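/- arXiv:2412.15825 — 2 statements merged into one kernel-verified Lean document; each statement's English description precedes it below -/
import Mathlib

section
/- Let d ≥ 1 be an integer, let f : [0,∞) → (0,∞) be Lipschitz with f(s) ≤ f(0) =: θ for all s ≥ 0, let φ : B₁' → ℝ be of class C^{1,1}, and let u be a solution of the two-phase thin obstacle problem in B₁ with ∫_{B₁⁺}(|u|² + |∇u|²) < ∞. Then there exists C > 0, depending only on d, θ, ‖u‖_{L²(B₁⁺)}, the Lipschitz constant of f, and ‖φ‖_{C¹(B₁')}, such that |∇u| ≤ C everywhere in B_{1/2}⁺. -/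
open MeasureTheory Set

/-- Euclidean space `ℝ^d`. -/
abbrev Esp (d : ℕ) := EuclideanSpace ℝ (Fin d)

/-- The upper half-ball `B_r⁺ = B_r ∩ {y > 0}` in `ℝ^{d+1} = ℝ^d × ℝ`. -/
def upBall (d : ℕ) (r : ℝ) : Set (Esp d × ℝ) := {p | ‖p.1‖^2 + p.2^2 < r^2 ∧ 0 < p.2}

/-- The thin ball `B_r' = B_r ∩ {y = 0}` in `ℝ^{d+1} = ℝ^d × ℝ`. -/
def flatBall (d : ℕ) (r : ℝ) : Set (Esp d × ℝ) := {p | ‖p.1‖^2 + p.2^2 < r^2 ∧ p.2 = 0}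

/-- Laplacian on `ℝ^d × ℝ`, computed through iterated coordinate derivatives. -/
noncomputable def lapH (d : ℕ) (u : Esp d × ℝ → ℝ) (p : Esp d × ℝ) : ℝ :=
  (∑ i : Fin d,
    deriv (deriv (fun t : ℝ => u (p.1 + t • EuclideanSpace.single i (1:ℝ), p.2))) 0)
  + deriv (deriv (fun t : ℝ => u (p.1, p.2 + t))) 0

/-- `u` is harmonic on the open set `U`: it is `C²` there and its Laplacian vanishes. -/
def HarmonicOnH (d : ℕ) (u : Esp d × ℝ → ℝ) (U : Set (Esp d × ℝ)) : Prop :=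
  ContDiffOn ℝ 2 u U ∧ ∀ p ∈ U, lapH d u p = 0

/-- Vertical partial derivative `∂_y u`. -/
noncomputable def pdy (d : ℕ) (u : Esp d × ℝ → ℝ) (p : Esp d × ℝ) : ℝ :=
  deriv (fun t : ℝ => u (p.1, p.2 + t)) 0

/-- Squared norm of the tangential gradient `|∇_x u|²`. -/
noncomputable def tangGradSq (d : ℕ) (u : Esp d × ℝ → ℝ) (p : Esp d × ℝ) : ℝ :=
  ∑ i : Fin d,
    (deriv (fun t : ℝ => u (p.1 + t • EuclideanSpace.single i (1:ℝ), p.2)) 0)^2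

/-- Squared norm of the full gradient `|∇u|²`. -/
noncomputable def gradSqH (d : ℕ) (u : Esp d × ℝ → ℝ) (p : Esp d × ℝ) : ℝ :=
  tangGradSq d u p + (pdy d u p)^2

/-- `L` is the one-sided vertical derivative `∂_y u(x,0⁺)`. -/
def NormalDeriv (d : ℕ) (u : Esp d × ℝ → ℝ) (x : Esp d) (L : ℝ) : Prop :=
  Filter.Tendsto (fun t => (u (x, t) - u (x, 0)) / t) (nhdsWithin 0 (Set.Ioi 0)) (nhds L)

/-- `f : [0,∞) → (0,∞)` is `L`-Lipschitz with `f ≤ f 0 = θ`. -/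
def GoodF (θ L : ℝ) (f : ℝ → ℝ) : Prop :=
  f 0 = θ ∧ (∀ s : ℝ, 0 ≤ s → 0 < f s ∧ f s ≤ θ) ∧
  (∀ s t : ℝ, 0 ≤ s → 0 ≤ t → |f s - f t| ≤ L * |s - t|)

/-- `u` is a solution of the two-phase thin obstacle problem in `B₁` with nonlinearity `f`
and obstacle `φ`: continuous on `B₁⁺ ∪ B₁'`, harmonic in `B₁⁺`, and on `B₁'` the one-sided
vertical derivative exists, is bounded by `θ` in absolute value, and equals
`f(|u−φ|)·sign(u−φ)` off the contact set. -/
def TwoPhaseSolH (d : ℕ) (θ : ℝ) (f : ℝ → ℝ) (φ : Esp d → ℝ) (u : Esp d × ℝ → ℝ) : Prop :=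
  ContinuousOn u (upBall d 1 ∪ flatBall d 1) ∧
  HarmonicOnH d u (upBall d 1) ∧
  ∀ x : Esp d, ‖x‖ < 1 → ∃ L : ℝ, NormalDeriv d u x L ∧ |L| ≤ θ ∧
    (u (x, 0) ≠ φ x → L = f |u (x, 0) - φ x| * Real.sign (u (x, 0) - φ x))

/-- `φ` is of class `C^{1,1}` on `B₁'` with `C^{1,1}` norm at most `P`. -/
def C11Bound (d : ℕ) (P : ℝ) (φ : Esp d → ℝ) : Prop :=
  (∀ x : Esp d, ‖x‖ < 1 → DifferentiableAt ℝ φ x ∧ |φ x| ≤ P ∧ ‖fderiv ℝ φ x‖ ≤ P) ∧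
  (∀ x y : Esp d, ‖x‖ < 1 → ‖y‖ < 1 → ‖fderiv ℝ φ x - fderiv ℝ φ y‖ ≤ P * ‖x - y‖)

/-- The coordinate directions of `ℝ^d × ℝ`; `none` is the vertical one. -/
noncomputable def coordVec (d : ℕ) : Option (Fin d) → Esp d × ℝ
  | none => (0, 1)
  | some i => (EuclideanSpace.single i 1, 0)

/-- The coordinates of a point of `ℝ^d × ℝ`. -/
def coordOf (d : ℕ) (z : Esp d × ℝ) : Option (Fin d) → ℝ
  | none => z.2
  | some i => z.1 i

/-- The squared Euclidean norm on `ℝ^d × ℝ`. -/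
noncomputable def euclSq (d : ℕ) (z : Esp d × ℝ) : ℝ := ‖z.1‖ ^ 2 + z.2 ^ 2

/-- The second derivative of `u` at `p` along the line of direction `v`. -/
noncomputable def secondDeriv {E : Type*} [AddCommGroup E] [Module ℝ E]
    (u : E → ℝ) (v p : E) : ℝ :=
  deriv (deriv (fun t : ℝ => u (p + t • v))) 0

lemma sum_coordOf_smul_coordVec (d : ℕ) (z : Esp d × ℝ) :
    ∑ o, coordOf d z o • coordVec d o = z := by
  rw [Fintype.sum_option]
  simp only [coordOf, coordVec]
  have h : ∑ i : Fin d, z.1 i • (EuclideanSpace.single i (1 : ℝ) : Esp d) = z.1 := by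
    ext j
    simp [Pi.single_apply]
  refine Prod.ext ?_ ?_
  · simp [Prod.fst_sum, h]
  · simp [Prod.snd_sum]

lemma lapH_eq_sum (d : ℕ) (u : Esp d × ℝ → ℝ) (p : Esp d × ℝ) :
    lapH d u p = ∑ o, secondDeriv u (coordVec d o) p := by
  rw [Fintype.sum_option, add_comm]
  simp only [lapH, secondDeriv, coordVec]
  congr 1
  · refine Finset.sum_congr rfl fun i _ => ?_
    congr 2
    funext t
    congr 1
    ext <;> simp
  · congr 2
    funext t
    congr 1
    ext <;> simp

section Line

variable {E : Type*} [NormedAddCommGroup E] [NormedSpace ℝ E] {u : E → ℝ} {p : E}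

lemma eventually_hasDerivAt_line (hu : ContDiffAt ℝ 2 u p) (v : E) :
    ∀ᶠ t in nhds (0 : ℝ),
      HasDerivAt (fun s : ℝ => u (p + s • v)) (fderiv ℝ u (p + t • v) v) t := by
  have h1 : ∀ᶠ q in nhds p, DifferentiableAt ℝ u q := by
    filter_upwards [hu.eventually (by simp)] with q hq
    exact hq.differentiableAt (by simp)
  have hc : Filter.Tendsto (fun t : ℝ => p + t • v) (nhds 0) (nhds p) := by
    have : Continuous fun t : ℝ => p + t • v := by fun_prop
    simpa using this.tendsto 0
  filter_upwards [hc.eventually h1] with t ht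
  have := ht.hasFDerivAt.comp_hasDerivAt t
    (((hasDerivAt_id t).smul_const v).const_add p)
  simpa [Function.comp_def] using this

lemma contDiffAt_fderiv_apply (hu : ContDiffAt ℝ 2 u p) (v : E) :
    ContDiffAt ℝ 1 (fun q => fderiv ℝ u q v) p :=
  (hu.fderiv_right (m := 1) (by norm_num)).clm_apply contDiffAt_const

lemma hasDerivAt_fderiv_line (hu : ContDiffAt ℝ 2 u p) (v : E) :
    HasDerivAt (fun t : ℝ => fderiv ℝ u (p + t • v) v)
      (fderiv ℝ (fun q => fderiv ℝ u q v) p v) 0 := by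
  have h := (contDiffAt_fderiv_apply hu v).differentiableAt (by simp)
  have h' : HasFDerivAt (fun q => fderiv ℝ u q v) (fderiv ℝ (fun q => fderiv ℝ u q v) p)
      (p + (0 : ℝ) • v) := by simpa using h.hasFDerivAt
  have := h'.comp_hasDerivAt (0 : ℝ) (((hasDerivAt_id (0 : ℝ)).smul_const v).const_add p)
  simpa [Function.comp_def] using this

lemma secondDeriv_eq_fderiv (hu : ContDiffAt ℝ 2 u p) (v : E) :
    secondDeriv u v p = fderiv ℝ (fun q => fderiv ℝ u q v) p v := by
  unfold secondDeriv
  have : deriv (fun t : ℝ => u (p + t • v)) =ᶠ[nhds 0] fun t => fderiv ℝ u (p + t • v) v := by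
    filter_upwards [eventually_hasDerivAt_line hu v] with t ht using ht.deriv
  rw [this.deriv_eq]
  exact (hasDerivAt_fderiv_line hu v).deriv

end Line

section MeanValue

lemma hasDerivAt_max_zero_cube (s : ℝ) :
    HasDerivAt (fun s : ℝ => max s 0 ^ 3) (3 * max s 0 ^ 2) s := by
  rcases lt_trichotomy s 0 with h | rfl | h
  · have : (fun s : ℝ => max s 0 ^ 3) =ᶠ[nhds s] fun _ => 0 := by
      filter_upwards [gt_mem_nhds h] with t ht
      simp [max_eq_right ht.le]
    rw [max_eq_right h.le]
    simpa using (hasDerivAt_const s (0 : ℝ)).congr_of_eventuallyEq this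
  · rw [hasDerivAt_iff_isLittleO_nhds_zero]
    simp only [zero_add, max_self]
    refine Asymptotics.IsBigO.trans_isLittleO (g := fun h : ℝ => h ^ 3) ?_ ?_
    · refine Asymptotics.IsBigO.of_bound 1 (Filter.Eventually.of_forall fun h => ?_)
      rcases le_total h 0 with hh | hh
      · simp [max_eq_right hh]
      · simp [max_eq_left hh]
    · simpa using Asymptotics.isLittleO_pow_pow (𝕜 := ℝ) (m := 1) (n := 3) (by norm_num)
  · have : (fun s : ℝ => max s 0 ^ 3) =ᶠ[nhds s] fun t => t ^ 3 := by
      filter_upwards [lt_mem_nhds h] with t ht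
      simp [max_eq_left ht.le]
    rw [max_eq_left h.le]
    simpa using (hasDerivAt_pow 3 s).congr_of_eventuallyEq this

/-- The averaging kernel `(1 - |z|²)₊²`. -/
noncomputable def avgKernel (d : ℕ) (z : Esp d × ℝ) : ℝ := max (1 - euclSq d z) 0 ^ 2

/-- A potential whose gradient is `-z` times the averaging kernel. -/
noncomputable def avgPotential (d : ℕ) (z : Esp d × ℝ) : ℝ := max (1 - euclSq d z) 0 ^ 3 / 6

variable {d : ℕ}

instance isAddHaarMeasure_volume_halfSpace :
    (volume : Measure (Esp d × ℝ)).IsAddHaarMeasure :=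
  inferInstanceAs ((volume : Measure (Esp d)).prod (volume : Measure ℝ)).IsAddHaarMeasure

lemma continuous_euclSq : Continuous (euclSq d) := by
  unfold euclSq; fun_prop

lemma continuous_avgKernel : Continuous (avgKernel d) := by
  unfold avgKernel
  have := continuous_euclSq (d := d)
  fun_prop

lemma continuous_avgPotential : Continuous (avgPotential d) := by
  unfold avgPotential
  have := continuous_euclSq (d := d)
  fun_prop

lemma isCompact_euclSq_le : IsCompact {z : Esp d × ℝ | euclSq d z ≤ 1} := by
  refine IsCompact.of_isClosed_subset (isCompact_closedBall (0 : Esp d × ℝ) 1)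
    (isClosed_le continuous_euclSq continuous_const) fun z hz => ?_
  simp only [mem_ofPred_eq, euclSq] at hz
  rw [mem_closedBall_zero_iff, Prod.norm_def]
  refine max_le ?_ ?_
  · nlinarith [sq_nonneg z.2, norm_nonneg z.1]
  · rw [Real.norm_eq_abs]
    exact abs_le_one_iff_mul_self_le_one.2 (by nlinarith [sq_nonneg ‖z.1‖])

lemma avgKernel_eq_zero {z : Esp d × ℝ} (h : 1 ≤ euclSq d z) : avgKernel d z = 0 := by
  simp [avgKernel, max_eq_right (sub_nonpos.2 h)]

lemma avgPotential_eq_zero {z : Esp d × ℝ} (h : 1 ≤ euclSq d z) : avgPotential d z = 0 := by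
  simp [avgPotential, max_eq_right (sub_nonpos.2 h)]

lemma avgKernel_nonneg (z : Esp d × ℝ) : 0 ≤ avgKernel d z := by
  unfold avgKernel; positivity

lemma avgKernel_le_one (z : Esp d × ℝ) : avgKernel d z ≤ 1 := by
  unfold avgKernel
  refine pow_le_one₀ (le_max_right _ _) (max_le ?_ zero_le_one)
  have : 0 ≤ euclSq d z := by unfold euclSq; positivity
  linarith

lemma hasCompactSupport_avgKernel : HasCompactSupport (avgKernel d) :=
  HasCompactSupport.intro isCompact_euclSq_le fun z hz =>
    avgKernel_eq_zero (by simpa using (not_le.1 hz).le)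

lemma hasCompactSupport_avgPotential : HasCompactSupport (avgPotential d) :=
  HasCompactSupport.intro isCompact_euclSq_le fun z hz =>
    avgPotential_eq_zero (by simpa using (not_le.1 hz).le)

lemma integral_avgKernel_pos : 0 < ∫ z, avgKernel d z := by
  refine continuous_avgKernel.integral_pos_of_hasCompactSupport_nonneg_nonzero
    hasCompactSupport_avgKernel avgKernel_nonneg (x := 0) ?_
  simp [avgKernel, euclSq]

lemma hasFDerivAt_euclSq (z : Esp d × ℝ) :
    HasFDerivAt (euclSq d)
      ((2 • innerSL ℝ z.1).comp (ContinuousLinearMap.fst ℝ (Esp d) ℝ) +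
        (2 * z.2) • ContinuousLinearMap.snd ℝ (Esp d) ℝ) z := by
  have h1 : HasFDerivAt (fun z : Esp d × ℝ => z.1) (ContinuousLinearMap.fst ℝ (Esp d) ℝ) z :=
    hasFDerivAt_fst
  have h2 : HasFDerivAt (fun z : Esp d × ℝ => z.2) (ContinuousLinearMap.snd ℝ (Esp d) ℝ) z :=
    hasFDerivAt_snd
  have h3 := h1.norm_sq.add (h2.pow 2)
  refine h3.congr_fderiv ?_
  ext <;> simp

lemma hasFDerivAt_avgPotential (z : Esp d × ℝ) :
    HasFDerivAt (avgPotential d)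
      ((-(avgKernel d z) / 2) •
        ((2 • innerSL ℝ z.1).comp (ContinuousLinearMap.fst ℝ (Esp d) ℝ) +
        (2 * z.2) • ContinuousLinearMap.snd ℝ (Esp d) ℝ)) z := by
  have h1 := ((hasDerivAt_max_zero_cube (1 - euclSq d z)).div_const 6).comp_hasFDerivAt z
    ((hasFDerivAt_euclSq z).const_sub 1)
  refine h1.congr_fderiv ?_
  rw [smul_neg, ← neg_smul]
  congr 1
  unfold avgKernel
  ring

lemma fderiv_avgPotential_coordVec (z : Esp d × ℝ) (o : Option (Fin d)) :
    fderiv ℝ (avgPotential d) z (coordVec d o) = -(coordOf d z o * avgKernel d z) := by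
  rw [(hasFDerivAt_avgPotential z).fderiv]
  cases o with
  | none => simp [coordVec, coordOf]; ring
  | some i => simp [coordVec, coordOf, EuclideanSpace.inner_single_right]; ring

lemma continuous_coordOf (o : Option (Fin d)) : Continuous fun z => coordOf d z o := by
  cases o with
  | none => exact continuous_snd
  | some i => simp only [coordOf]; fun_prop

/-- The radial derivative of a function harmonic near the unit ball has zero weighted mean. -/
lemma integral_fderiv_mul_avgKernel {w : Esp d × ℝ → ℝ} (hw : ContDiff ℝ 2 w)
    (hlap : ∀ z, euclSq d z < 2 → lapH d w z = 0) {t : ℝ} (ht0 : 0 ≤ t) (ht1 : t ≤ 1) :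
    ∫ z, fderiv ℝ w (t • z) z * avgKernel d z = 0 := by
  have hC1 : ∀ v, ContDiff ℝ 1 fun q => fderiv ℝ w q v := fun v =>
    (hw.fderiv_right (m := 1) (by norm_num)).clm_apply contDiff_const
  have hg : ∀ o, ContDiff ℝ 1 fun z => fderiv ℝ w (t • z) (coordVec d o) := fun o =>
    (hC1 _).comp (contDiff_const_smul t)
  have hder : ∀ o z, fderiv ℝ (fun z => fderiv ℝ w (t • z) (coordVec d o)) z (coordVec d o) =
      t * secondDeriv w (coordVec d o) (t • z) := by
    intro o z
    rw [secondDeriv_eq_fderiv hw.contDiffAt]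
    have h1 : HasFDerivAt (fun q => fderiv ℝ w q (coordVec d o)) _ (t • z) :=
      (((hC1 (coordVec d o)).differentiable (by simp)) (t • z)).hasFDerivAt
    have h2 := h1.comp z ((hasFDerivAt_id z).const_smul t)
    have h3 : fderiv ℝ (fun z => fderiv ℝ w (t • z) (coordVec d o)) z = _ := h2.fderiv
    rw [h3]
    simp
  have hibp : ∀ o, ∫ z, fderiv ℝ w (t • z) (coordVec d o) * (coordOf d z o * avgKernel d z) =
      ∫ z, t * secondDeriv w (coordVec d o) (t • z) * avgPotential d z := by
    intro o
    have hdiff : Differentiable ℝ (avgPotential d) := fun z =>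
      (hasFDerivAt_avgPotential z).differentiableAt
    have h := integral_mul_fderiv_eq_neg_fderiv_mul_of_integrable (μ := volume)
      (f := fun z => fderiv ℝ w (t • z) (coordVec d o)) (g := avgPotential d) (v := coordVec d o)
      ?_ ?_ ?_ (fun x _ => (hg o).differentiable (by simp) x) (fun x _ => hdiff x)
    · simp only [fderiv_avgPotential_coordVec, mul_neg, integral_neg, neg_inj, hder] at h
      exact h
    · refine Continuous.integrable_of_hasCompactSupport ?_ hasCompactSupport_avgPotential.mul_left
      exact (((hg o).continuous_fderiv (by simp)).clm_apply continuous_const).mul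
        continuous_avgPotential
    · simp only [fderiv_avgPotential_coordVec]
      refine Continuous.integrable_of_hasCompactSupport ?_ ?_
      · exact (hg o).continuous.mul ((continuous_coordOf o).mul continuous_avgKernel).neg
      · exact (hasCompactSupport_avgKernel.mul_left (f := fun z => coordOf d z o)).neg.mul_left
    · exact Continuous.integrable_of_hasCompactSupport
        ((hg o).continuous.mul continuous_avgPotential) hasCompactSupport_avgPotential.mul_left
  have hsd : ∀ o, Continuous fun z => t * secondDeriv w (coordVec d o) (t • z) := by
    intro o
    simp only [← hder]
    exact ((hg o).continuous_fderiv (by simp)).clm_apply continuous_const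
  calc ∫ z, fderiv ℝ w (t • z) z * avgKernel d z
      = ∫ z, ∑ o, fderiv ℝ w (t • z) (coordVec d o) * (coordOf d z o * avgKernel d z) := by
        refine integral_congr_ae (Filter.Eventually.of_forall fun z => ?_)
        simp only
        conv_lhs => rw [show fderiv ℝ w (t • z) z =
          fderiv ℝ w (t • z) (∑ o, coordOf d z o • coordVec d o) by
            rw [sum_coordOf_smul_coordVec]]
        rw [map_sum, Finset.sum_mul]
        refine Finset.sum_congr rfl fun o _ => ?_
        rw [map_smul, smul_eq_mul]
        ring
    _ = ∑ o, ∫ z, fderiv ℝ w (t • z) (coordVec d o) * (coordOf d z o * avgKernel d z) := by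
        refine integral_finsetSum _ fun o _ => ?_
        refine Continuous.integrable_of_hasCompactSupport
          ((hg o).continuous.mul ((continuous_coordOf o).mul continuous_avgKernel)) ?_
        exact (hasCompactSupport_avgKernel.mul_left (f := fun z => coordOf d z o)).mul_left
    _ = ∑ o, ∫ z, t * secondDeriv w (coordVec d o) (t • z) * avgPotential d z :=
        Finset.sum_congr rfl fun o _ => hibp o
    _ = ∫ z, ∑ o, t * secondDeriv w (coordVec d o) (t • z) * avgPotential d z := by
        refine (integral_finsetSum _ fun o _ => ?_).symm
        exact Continuous.integrable_of_hasCompactSupport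
          ((hsd o).mul continuous_avgPotential) hasCompactSupport_avgPotential.mul_left
    _ = ∫ z : Esp d × ℝ, 0 := by
        refine integral_congr_ae (Filter.Eventually.of_forall fun z => ?_)
        simp only
        rw [← Finset.sum_mul, ← Finset.mul_sum, ← lapH_eq_sum]
        by_cases hz : 1 ≤ euclSq d z
        · rw [avgPotential_eq_zero hz, mul_zero]
        · have : euclSq d (t • z) < 2 := by
            have h1 : euclSq d (t • z) = t ^ 2 * euclSq d z := by
              simp [euclSq, norm_smul, mul_pow]; ring
            have h2 : 0 ≤ euclSq d z := by unfold euclSq; positivity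
            rw [h1]
            nlinarith [pow_le_one₀ ht0 ht1 (n := 2)]
          rw [hlap _ this]
          ring
    _ = 0 := by simp

/-- Weighted mean value property. -/
lemma mul_integral_avgKernel_eq {w : Esp d × ℝ → ℝ} (hw : ContDiff ℝ 2 w)
    (hlap : ∀ z, euclSq d z < 2 → lapH d w z = 0) :
    w 0 * ∫ z, avgKernel d z = ∫ z, w z * avgKernel d z := by
  have hcd : Continuous (fderiv ℝ w) := hw.continuous_fderiv (by simp)
  have hF : ∀ t₀ : ℝ, HasDerivAt (fun t : ℝ => ∫ z, w (t • z) * avgKernel d z)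
      (∫ z, fderiv ℝ w (t₀ • z) z * avgKernel d z) t₀ := by
    intro t₀
    have hjoint : Continuous fun q : ℝ × (Esp d × ℝ) =>
        fderiv ℝ w (q.1 • q.2) q.2 * avgKernel d q.2 := by
      have := continuous_avgKernel (d := d)
      exact ((hcd.comp (by fun_prop)).clm_apply continuous_snd).mul (by fun_prop)
    obtain ⟨C, hC⟩ := ((isCompact_closedBall t₀ 1).prod
      (isCompact_euclSq_le (d := d))).exists_bound_of_continuousOn hjoint.continuousOn
    refine (hasDerivAt_integral_of_dominated_loc_of_deriv_le
      (F := fun t z => w (t • z) * avgKernel d z)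
      (F' := fun t z => fderiv ℝ w (t • z) z * avgKernel d z)
      (bound := {z : Esp d × ℝ | euclSq d z ≤ 1}.indicator fun _ => C)
      (Metric.ball_mem_nhds t₀ one_pos) ?_ ?_ ?_ ?_ ?_ ?_).2
    · refine Filter.Eventually.of_forall fun t => Continuous.aestronglyMeasurable ?_
      exact (hw.continuous.comp (continuous_const_smul t)).mul continuous_avgKernel
    · exact Continuous.integrable_of_hasCompactSupport
        ((hw.continuous.comp (continuous_const_smul t₀)).mul continuous_avgKernel)
        hasCompactSupport_avgKernel.mul_left
    · refine Continuous.aestronglyMeasurable ?_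
      exact hjoint.comp (Continuous.prodMk_right t₀)
    · refine Filter.Eventually.of_forall fun z t ht => ?_
      by_cases hz : euclSq d z ≤ 1
      · rw [indicator_of_mem (by exact hz)]
        exact hC (t, z) ⟨Metric.ball_subset_closedBall ht, hz⟩
      · rw [indicator_of_notMem (by exact hz), avgKernel_eq_zero (not_le.1 hz).le]
        simp
    · rw [integrable_indicator_iff isCompact_euclSq_le.measurableSet]
      exact integrableOn_const isCompact_euclSq_le.measure_lt_top.ne
    · refine Filter.Eventually.of_forall fun z t _ => ?_
      have h1 := (hw.differentiable (by simp) (t • z)).hasFDerivAt.comp_hasDerivAt t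
        ((hasDerivAt_id t).smul_const z)
      simpa using h1.mul_const (avgKernel d z)
  have hconst := constant_of_has_deriv_right_zero (a := 0) (b := 1)
    (f := fun t : ℝ => ∫ z, w (t • z) * avgKernel d z)
    (fun t _ => (hF t).continuousAt.continuousWithinAt)
    (fun t ht => by
      have := hF t
      rw [integral_fderiv_mul_avgKernel hw hlap ht.1 ht.2.le] at this
      exact this.hasDerivWithinAt) 1 (by simp)
  simp only [one_smul, zero_smul] at hconst
  rw [hconst, integral_const_mul]

end MeanValue

section InteriorBound

variable {d : ℕ}

lemma secondDeriv_comp_affine (u : Esp d × ℝ → ℝ) (p v z : Esp d × ℝ) (r : ℝ) :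
    secondDeriv (fun z => u (p + r • z)) v z = r ^ 2 * secondDeriv u v (p + r • z) := by
  unfold secondDeriv
  have h : (fun t : ℝ => u (p + r • (z + t • v))) =
      fun t => (fun s : ℝ => u (p + r • z + s • v)) (r * t) := by
    funext t
    simp only
    congr 1
    rw [smul_add, smul_smul, add_assoc]
  have h' : deriv (fun t : ℝ => u (p + r • (z + t • v))) =
      fun t => r * deriv (fun s : ℝ => u (p + r • z + s • v)) (r * t) := by
    rw [h]
    funext t
    exact deriv_comp_mul_left r (fun s : ℝ => u (p + r • z + s • v)) t
  rw [h', deriv_const_mul_field, deriv_comp_mul_left]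
  simp only [smul_eq_mul, mul_zero]
  ring

lemma secondDeriv_congr {E : Type*} [NormedAddCommGroup E] [NormedSpace ℝ E] {u w : E → ℝ} {p : E}
    (h : u =ᶠ[nhds p] w) (v : E) : secondDeriv u v p = secondDeriv w v p := by
  have hc : Filter.Tendsto (fun t : ℝ => p + t • v) (nhds 0) (nhds p) := by
    have : Continuous fun t : ℝ => p + t • v := by fun_prop
    simpa using this.tendsto 0
  have h1 : (fun t : ℝ => u (p + t • v)) =ᶠ[nhds 0] fun t => w (p + t • v) := hc.eventually h
  exact h1.deriv.deriv_eq

lemma isOpen_upBall (r : ℝ) : IsOpen (upBall d r) := by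
  have h1 : IsOpen {p : Esp d × ℝ | ‖p.1‖ ^ 2 + p.2 ^ 2 < r ^ 2} :=
    isOpen_lt (by fun_prop) continuous_const
  have h2 : IsOpen {p : Esp d × ℝ | 0 < p.2} := isOpen_lt continuous_const continuous_snd
  exact h1.inter h2

/-- A function harmonic near a closed ball is controlled at the centre by its square integral. -/
lemma abs_mul_integral_avgKernel_le {U : Set (Esp d × ℝ)} (hU : IsOpen U) {u : Esp d × ℝ → ℝ}
    (hu : ContDiffOn ℝ 2 u U) (hlap : ∀ p ∈ U, lapH d u p = 0)
    (hint : IntegrableOn (fun p => u p ^ 2) U) {p : Esp d × ℝ} {r : ℝ} (hr : 0 < r)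
    (hball : ∀ z, euclSq d z < 4 → p + r • z ∈ U) :
    |u p| * ∫ z, avgKernel d z ≤
      volume.real {z : Esp d × ℝ | euclSq d z ≤ 1} + (r⁻¹) ^ (d + 1) * ∫ q in U, u q ^ 2 := by
  have hQ := continuous_euclSq (d := d)
  set w : Esp d × ℝ → ℝ := fun z => Real.smoothTransition (3 - euclSq d z) * u (p + r • z) with hw
  have hQs : ContDiff ℝ 2 (euclSq d) := by
    unfold euclSq
    exact (contDiff_fst.norm_sq ℝ).add (contDiff_snd.pow 2)
  have hcomp : ∀ z, euclSq d z < 4 → ContDiffAt ℝ 2 (fun z => u (p + r • z)) z := fun z hz =>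
    (hu.contDiffAt (hU.mem_nhds (hball z hz))).comp z
      (contDiff_const.add (contDiff_const_smul r)).contDiffAt
  have hwc : ContDiff ℝ 2 w := by
    rw [contDiff_iff_contDiffAt]
    intro z
    rcases lt_or_ge (euclSq d z) 4 with hz | hz
    · exact ((Real.smoothTransition.contDiff.comp (contDiff_const.sub hQs)).contDiffAt).mul
        (hcomp z hz)
    · have : w =ᶠ[nhds z] fun _ => 0 := by
        filter_upwards [(isOpen_lt continuous_const hQ).mem_nhds
          (show (3 : ℝ) < euclSq d z by linarith)] with y hy
        have hy' : (3 : ℝ) < euclSq d y := hy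
        simp only [hw]
        rw [Real.smoothTransition.zero_of_nonpos (by linarith), zero_mul]
      exact contDiffAt_const.congr_of_eventuallyEq this
  have hwlap : ∀ z, euclSq d z < 2 → lapH d w z = 0 := by
    intro z hz
    have hev : w =ᶠ[nhds z] fun z => u (p + r • z) := by
      filter_upwards [(isOpen_lt hQ continuous_const).mem_nhds hz] with y hy
      have hy' : euclSq d y < 2 := hy
      simp only [hw]
      rw [Real.smoothTransition.one_of_one_le (by linarith), one_mul]
    rw [lapH_eq_sum]
    simp only [secondDeriv_congr hev, secondDeriv_comp_affine]
    rw [← Finset.mul_sum, ← lapH_eq_sum, hlap _ (hball z (by linarith)), mul_zero]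
  have hmean := mul_integral_avgKernel_eq hwc hwlap
  have hw0 : w 0 = u p := by
    simp only [hw, smul_zero, add_zero]
    rw [Real.smoothTransition.one_of_one_le (by simp [euclSq]), one_mul]
  set g : Esp d × ℝ → ℝ := U.indicator fun q => u q ^ 2 with hg
  have hgi : Integrable g := by
    rw [hg, integrable_indicator_iff hU.measurableSet]
    exact hint
  have hgi' : Integrable fun z => g (p + r • z) := (hgi.comp_add_left p).comp_smul hr.ne'
  have hgint : ∫ z, g (p + r • z) = (r⁻¹) ^ (d + 1) * ∫ q in U, u q ^ 2 := by
    have h1 := Measure.integral_comp_smul (volume : Measure (Esp d × ℝ)) (fun z => g (p + z)) r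
    rw [h1, integral_add_left_eq_self g p, hg, integral_indicator hU.measurableSet]
    simp only [Module.finrank_prod, finrank_euclideanSpace, Fintype.card_fin, Module.finrank_self,
      smul_eq_mul]
    rw [abs_of_pos (by positivity), inv_pow]
  set S : Set (Esp d × ℝ) := {z | euclSq d z ≤ 1} with hS
  have hSi : Integrable (S.indicator fun _ : Esp d × ℝ => (1 : ℝ)) := by
    rw [integrable_indicator_iff isCompact_euclSq_le.measurableSet]
    exact integrableOn_const isCompact_euclSq_le.measure_lt_top.ne
  have hSint : ∫ z, S.indicator (fun _ : Esp d × ℝ => (1 : ℝ)) z = volume.real S := by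
    rw [integral_indicator isCompact_euclSq_le.measurableSet]
    simp [hS]
  have hbound : ∀ z, ‖w z * avgKernel d z‖ ≤
      S.indicator (fun _ => (1 : ℝ)) z + g (p + r • z) := by
    intro z
    have hg0 : 0 ≤ g (p + r • z) := indicator_nonneg (fun _ _ => sq_nonneg _) _
    by_cases hz : euclSq d z ≤ 1
    · rw [indicator_of_mem (show z ∈ S from hz), hg,
        indicator_of_mem (hball z (by linarith))]
      have hwz : w z = u (p + r • z) := by
        simp only [hw]
        rw [Real.smoothTransition.one_of_one_le (by linarith), one_mul]
      rw [norm_mul, hwz, Real.norm_eq_abs, Real.norm_eq_abs, abs_of_nonneg (avgKernel_nonneg z)]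
      have h1 := mul_le_mul_of_nonneg_left (avgKernel_le_one z) (abs_nonneg (u (p + r • z)))
      nlinarith [sq_abs (u (p + r • z)), sq_nonneg (|u (p + r • z)| - 1)]
    · rw [avgKernel_eq_zero (not_le.1 hz).le]
      simp only [mul_zero, norm_zero]
      exact add_nonneg (indicator_nonneg (fun _ _ => zero_le_one) _) hg0
  calc |u p| * ∫ z, avgKernel d z = ‖∫ z, w z * avgKernel d z‖ := by
        rw [← hmean, hw0, norm_mul, Real.norm_eq_abs, Real.norm_eq_abs,
          abs_of_pos integral_avgKernel_pos]
    _ ≤ ∫ z, (S.indicator (fun _ => (1 : ℝ)) z + g (p + r • z)) :=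
        norm_integral_le_of_norm_le (hSi.add hgi') (Filter.Eventually.of_forall hbound)
    _ = volume.real S + (r⁻¹) ^ (d + 1) * ∫ q in U, u q ^ 2 := by
        rw [integral_add hSi hgi', hSint, hgint]

/-- Interior estimate: the `L²` norm controls a harmonic function up to a power of the height. -/
lemma exists_interior_bound (d : ℕ) (A : ℝ) :
    ∃ C > 0, ∀ u : Esp d × ℝ → ℝ, HarmonicOnH d u (upBall d 1) →
      IntegrableOn (fun p => u p ^ 2) (upBall d 1) → ∫ p in upBall d 1, u p ^ 2 ≤ A ^ 2 →
      ∀ p ∈ upBall d (9 / 10), |u p| ≤ C * (p.2⁻¹) ^ (d + 1) := by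
  set V := volume.real {z : Esp d × ℝ | euclSq d z ≤ 1}
  have hV : 0 ≤ V := measureReal_nonneg
  have hI := integral_avgKernel_pos (d := d)
  refine ⟨(V + 20 ^ (d + 1) * A ^ 2 + 1) / ∫ z, avgKernel d z, by positivity, ?_⟩
  rintro u ⟨hu, hlap⟩ hint hA p ⟨hp1, hp2⟩
  have hball : ∀ z, euclSq d z < 4 → p + (p.2 / 20) • z ∈ upBall d 1 := by
    intro z hz
    simp only [euclSq] at hz
    have hz2 : |z.2| < 2 := abs_lt_of_sq_lt_sq (by nlinarith [sq_nonneg ‖z.1‖]) (by norm_num)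
    obtain ⟨hz2a, hz2b⟩ := abs_lt.1 hz2
    have hn : ‖p.1 + (p.2 / 20) • z.1‖ ≤ ‖p.1‖ + p.2 / 20 * ‖z.1‖ := by
      refine (norm_add_le _ _).trans ?_
      rw [norm_smul, Real.norm_eq_abs, abs_of_pos (by positivity)]
    have hn2 : ‖p.1 + (p.2 / 20) • z.1‖ ^ 2 ≤
        1.1 * ‖p.1‖ ^ 2 + 11 * (p.2 / 20) ^ 2 * ‖z.1‖ ^ 2 := by
      have := pow_le_pow_left₀ (norm_nonneg _) hn 2
      nlinarith [sq_nonneg (‖p.1‖ - 10 * (p.2 / 20 * ‖z.1‖))]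
    have hn3 : (p.2 + p.2 / 20 * z.2) ^ 2 ≤ 1.1 * p.2 ^ 2 + 11 * (p.2 / 20) ^ 2 * z.2 ^ 2 := by
      nlinarith [sq_nonneg (p.2 - 10 * (p.2 / 20 * z.2))]
    have hp2sq : p.2 ^ 2 < (9 / 10) ^ 2 := by nlinarith [sq_nonneg ‖p.1‖]
    refine ⟨?_, ?_⟩
    · simp only [Prod.fst_add, Prod.smul_fst, Prod.snd_add, Prod.smul_snd, smul_eq_mul]
      have : 11 * (p.2 / 20) ^ 2 * (‖z.1‖ ^ 2 + z.2 ^ 2) ≤ 11 * (p.2 / 20) ^ 2 * 4 := by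
        gcongr
      nlinarith
    · simp only [Prod.snd_add, Prod.smul_snd, smul_eq_mul]
      nlinarith
  have h := abs_mul_integral_avgKernel_le (isOpen_upBall 1) hu hlap hint
    (show 0 < p.2 / 20 by positivity) hball
  have hp21 : p.2 ≤ 1 := by nlinarith [sq_nonneg ‖p.1‖]
  have h1 : 1 ≤ (p.2⁻¹) ^ (d + 1) := one_le_pow₀ ((one_le_inv₀ hp2).2 hp21)
  have h2 : ((p.2 / 20)⁻¹) ^ (d + 1) = 20 ^ (d + 1) * (p.2⁻¹) ^ (d + 1) := by
    rw [inv_div, div_eq_mul_inv, mul_pow]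
  rw [div_mul_eq_mul_div, le_div_iff₀ hI]
  refine h.trans ?_
  have h3 : (p.2 / 20)⁻¹ ^ (d + 1) * ∫ q in upBall d 1, u q ^ 2 ≤
      20 ^ (d + 1) * (p.2⁻¹) ^ (d + 1) * A ^ 2 := by
    rw [h2]
    gcongr
  nlinarith

end InteriorBound

section SecondDifference

variable {E : Type*} [NormedAddCommGroup E] [NormedSpace ℝ E] {u : E → ℝ} {p : E}

/-- The symmetric second difference of `u` at `p` in direction `v` with step `t`. -/
def secDiff (u : E → ℝ) (v p : E) (t : ℝ) : ℝ := u (p + t • v) + u (p - t • v) - 2 * u p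

lemma tendsto_secDiff (hu : ContDiffAt ℝ 2 u p) (v : E) :
    Filter.Tendsto (fun t => secDiff u v p t / t ^ 2) (nhdsWithin 0 (Ioi 0))
      (nhds (secondDeriv u v p)) := by
  have h1 := eventually_hasDerivAt_line hu v
  have hneg : Filter.Tendsto (fun t : ℝ => -t) (nhds 0) (nhds 0) := by
    simpa using (continuous_neg (G := ℝ)).tendsto 0
  have h2 := hneg.eventually h1
  have hder : ∀ᶠ t in nhds (0 : ℝ), HasDerivAt (fun t => secDiff u v p t)
      (fderiv ℝ u (p + t • v) v - fderiv ℝ u (p + (-t) • v) v) t := by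
    filter_upwards [h1, h2] with t ht ht'
    have h3 := ht'.scomp t (hasDerivAt_neg t)
    have h4 := (ht.add h3).sub_const (2 * u p)
    refine (h4.congr_deriv (by simp; ring)).congr_of_eventuallyEq ?_
    refine Filter.Eventually.of_forall fun s => ?_
    simp [secDiff, sub_eq_add_neg]
  have h0 := hasDerivAt_fderiv_line hu v
  have hd2 : HasDerivAt (fun t : ℝ => fderiv ℝ u (p + t • v) v - fderiv ℝ u (p + (-t) • v) v)
      (2 * secondDeriv u v p) 0 := by
    rw [secondDeriv_eq_fderiv hu]
    have h0' : HasDerivAt (fun t : ℝ => fderiv ℝ u (p + t • v) v)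
      (fderiv ℝ (fun q => fderiv ℝ u q v) p v) (-0) := by simpa using h0
    have h5 := h0.sub (h0'.scomp (0 : ℝ) (hasDerivAt_neg (0 : ℝ)))
    exact h5.congr_deriv (by simp; ring)
  have hle : nhdsWithin (0 : ℝ) (Ioi 0) ≤ nhds 0 := nhdsWithin_le_nhds
  refine HasDerivAt.lhopital_zero_nhdsGT (f := fun t => secDiff u v p t) (g := fun t => t ^ 2)
    (f' := fun t => fderiv ℝ u (p + t • v) v - fderiv ℝ u (p + (-t) • v) v)
    (g' := fun t => 2 * t) (hle hder)
    (Filter.Eventually.of_forall fun t => by simpa using hasDerivAt_pow 2 t) ?_ ?_ ?_ ?_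
  · filter_upwards [self_mem_nhdsWithin] with t ht
    have : (0 : ℝ) < t := ht
    positivity
  · have := hder.self_of_nhds.continuousAt.tendsto
    have h6 : secDiff u v p 0 = 0 := by simp [secDiff]; ring
    rw [h6] at this
    exact this.mono_left hle
  · have : Filter.Tendsto (fun t : ℝ => t ^ 2) (nhds 0) (nhds 0) := by
      simpa using (continuous_pow 2 : Continuous fun t : ℝ => t ^ 2).tendsto 0
    exact this.mono_left hle
  · have h7 := hd2.tendsto_slope_zero_right
    have h8 := h7.const_mul (1 / 2)
    rw [show 1 / 2 * (2 * secondDeriv u v p) = secondDeriv u v p by ring] at h8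
    refine h8.congr' ?_
    filter_upwards [self_mem_nhdsWithin] with t ht
    have ht' : (0 : ℝ) < t := ht
    simp
    field_simp

/-- Comparison of limits of second difference quotients. -/
lemma le_of_secDiff_le {f g : ℝ → ℝ} {a b : ℝ}
    (hf : Filter.Tendsto (fun t => f t / t ^ 2) (nhdsWithin 0 (Ioi 0)) (nhds a))
    (hg : Filter.Tendsto (fun t => g t / t ^ 2) (nhdsWithin 0 (Ioi 0)) (nhds b))
    (h : ∀ᶠ t in nhdsWithin (0 : ℝ) (Ioi 0), f t ≤ g t) : a ≤ b := by
  refine le_of_tendsto_of_tendsto hf hg ?_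
  filter_upwards [h] with t ht
  exact div_le_div_of_nonneg_right ht (sq_nonneg t)

lemma tendsto_mul_sq_div_sq (b : ℝ) :
    Filter.Tendsto (fun t : ℝ => b * t ^ 2 / t ^ 2) (nhdsWithin 0 (Ioi 0)) (nhds b) := by
  refine tendsto_const_nhds.congr' ?_
  filter_upwards [self_mem_nhdsWithin] with t ht
  have ht' : (0 : ℝ) < t := ht
  field_simp

/-- The second difference of `F` is at most that of `G` at a maximum point of `F - G` that is
interior along the given line. -/
lemma secDiff_le_of_isMaxOn {F G : E → ℝ} {s : Set E} {v : E}
    (hmax : IsMaxOn (fun q => F q - G q) s p)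
    (hs : ∀ᶠ t in nhds (0 : ℝ), p + t • v ∈ s) :
    ∀ᶠ t in nhdsWithin (0 : ℝ) (Ioi 0), secDiff F v p t ≤ secDiff G v p t := by
  have hneg : Filter.Tendsto (fun t : ℝ => -t) (nhds 0) (nhds 0) := by
    simpa using (continuous_neg (G := ℝ)).tendsto 0
  have h := hs.and (hneg.eventually hs)
  filter_upwards [nhdsWithin_le_nhds h] with t ht
  have h1 : F (p + t • v) - G (p + t • v) ≤ F p - G p := hmax ht.1
  have h2 : F (p + -t • v) - G (p + -t • v) ≤ F p - G p := hmax ht.2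
  rw [neg_smul, ← sub_eq_add_neg] at h2
  unfold secDiff
  linarith

lemma eventually_line_mem {s : Set E} (hs : s ∈ nhds p) (v : E) :
    ∀ᶠ t in nhds (0 : ℝ), p + t • v ∈ s := by
  have hc : Filter.Tendsto (fun t : ℝ => p + t • v) (nhds 0) (nhds p) := by
    have : Continuous fun t : ℝ => p + t • v := by fun_prop
    simpa using this.tendsto 0
  exact hc.eventually hs

end SecondDifference

section ConeBarrier

variable {d : ℕ}

lemma norm_add_smul_single_sq (x : Esp d) (i : Fin d) (t : ℝ) :
    ‖x + t • EuclideanSpace.single i (1 : ℝ)‖ ^ 2 = ‖x‖ ^ 2 + 2 * t * x i + t ^ 2 := by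
  rw [norm_add_sq_real, inner_smul_right, EuclideanSpace.inner_single_right, norm_smul]
  simp
  ring

/-- The quantity `4/5 - |x|²`, extended to `ℝ^d × ℝ` independently of `y`. -/
noncomputable def capHeight (d : ℕ) (p : Esp d × ℝ) : ℝ := 4 / 5 - ‖p.1‖ ^ 2

lemma continuous_capHeight : Continuous (capHeight d) := by
  unfold capHeight; fun_prop

lemma contDiff_capHeight : ContDiff ℝ 2 (capHeight d) :=
  contDiff_const.sub (contDiff_fst.norm_sq ℝ)

lemma secondDeriv_inv_capHeight_pow {p : Esp d × ℝ} (hp : 0 < capHeight d p) (m : ℕ) (i : Fin d) :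
    secondDeriv (fun q => (capHeight d q)⁻¹ ^ m) (coordVec d (some i)) p =
      m * (m + 1) * (capHeight d p)⁻¹ ^ (m + 2) * (2 * p.1 i) ^ 2 +
        2 * m * (capHeight d p)⁻¹ ^ (m + 1) := by
  set h := capHeight d p with hh
  set a : ℝ → ℝ := fun t => h - 2 * t * p.1 i - t ^ 2 with ha
  have hline : ∀ t : ℝ, capHeight d (p + t • coordVec d (some i)) = a t := by
    intro t
    simp only [capHeight, coordVec, Prod.fst_add, Prod.smul_fst, norm_add_smul_single_sq, ha, hh]
    ring
  have hac : Continuous a := by fun_prop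
  have ha0 : a 0 = h := by simp [ha]
  have hapos : ∀ᶠ t in nhds (0 : ℝ), 0 < a t :=
    hac.continuousAt.eventually (lt_mem_nhds (by rw [ha0]; exact hp))
  have hader : ∀ t, HasDerivAt a (-(2 * p.1 i) - 2 * t) t := by
    intro t
    have := ((((hasDerivAt_id t).const_mul 2).mul_const (p.1 i)).const_sub h).sub
      (hasDerivAt_pow 2 t)
    refine this.congr_deriv ?_
    simp
  have hpow : ∀ (n : ℕ) (t : ℝ), 0 < a t → HasDerivAt (fun t => (a t)⁻¹ ^ n)
      (n * (a t)⁻¹ ^ (n + 1) * (2 * p.1 i + 2 * t)) t := by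
    intro n t ht
    have := ((hader t).inv ht.ne').pow n
    refine this.congr_deriv ?_
    rcases n with _ | n
    · simp
    · simp only [Nat.add_sub_cancel, Pi.inv_apply, pow_succ]
      field_simp
      ring
  unfold secondDeriv
  simp only [hline]
  have hd1 : deriv (fun t => (a t)⁻¹ ^ m) =ᶠ[nhds 0]
      fun t => m * (a t)⁻¹ ^ (m + 1) * (2 * p.1 i + 2 * t) := by
    filter_upwards [hapos] with t ht using (hpow m t ht).deriv
  rw [hd1.deriv_eq]
  have h2 := (((hpow (m + 1) 0 hapos.self_of_nhds).const_mul (m : ℝ)).mul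
    (((hasDerivAt_id (0 : ℝ)).const_mul 2).const_add (2 * p.1 i)))
  refine (h2.deriv.trans ?_)
  simp only [ha0, id]
  push_cast
  ring

end ConeBarrier

section BoundFromPower

variable {d : ℕ}

/-- A superharmonic barrier blowing up at the rim `|x|² = 4/5`, `y = 0`. -/
noncomputable def rimBarrier (d k : ℕ) (K c θ : ℝ) (p : Esp d × ℝ) : ℝ :=
  K * ((capHeight d p)⁻¹ ^ k - c * p.2 ^ 2 * (capHeight d p)⁻¹ ^ (k + 2)) + 2 * θ * (1 - p.2)

lemma capHeight_add_smul_vertical (p : Esp d × ℝ) (t : ℝ) :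
    capHeight d (p + t • coordVec d none) = capHeight d p := by
  simp [capHeight, coordVec]

lemma capHeight_le_one (p : Esp d × ℝ) : capHeight d p ≤ 1 := by
  unfold capHeight; nlinarith [sq_nonneg ‖p.1‖]

lemma sum_coord_sq (x : Esp d) : ∑ i, x i ^ 2 = ‖x‖ ^ 2 := by
  rw [EuclideanSpace.norm_sq_eq]; simp

lemma secDiff_rimBarrier_vertical (k : ℕ) (K c θ : ℝ) (p : Esp d × ℝ) (t : ℝ) :
    secDiff (rimBarrier d k K c θ) (coordVec d none) p t =
      -(2 * c * K * (capHeight d p)⁻¹ ^ (k + 2)) * t ^ 2 := by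
  have h2 : capHeight d (p - t • coordVec d none) = capHeight d p := by
    simp [capHeight, coordVec]
  simp only [secDiff, rimBarrier, capHeight_add_smul_vertical, h2]
  simp only [coordVec, Prod.snd_add, Prod.smul_snd, Prod.snd_sub, smul_eq_mul, mul_one]
  ring

lemma tendsto_secDiff_rimBarrier (k : ℕ) (K c θ : ℝ) {p : Esp d × ℝ} (hp : 0 < capHeight d p)
    (i : Fin d) :
    Filter.Tendsto (fun t => secDiff (rimBarrier d k K c θ) (coordVec d (some i)) p t / t ^ 2)
      (nhdsWithin 0 (Ioi 0))
      (nhds (K * (secondDeriv (fun q => (capHeight d q)⁻¹ ^ k) (coordVec d (some i)) p -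
        c * p.2 ^ 2 *
          secondDeriv (fun q => (capHeight d q)⁻¹ ^ (k + 2)) (coordVec d (some i)) p))) := by
  have hsm : ∀ m : ℕ, ContDiffAt ℝ 2 (fun q : Esp d × ℝ => (capHeight d q)⁻¹ ^ m) p := fun m =>
    (contDiff_capHeight.contDiffAt.inv hp.ne').pow m
  have h := ((tendsto_secDiff (hsm k) (coordVec d (some i))).sub
    ((tendsto_secDiff (hsm (k + 2)) (coordVec d (some i))).const_mul (c * p.2 ^ 2))).const_mul K
  refine h.congr fun t => ?_
  simp only [secDiff, rimBarrier]
  simp only [coordVec, Prod.snd_add, Prod.smul_snd, Prod.snd_sub, smul_eq_mul, mul_zero, add_zero,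
    sub_zero]
  ring

/-- If `u - T` has an interior maximum and the second differences of `T` are bounded by `b`,
then the Laplacian of `u` is at most the sum of the `b`. -/
lemma lapH_le_sum_of_isMaxOn {u T : Esp d × ℝ → ℝ} {p : Esp d × ℝ} {s : Set (Esp d × ℝ)}
    (hu : ContDiffAt ℝ 2 u p) (hs : s ∈ nhds p) (hmax : IsMaxOn (fun q => u q - T q) s p)
    {b : Option (Fin d) → ℝ}
    (hT : ∀ o, Filter.Tendsto (fun t => secDiff T (coordVec d o) p t / t ^ 2)
      (nhdsWithin 0 (Ioi 0)) (nhds (b o))) :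
    lapH d u p ≤ ∑ o, b o := by
  rw [lapH_eq_sum]
  exact Finset.sum_le_sum fun o _ => le_of_secDiff_le (tendsto_secDiff hu _) (hT o)
    (secDiff_le_of_isMaxOn hmax (eventually_line_mem hs _))

lemma lap_rimBarrier_neg {k : ℕ} {K c : ℝ} (hK : 0 < K) (hc : 2 * k * (k + 1) + k * d + 1 ≤ c)
    {p : Esp d × ℝ} (hp : 0 < capHeight d p) {b : Option (Fin d) → ℝ}
    (hb0 : b none = -(2 * c * K * (capHeight d p)⁻¹ ^ (k + 2)))
    (hb : ∀ i, b (some i) =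
      K * (secondDeriv (fun q => (capHeight d q)⁻¹ ^ k) (coordVec d (some i)) p - c * p.2 ^ 2 *
          secondDeriv (fun q => (capHeight d q)⁻¹ ^ (k + 2)) (coordVec d (some i)) p)) :
    ∑ o, b o < 0 := by
  set h := (capHeight d p)⁻¹ with hh
  have hhpos : 0 < h := inv_pos.2 hp
  have hcpos : 0 < c := lt_of_lt_of_le (by positivity) hc
  have hle : ∀ i, b (some i) ≤ K * (k * (k + 1) * h ^ (k + 2) * (2 * p.1 i) ^ 2 +
      2 * k * h ^ (k + 2)) := by
    intro i
    rw [hb i, secondDeriv_inv_capHeight_pow hp, secondDeriv_inv_capHeight_pow hp, ← hh]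
    refine mul_le_mul_of_nonneg_left ?_ hK.le
    have h1 : h ^ (k + 1) ≤ h ^ (k + 2) :=
      pow_le_pow_right₀ ((one_le_inv₀ hp).2 (capHeight_le_one p)) (by omega)
    have h2 : 2 * (k : ℝ) * h ^ (k + 1) ≤ 2 * k * h ^ (k + 2) := by gcongr
    have h3 : 0 ≤ c * p.2 ^ 2 * (((k + 2 : ℕ) : ℝ) * (((k + 2 : ℕ) : ℝ) + 1) *
        h ^ (k + 2 + 2) * (2 * p.1 i) ^ 2 + 2 * ((k + 2 : ℕ) : ℝ) * h ^ (k + 2 + 1)) := by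
      positivity
    linarith
  have hx : ‖p.1‖ ^ 2 ≤ 1 := by unfold capHeight at hp; linarith
  have hkk : (0 : ℝ) ≤ k * (k + 1) := by positivity
  have hsum : ∑ i : Fin d, (K * (k * (k + 1) * h ^ (k + 2) * (2 * p.1 i) ^ 2 +
      2 * k * h ^ (k + 2))) = K * h ^ (k + 2) * (4 * (k * (k + 1)) * ‖p.1‖ ^ 2 + 2 * k * d) := by
    rw [← sum_coord_sq, ← Finset.mul_sum, Finset.sum_add_distrib, Finset.sum_const]
    simp only [mul_pow, Finset.card_univ, Fintype.card_fin, nsmul_eq_mul]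
    rw [← Finset.mul_sum, ← Finset.mul_sum]
    ring
  rw [Fintype.sum_option, hb0]
  have h4 := Finset.sum_le_sum fun i (_ : i ∈ Finset.univ) => hle i
  rw [hsum] at h4
  have h5 : 0 < K * h ^ (k + 2) := by positivity
  have h6 : 4 * (k * (k + 1)) * ‖p.1‖ ^ 2 + 2 * k * d < 2 * c := by
    nlinarith
  nlinarith

/-- A harmonic function with normal derivative at least `-θ` at the base and bounded by a
negative power of the height lies below the rim barrier in the cone `y ≤ ε (4/5 - |x|²)`. -/
lemma le_rimBarrier {θ C ε c K : ℝ} {k : ℕ} (hk : 1 ≤ k) (hθ : 0 < θ) (hC : 0 < C) (hε : 0 < ε)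
    (hε1 : ε ≤ 1 / 20) (hc : 2 * k * (k + 1) + k * d + 1 ≤ c) (hcε : c * ε ^ 2 ≤ 1 / 2)
    (hKC : K = 2 * C * (ε⁻¹) ^ k) {v : Esp d × ℝ → ℝ}
    (hcont : ContinuousOn v (upBall d 1 ∪ flatBall d 1)) (hharm : HarmonicOnH d v (upBall d 1))
    (hnd : ∀ x : Esp d, ‖x‖ < 1 → ∃ L, NormalDeriv d v x L ∧ -θ ≤ L)
    (hpow : ∀ p ∈ upBall d (9 / 10), v p ≤ C * (p.2⁻¹) ^ k)
    {p : Esp d × ℝ} (hp : 0 < capHeight d p) (hp0 : 0 ≤ p.2) (hpε : p.2 ≤ ε * capHeight d p) :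
    v p ≤ rimBarrier d k K c θ p := by
  by_contra! hlt
  have hK : 0 < K := by rw [hKC]; positivity
  have hcpos : 0 < c := lt_of_lt_of_le (by positivity) hc
  have hhc := continuous_capHeight (d := d)
  have hcone : ∀ δ, IsCompact {q : Esp d × ℝ | δ ≤ capHeight d q ∧ 0 ≤ q.2 ∧
      q.2 ≤ ε * capHeight d q ∧ 0 ≤ capHeight d q} := by
    intro δ
    refine IsCompact.of_isClosed_subset (isCompact_closedBall (0 : Esp d × ℝ) 1) ?_ ?_
    · exact (isClosed_le continuous_const hhc).inter
        ((isClosed_le continuous_const continuous_snd).inter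
        ((isClosed_le continuous_snd (continuous_const.mul hhc)).inter
          (isClosed_le continuous_const hhc)))
    · rintro q ⟨-, h2, h3, h4⟩
      have h5 := capHeight_le_one q
      rw [mem_closedBall_zero_iff, Prod.norm_def]
      refine max_le ?_ ?_
      · unfold capHeight at h4
        nlinarith [norm_nonneg q.1]
      · rw [Real.norm_eq_abs, abs_of_nonneg h2]
        nlinarith
  have hsub : ∀ q : Esp d × ℝ, 0 ≤ q.2 → q.2 ≤ ε * capHeight d q → 0 ≤ capHeight d q →
      ‖q.1‖ ^ 2 + q.2 ^ 2 < (9 / 10) ^ 2 := by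
    intro q h2 h3 h4
    have h5 := capHeight_le_one q
    have h6 : q.2 ≤ 1 / 20 := h3.trans (by nlinarith)
    unfold capHeight at h4
    nlinarith
  have hdom : ∀ q : Esp d × ℝ, 0 ≤ q.2 → q.2 ≤ ε * capHeight d q → 0 ≤ capHeight d q →
      q ∈ upBall d 1 ∪ flatBall d 1 := by
    intro q h2 h3 h4
    have h5 := hsub q h2 h3 h4
    have h6 : ‖q.1‖ ^ 2 + q.2 ^ 2 < 1 ^ 2 := by linarith
    rcases h2.lt_or_eq with h | h
    · exact Or.inl ⟨h6, h⟩
    · exact Or.inr ⟨h6, h.symm⟩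
  obtain ⟨B, hB⟩ := (hcone 0).exists_bound_of_continuousOn (hcont.mono fun q hq =>
    hdom q hq.2.1 hq.2.2.1 hq.2.2.2)
  set δ := min (capHeight d p) (min 1 (K / (2 * (|B| + 1)))) with hδ
  have hδ0 : 0 < δ := by positivity
  have hlow : ∀ q : Esp d × ℝ, 0 ≤ q.2 → q.2 ≤ ε * capHeight d q → 0 < capHeight d q →
      K / 2 * (capHeight d q)⁻¹ ^ k ≤ rimBarrier d k K c θ q := by
    intro q h2 h3 h4
    have h5 := capHeight_le_one q
    have h6 : q.2 ≤ 1 := h3.trans (by nlinarith)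
    have h7 : c * q.2 ^ 2 * (capHeight d q)⁻¹ ^ 2 ≤ 1 / 2 := by
      calc c * q.2 ^ 2 * (capHeight d q)⁻¹ ^ 2
          ≤ c * (ε * capHeight d q) ^ 2 * (capHeight d q)⁻¹ ^ 2 := by gcongr
        _ = c * ε ^ 2 := by field_simp
        _ ≤ 1 / 2 := hcε
    have h8 : 0 ≤ 2 * θ * (1 - q.2) := by
      have : 0 ≤ 1 - q.2 := by linarith
      positivity
    have h9 : 0 < (capHeight d q)⁻¹ ^ k := by positivity
    have h10 : 0 < K * (capHeight d q)⁻¹ ^ k := by positivity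
    unfold rimBarrier
    rw [pow_add]
    nlinarith
  set Q : Set (Esp d × ℝ) := {q | δ ≤ capHeight d q ∧ 0 ≤ q.2 ∧ q.2 ≤ ε * capHeight d q ∧
    0 ≤ capHeight d q} with hQ
  have hTc : ContinuousOn (rimBarrier d k K c θ) Q := by
    have hne : ∀ q ∈ Q, capHeight d q ≠ 0 := fun q hq => (hδ0.trans_le hq.1).ne'
    have hi := hhc.continuousOn.inv₀ hne
    unfold rimBarrier
    fun_prop (disch := assumption)
  have hpQ : p ∈ Q := ⟨min_le_left _ _, hp0, hpε, hp.le⟩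
  obtain ⟨q, hqQ, hmax⟩ := (hcone δ).exists_isMaxOn ⟨p, hpQ⟩
    ((hcont.mono fun q hq => hdom q hq.2.1 hq.2.2.1 hq.2.2.2).sub hTc)
  have hpq : v p - rimBarrier d k K c θ p ≤ v q - rimBarrier d k K c θ q := hmax hpQ
  obtain ⟨hq1, hq2, hq3, hq4⟩ := hqQ
  have hqpos : 0 < capHeight d q := hδ0.trans_le hq1
  have hlowq := hlow q hq2 hq3 hqpos
  have hq1' : δ < capHeight d q := by
    refine lt_of_le_of_ne hq1 fun he => ?_
    have h1 : v q ≤ |B| := (le_abs_self _).trans ((hB q ⟨hq4, hq2, hq3, hq4⟩).trans (le_abs_self B))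
    have h2 : (capHeight d q)⁻¹ ≤ (capHeight d q)⁻¹ ^ k :=
      le_self_pow₀ ((one_le_inv₀ hqpos).2 (capHeight_le_one q)) (by omega)
    have h3 : |B| + 1 ≤ K / 2 * (capHeight d q)⁻¹ := by
      rw [← he, ← div_eq_mul_inv, le_div_iff₀ hδ0]
      have h4 : δ ≤ K / (2 * (|B| + 1)) := (min_le_right _ _).trans (min_le_right _ _)
      rw [le_div_iff₀ (by positivity)] at h4
      linarith
    have h5 : K / 2 * (capHeight d q)⁻¹ ≤ K / 2 * (capHeight d q)⁻¹ ^ k := by gcongr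
    linarith
  have hq3' : q.2 < ε * capHeight d q := by
    refine lt_of_le_of_ne hq3 fun he => ?_
    have hq2' : 0 < q.2 := by rw [he]; positivity
    have h1 := hpow q ⟨hsub q hq2 hq3 hq4, hq2'⟩
    rw [he, mul_inv, mul_pow, ← mul_assoc] at h1
    have h2 : K / 2 * (capHeight d q)⁻¹ ^ k = C * ε⁻¹ ^ k * (capHeight d q)⁻¹ ^ k := by
      rw [hKC]; ring
    linarith
  rcases hq2.lt_or_eq with hq2' | hq2'
  · have hmem : q ∈ upBall d 1 := by
      have := hsub q hq2 hq3 hq4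
      exact ⟨by linarith, hq2'⟩
    have hnhds : Q ∈ nhds q := by
      filter_upwards [(isOpen_lt continuous_const hhc).mem_nhds hq1',
        (isOpen_lt continuous_const continuous_snd).mem_nhds hq2',
        (isOpen_lt continuous_snd (continuous_const.mul hhc)).mem_nhds hq3'] with r h1 h2 h3
      exact ⟨le_of_lt h1, le_of_lt h2, le_of_lt h3, (hδ0.trans h1).le⟩
    have h := lapH_le_sum_of_isMaxOn (T := rimBarrier d k K c θ)
      (hharm.1.contDiffAt ((isOpen_upBall 1).mem_nhds hmem)) hnhds hmax
      (b := fun o => match o with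
        | none => -(2 * c * K * (capHeight d q)⁻¹ ^ (k + 2))
        | some i => K * (secondDeriv (fun q => (capHeight d q)⁻¹ ^ k) (coordVec d (some i)) q -
            c * q.2 ^ 2 *
              secondDeriv (fun q => (capHeight d q)⁻¹ ^ (k + 2)) (coordVec d (some i)) q))
      (fun o => by
        cases o with
        | none =>
          simp only [secDiff_rimBarrier_vertical]
          exact tendsto_mul_sq_div_sq _
        | some i => exact tendsto_secDiff_rimBarrier k K c θ hqpos i)
    rw [hharm.2 q hmem] at h
    exact absurd (lap_rimBarrier_neg hK hc hqpos rfl fun i => rfl) (not_lt.2 h)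
  · have hx : ‖q.1‖ < 1 := by
      have := hsub q hq2 hq3 hq4
      nlinarith [norm_nonneg q.1, sq_nonneg q.2]
    obtain ⟨L, hL, hLθ⟩ := hnd q.1 hx
    have hL2 : L ≤ -(2 * θ) := by
      refine le_of_tendsto hL ?_
      have hev : ∀ᶠ t in nhds (0 : ℝ), t < ε * capHeight d q := by
        refine gt_mem_nhds ?_
        positivity
      filter_upwards [nhdsWithin_le_nhds hev, self_mem_nhdsWithin] with t ht ht0
      have ht0' : (0 : ℝ) < t := ht0
      have hcap : capHeight d (q.1, t) = capHeight d q := rfl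
      have hcap0 : capHeight d (q.1, (0 : ℝ)) = capHeight d q := rfl
      have h1 : v (q.1, t) - rimBarrier d k K c θ (q.1, t) ≤ v q - rimBarrier d k K c θ q :=
        hmax ⟨by rw [hcap]; exact hq1, ht0'.le, by rw [hcap]; exact ht.le, by rw [hcap]; exact hq4⟩
      have hq0 : q = (q.1, 0) := by rw [hq2']
      rw [hq0] at h1
      simp only [rimBarrier, hcap, hcap0] at h1
      rw [div_le_iff₀ ht0']
      have h2 : 0 ≤ K * (c * t ^ 2 * (capHeight d q)⁻¹ ^ (k + 2)) := by positivity
      nlinarith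
    linarith

/-- Harmonic functions with normal derivative at least `-θ` at the base that are bounded by a
negative power of the height are bounded in a smaller half-ball. -/
lemma exists_bound_of_power_bound (d : ℕ) {θ C : ℝ} (hθ : 0 < θ) (hC : 0 < C) :
    ∃ S > 0, ∀ v : Esp d × ℝ → ℝ, ContinuousOn v (upBall d 1 ∪ flatBall d 1) →
      HarmonicOnH d v (upBall d 1) →
      (∀ x : Esp d, ‖x‖ < 1 → ∃ L, NormalDeriv d v x L ∧ -θ ≤ L) →
      (∀ p ∈ upBall d (9 / 10), v p ≤ C * (p.2⁻¹) ^ (d + 1)) →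
      ∀ p : Esp d × ℝ, ‖p.1‖ ^ 2 + p.2 ^ 2 < (3 / 4) ^ 2 → 0 ≤ p.2 → v p ≤ S := by
  set k := d + 1
  set c : ℝ := 2 * k * (k + 1) + k * d + 1 with hc
  have hc1 : 1 ≤ c := by
    have : (0 : ℝ) ≤ 2 * k * (k + 1) + k * d := by positivity
    linarith
  set ε : ℝ := 1 / (20 * c) with hεd
  have hε : 0 < ε := by positivity
  have hε1 : ε ≤ 1 / 20 := by
    rw [hεd]
    gcongr
    linarith
  have hcε : c * ε ^ 2 ≤ 1 / 2 := by
    have h1 : c * ε = 1 / 20 := by rw [hεd]; field_simp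
    nlinarith
  set K : ℝ := 2 * C * (ε⁻¹) ^ k with hK
  have hKpos : 0 < K := by positivity
  refine ⟨K * 5 ^ k + 2 * θ, by positivity, ?_⟩
  intro v hcont hharm hnd hpow p hp hp0
  have hcap : 1 / 5 ≤ capHeight d p := by
    unfold capHeight
    nlinarith [sq_nonneg p.2]
  have hcap0 : 0 < capHeight d p := by linarith
  rcases le_or_gt p.2 (ε * capHeight d p) with h | h
  · refine (le_rimBarrier (by omega) hθ hC hε hε1 le_rfl hcε hK hcont hharm hnd hpow hcap0 hp0
      h).trans ?_
    unfold rimBarrier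
    have h1 : (capHeight d p)⁻¹ ^ k ≤ 5 ^ k := by
      refine pow_le_pow_left₀ (by positivity) ?_ k
      rw [inv_le_comm₀ hcap0 (by norm_num)]
      linarith
    have h2 : 0 ≤ c * p.2 ^ 2 * (capHeight d p)⁻¹ ^ (k + 2) := by positivity
    have h3 : K * ((capHeight d p)⁻¹ ^ k - c * p.2 ^ 2 * (capHeight d p)⁻¹ ^ (k + 2)) ≤
        K * 5 ^ k := mul_le_mul_of_nonneg_left (by linarith) hKpos.le
    nlinarith
  · have hp1 : ε / 5 ≤ p.2 := by nlinarith
    have hp2 : 0 < p.2 := by linarith [div_pos hε (by norm_num : (0 : ℝ) < 5)]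
    have h1 : p.2⁻¹ ^ k ≤ (ε⁻¹) ^ k * 5 ^ k := by
      rw [← mul_pow]
      refine pow_le_pow_left₀ (by positivity) ?_ k
      rw [inv_le_comm₀ hp2 (by positivity), mul_inv, inv_inv]
      linarith
    have h2 := hpow p ⟨by linarith, hp2⟩
    have h3 : C * p.2⁻¹ ^ k ≤ C * ((ε⁻¹) ^ k * 5 ^ k) := by gcongr
    have h4 : 0 < C * ((ε⁻¹) ^ k * 5 ^ k) := by positivity
    rw [hK]
    nlinarith

end BoundFromPower


section Solutions

variable {d : ℕ} {θ L : ℝ} {f : ℝ → ℝ} {φ : Esp d → ℝ} {u : Esp d × ℝ → ℝ}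

lemma HarmonicOnH.neg {U : Set (Esp d × ℝ)} (hu : HarmonicOnH d u U) :
    HarmonicOnH d (fun p => -u p) U := by
  refine ⟨hu.1.neg, fun p hp => ?_⟩
  have h := hu.2 p hp
  unfold lapH at h ⊢
  simp only [deriv.fun_neg', deriv.fun_neg, Finset.sum_neg_distrib]
  linarith

lemma NormalDeriv.neg {x : Esp d} (h : NormalDeriv d u x L) :
    NormalDeriv d (fun p => -u p) x (-L) := by
  refine (Filter.Tendsto.neg h).congr fun t => ?_
  ring

lemma TwoPhaseSolH.neg (hu : TwoPhaseSolH d θ f φ u) :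
    TwoPhaseSolH d θ f (fun x => -φ x) (fun p => -u p) := by
  refine ⟨hu.1.neg, hu.2.1.neg, fun x hx => ?_⟩
  obtain ⟨l, hl, hlθ, hlf⟩ := hu.2.2 x hx
  refine ⟨-l, hl.neg, by rwa [abs_neg], fun hne => ?_⟩
  change -l = f |-u (x, 0) - -φ x| * Real.sign (-u (x, 0) - -φ x)
  rw [hlf fun h => hne (by simp [h]),
    show -u (x, 0) - -φ x = -(u (x, 0) - φ x) by ring, abs_neg, Real.sign_neg]
  ring

/-- Solutions are bounded away from the spherical part of the boundary. -/
lemma exists_sup_bound (d : ℕ) {θ : ℝ} (A : ℝ) (hθ : 0 < θ) :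
    ∃ S > 0, ∀ (f : ℝ → ℝ) (φ : Esp d → ℝ) (u : Esp d × ℝ → ℝ), TwoPhaseSolH d θ f φ u →
      IntegrableOn (fun p => (u p) ^ 2 + gradSqH d u p) (upBall d 1) →
      (∫ p in upBall d 1, (u p) ^ 2) ≤ A ^ 2 →
      ∀ p : Esp d × ℝ, ‖p.1‖ ^ 2 + p.2 ^ 2 < (3 / 4) ^ 2 → 0 ≤ p.2 → |u p| ≤ S := by
  obtain ⟨C, hC, hint⟩ := exists_interior_bound d A
  obtain ⟨S, hS, hbd⟩ := exists_bound_of_power_bound d hθ hC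
  refine ⟨S, hS, fun f φ u hu hi hA p hp hp0 => ?_⟩
  have hcu : ContinuousOn u (upBall d 1) := hu.1.mono subset_union_left
  have hmeas : MeasurableSet (upBall d 1) := (isOpen_upBall 1).measurableSet
  have hi2 : IntegrableOn (fun p => u p ^ 2) (upBall d 1) := by
    refine Integrable.mono' hi ((hcu.pow 2).aestronglyMeasurable hmeas) ?_
    refine Filter.Eventually.of_forall fun q => ?_
    have : 0 ≤ gradSqH d u q :=
      add_nonneg (Finset.sum_nonneg fun i _ => sq_nonneg _) (sq_nonneg _)
    rw [Real.norm_eq_abs, abs_of_nonneg (sq_nonneg _)]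
    linarith
  have hpow := hint u hu.2.1 hi2 hA
  rw [abs_le]
  constructor
  · have h := hbd (fun q => -u q) hu.neg.1 hu.neg.2.1 (fun x hx => by
      obtain ⟨l, hl, hlθ, -⟩ := hu.neg.2.2 x hx
      exact ⟨l, hl, (abs_le.1 hlθ).1⟩)
      (fun q hq => (neg_le_abs _).trans (hpow q hq)) p hp hp0
    linarith
  · exact hbd u hu.1 hu.2.1 (fun x hx => by
      obtain ⟨l, hl, hlθ, -⟩ := hu.2.2 x hx
      exact ⟨l, hl, (abs_le.1 hlθ).1⟩)
      (fun q hq => (le_abs_self _).trans (hpow q hq)) p hp hp0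

/-- The jump of the boundary datum between two points is controlled from below by the jump of
`u - φ`. -/
lemma GoodF.neg_mul_sub_le (hf : GoodF θ L f) {a b la lb : ℝ} (hab : b < a)
    (hla : |la| ≤ θ) (hlb : |lb| ≤ θ) (ha : a ≠ 0 → la = f |a| * Real.sign a)
    (hb : b ≠ 0 → lb = f |b| * Real.sign b) : -L * (a - b) ≤ la - lb := by
  obtain ⟨hf0, hfb, hfL⟩ := hf
  rw [abs_le] at hla hlb
  have hL : 0 ≤ L := by
    have h := hfL 0 1 le_rfl zero_le_one
    norm_num at h
    exact (abs_nonneg _).trans h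
  rcases lt_trichotomy a 0 with h | h | h
  · have h' : b < 0 := hab.trans h
    rw [ha h.ne, hb h'.ne, abs_of_neg h, abs_of_neg h', Real.sign_of_neg h, Real.sign_of_neg h']
    have h1 := hfL (-a) (-b) (by linarith) (by linarith)
    rw [abs_of_neg (show -a - -b < 0 by linarith)] at h1
    linarith [(abs_le.1 h1).2]
  · subst h
    rw [hb hab.ne, abs_of_neg hab, Real.sign_of_neg hab]
    have h1 := hfL 0 (-b) le_rfl (by linarith)
    rw [abs_of_neg (show (0 : ℝ) - -b < 0 by linarith), hf0] at h1
    linarith [(abs_le.1 h1).2]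
  · rw [ha h.ne', abs_of_pos h, Real.sign_of_pos h]
    rcases lt_trichotomy b 0 with h' | h' | h'
    · rw [hb h'.ne, abs_of_neg h', Real.sign_of_neg h']
      have h1 := (hfb a h.le).1
      have h2 := (hfb (-b) (by linarith)).1
      nlinarith
    · subst h'
      have h1 := hfL a 0 h.le le_rfl
      rw [hf0, abs_of_pos (show 0 < a - 0 by linarith)] at h1
      linarith [(abs_le.1 h1).1]
    · rw [hb h'.ne', abs_of_pos h', Real.sign_of_pos h']
      have h1 := hfL a b h.le h'.le
      rw [abs_of_pos (show 0 < a - b by linarith)] at h1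
      linarith [(abs_le.1 h1).1]

lemma normSq_add_sq_lt_of_near {x₀ x : Esp d} {y₀ y : ℝ} (h₀ : (x₀, y₀) ∈ upBall d (1 / 2))
    (hx : ‖x - x₀‖ ≤ 1 / 5) (hy : 0 ≤ y) (hy' : y ≤ y₀ + 1 / 10) :
    ‖x‖ ^ 2 + y ^ 2 < (3 / 4) ^ 2 := by
  obtain ⟨h1, h2⟩ := h₀
  simp only at h1 h2
  have h3 : ‖x‖ ≤ ‖x₀‖ + 1 / 5 := by
    have := norm_sub_norm_le x x₀
    linarith
  have h4 : ‖x‖ ^ 2 ≤ (‖x₀‖ + 1 / 5) ^ 2 := pow_le_pow_left₀ (norm_nonneg _) h3 2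
  have h5 : y ^ 2 ≤ (y₀ + 1 / 10) ^ 2 := pow_le_pow_left₀ hy hy' 2
  nlinarith [sq_nonneg (‖x₀‖ - 9 / 20), sq_nonneg (y₀ - 9 / 40)]

end Solutions

section VerticalBound

variable {d : ℕ}

lemma lapH_sub_le_sum {u : Esp d × ℝ → ℝ} {p q : Esp d × ℝ} (hp : ContDiffAt ℝ 2 u p)
    (hq : ContDiffAt ℝ 2 u q) {c : Option (Fin d) → ℝ} {g : Option (Fin d) → ℝ → ℝ}
    (hg : ∀ o, Filter.Tendsto (fun t => g o t / t ^ 2) (nhdsWithin 0 (Ioi 0)) (nhds (c o)))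
    (h : ∀ o, ∀ᶠ t in nhdsWithin (0 : ℝ) (Ioi 0),
      secDiff u (coordVec d o) p t - secDiff u (coordVec d o) q t ≤ g o t) :
    lapH d u p - lapH d u q ≤ ∑ o, c o := by
  rw [lapH_eq_sum, lapH_eq_sum, ← Finset.sum_sub_distrib]
  refine Finset.sum_le_sum fun o _ => le_of_secDiff_le ?_ (hg o) (h o)
  refine ((tendsto_secDiff hp _).sub (tendsto_secDiff hq _)).congr fun t => ?_
  ring

lemma eventually_symm {P : ℝ → Prop} (h : ∀ᶠ t in nhds (0 : ℝ), P t) :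
    ∀ᶠ t in nhdsWithin (0 : ℝ) (Ioi 0), P t ∧ P (-t) := by
  have hneg : Filter.Tendsto (fun t : ℝ => -t) (nhds 0) (nhds 0) := by
    simpa using (continuous_neg (G := ℝ)).tendsto 0
  exact nhdsWithin_le_nhds (h.and (hneg.eventually h))

set_option maxHeartbeats 1000000 in
/-- Doubling of variables: if the normal derivative at the base is at most `θ`, then vertical
difference quotients are bounded from above. -/
lemma sub_le_of_normalDeriv_le {θ S K : ℝ} (hS : 0 < S) (hθ : 0 < θ)
    (hK : K = 400 * S * (d + 1) + θ + 1) {v : Esp d × ℝ → ℝ}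
    (hcont : ContinuousOn v (upBall d 1 ∪ flatBall d 1)) (hharm : HarmonicOnH d v (upBall d 1))
    (hnd : ∀ x : Esp d, ‖x‖ < 1 → ∃ l, NormalDeriv d v x l ∧ l ≤ θ)
    (hb : ∀ p : Esp d × ℝ, ‖p.1‖ ^ 2 + p.2 ^ 2 < (3 / 4) ^ 2 → 0 ≤ p.2 → |v p| ≤ S)
    {x₀ : Esp d} {y₀ a₀ : ℝ} (hp : (x₀, y₀) ∈ upBall d (1 / 2)) (ha₀ : 0 ≤ a₀) (ha₀y : a₀ ≤ y₀) :
    v (x₀, y₀) - v (x₀, a₀) ≤ K * (y₀ - a₀) := by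
  by_contra! hlt
  set M : ℝ := 200 * S with hM
  set N : ℝ := M * (d + 1) with hN
  have hM0 : 0 < M := by positivity
  have hN0 : 0 < N := by positivity
  have hKN : K = 2 * N + θ + 1 := by rw [hK, hN, hM]; ring
  have hy₀ : y₀ < 1 / 2 := by
    have h1 := hp.1
    have h2 := hp.2
    simp only at h1 h2
    nlinarith [sq_nonneg ‖x₀‖]
  set Q : Set (Esp d × ℝ × ℝ) := {z | ‖z.1 - x₀‖ ≤ 1 / 10 ∧ |z.2.2 - y₀| ≤ 1 / 10 ∧ 0 ≤ z.2.1 ∧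
    z.2.1 ≤ z.2.2} with hQ
  have hb1 : ∀ z ∈ Q, z.2.2 ≤ 3 / 5 := fun z hz => by linarith [(abs_le.1 hz.2.1).2]
  have hin : ∀ z ∈ Q, ∀ y, 0 ≤ y → y ≤ z.2.2 → ‖z.1‖ ^ 2 + y ^ 2 < (3 / 4) ^ 2 :=
    fun z hz y hy hyz => normSq_add_sq_lt_of_near hp (by linarith [hz.1]) hy
      (by linarith [(abs_le.1 hz.2.1).2])
  have hdom : ∀ z ∈ Q, ∀ y, 0 ≤ y → y ≤ z.2.2 → (z.1, y) ∈ upBall d 1 ∪ flatBall d 1 := by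
    intro z hz y hy hyz
    have h1 := hin z hz y hy hyz
    have h2 : ‖z.1‖ ^ 2 + y ^ 2 < 1 ^ 2 := by linarith
    rcases hy.lt_or_eq with h | h
    · exact Or.inl ⟨h2, h⟩
    · exact Or.inr ⟨h2, h.symm⟩
  have hcomp : IsCompact Q := by
    refine IsCompact.of_isClosed_subset ((isCompact_closedBall x₀ 1).prod
      ((isCompact_Icc (a := (0 : ℝ)) (b := 1)).prod (isCompact_Icc (a := (0 : ℝ)) (b := 1)))) ?_ ?_
    · have h1 : Continuous fun z : Esp d × ℝ × ℝ => ‖z.1 - x₀‖ := by fun_prop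
      have h2 : Continuous fun z : Esp d × ℝ × ℝ => |z.2.2 - y₀| := by fun_prop
      have h3 : Continuous fun z : Esp d × ℝ × ℝ => z.2.1 := by fun_prop
      have h4 : Continuous fun z : Esp d × ℝ × ℝ => z.2.2 := by fun_prop
      exact (isClosed_le h1 continuous_const).inter ((isClosed_le h2 continuous_const).inter
        ((isClosed_le continuous_const h3).inter (isClosed_le h3 h4)))
    · intro z hz
      have h1 := hb1 z hz
      obtain ⟨h2, h3, h4, h5⟩ := hz
      refine ⟨?_, ⟨h4, by linarith⟩, by linarith, by linarith⟩
      rw [Metric.mem_closedBall, dist_eq_norm]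
      linarith
  set B : Esp d × ℝ × ℝ → ℝ := fun z => M * (‖z.1 - x₀‖ ^ 2 + (z.2.2 - y₀) ^ 2) +
    (K * (z.2.2 - z.2.1) - N * (z.2.2 - z.2.1) ^ 2) with hB
  have hBc : Continuous B := by fun_prop
  have hWc : ContinuousOn (fun z : Esp d × ℝ × ℝ => v (z.1, z.2.2) - v (z.1, z.2.1) - B z) Q := by
    refine (ContinuousOn.sub ?_ ?_).sub hBc.continuousOn
    · exact hcont.comp (by fun_prop) fun z hz => hdom z hz _ (hz.2.2.1.trans hz.2.2.2) le_rfl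
    · exact hcont.comp (by fun_prop) fun z hz => hdom z hz _ hz.2.2.1 hz.2.2.2
  have hz₀ : (x₀, a₀, y₀) ∈ Q := by
    refine ⟨?_, ?_, ha₀, ha₀y⟩ <;> norm_num
  obtain ⟨⟨x, a, b⟩, hz, hmax⟩ := hcomp.exists_isMaxOn ⟨_, hz₀⟩ hWc
  have hpos : 0 < v (x, b) - v (x, a) - B (x, a, b) := by
    have h1 : v (x₀, y₀) - v (x₀, a₀) - B (x₀, a₀, y₀) ≤ v (x, b) - v (x, a) - B (x, a, b) :=
      hmax hz₀
    refine lt_of_lt_of_le ?_ h1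
    simp only [hB, sub_self, norm_zero]
    nlinarith [sq_nonneg (y₀ - a₀)]
  have hbz := hb1 _ hz
  have hza := hin _ hz a hz.2.2.1 hz.2.2.2
  have hzb := hin _ hz b (hz.2.2.1.trans hz.2.2.2) le_rfl
  obtain ⟨h1, h2, h3, h4⟩ := id hz
  simp only at h1 h2 h3 h4 hbz hza hzb
  have hb0 : 0 ≤ b := h3.trans h4
  have hvb := abs_le.1 (hb (x, b) hzb hb0)
  have hva := abs_le.1 (hb (x, a) hza h3)
  have hBval : B (x, a, b) = M * (‖x - x₀‖ ^ 2 + (b - y₀) ^ 2) +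
    (K * (b - a) - N * (b - a) ^ 2) := rfl
  have hg : 0 ≤ K * (b - a) - N * (b - a) ^ 2 := by
    have : 0 ≤ (b - a) * (K - N * (b - a)) := mul_nonneg (by linarith) (by nlinarith)
    linarith
  have h1' : ‖x - x₀‖ < 1 / 10 := by
    refine lt_of_le_of_ne h1 fun he => ?_
    rw [hBval, he] at hpos
    nlinarith [mul_nonneg hM0.le (sq_nonneg (b - y₀))]
  have h2' : |b - y₀| < 1 / 10 := by
    refine lt_of_le_of_ne h2 fun he => ?_
    rw [hBval, ← sq_abs (b - y₀), he] at hpos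
    nlinarith [mul_nonneg hM0.le (sq_nonneg ‖x - x₀‖)]
  have h4' : a < b := by
    refine lt_of_le_of_ne h4 fun he => ?_
    rw [hBval, he] at hpos
    nlinarith [mul_nonneg hM0.le (sq_nonneg ‖x - x₀‖), mul_nonneg hM0.le (sq_nonneg (b - y₀))]
  rcases h3.lt_or_eq with h3' | h3'
  · have hma : (x, a) ∈ upBall d 1 := ⟨by simp only; linarith, h3'⟩
    have hmb : (x, b) ∈ upBall d 1 := ⟨by simp only; linarith, h3'.trans h4'⟩
    have hnhds : Q ∈ nhds (x, a, b) := by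
      have c1 : Continuous fun z : Esp d × ℝ × ℝ => ‖z.1 - x₀‖ := by fun_prop
      have c2 : Continuous fun z : Esp d × ℝ × ℝ => |z.2.2 - y₀| := by fun_prop
      have c3 : Continuous fun z : Esp d × ℝ × ℝ => z.2.1 := by fun_prop
      have c4 : Continuous fun z : Esp d × ℝ × ℝ => z.2.2 := by fun_prop
      filter_upwards [(isOpen_lt c1 continuous_const).mem_nhds h1',
        (isOpen_lt c2 continuous_const).mem_nhds h2', (isOpen_lt continuous_const c3).mem_nhds h3',
        (isOpen_lt c3 c4).mem_nhds h4'] with z k1 k2 k3 k4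
      exact ⟨le_of_lt k1, le_of_lt k2, le_of_lt k3, le_of_lt k4⟩
    have hmax' : ∀ z ∈ Q, v (z.1, z.2.2) - v (z.1, z.2.1) - B z ≤
        v (x, b) - v (x, a) - B (x, a, b) := fun z hz => hmax hz
    have hvert : ∀ᶠ t in nhdsWithin (0 : ℝ) (Ioi 0), secDiff v (coordVec d none) (x, b) t -
        secDiff v (coordVec d none) (x, a) t ≤ (2 * M - 4 * N) * t ^ 2 := by
      filter_upwards [eventually_symm (eventually_line_mem hnhds ((0 : Esp d), (1 : ℝ), (0 : ℝ))),
        eventually_symm (eventually_line_mem hnhds ((0 : Esp d), (0 : ℝ), (1 : ℝ)))]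
        with t hk hk'
      have k1 := hmax' _ hk.1
      have k2 := hmax' _ hk.2
      have k3 := hmax' _ hk'.1
      have k4 := hmax' _ hk'.2
      simp only [hB, secDiff, coordVec, Prod.mk_add_mk, Prod.mk_sub_mk, Prod.smul_mk,
        smul_zero, add_zero, sub_zero, smul_eq_mul, mul_one, mul_zero, ← sub_eq_add_neg]
        at k1 k2 k3 k4 ⊢
      linarith
    have htang : ∀ i, ∀ᶠ t in nhdsWithin (0 : ℝ) (Ioi 0), secDiff v (coordVec d (some i)) (x, b) t -
        secDiff v (coordVec d (some i)) (x, a) t ≤ (2 * M) * t ^ 2 := by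
      intro i
      filter_upwards [eventually_symm (eventually_line_mem hnhds
        (EuclideanSpace.single i (1 : ℝ), (0 : ℝ), (0 : ℝ)))] with t hk
      have k1 := hmax' _ hk.1
      have k2 := hmax' _ hk.2
      have e1 := norm_add_smul_single_sq (x - x₀) i t
      have e2 := norm_add_smul_single_sq (x - x₀) i (-t)
      rw [sub_add_eq_add_sub] at e1 e2
      simp only [hB, secDiff, coordVec, Prod.mk_add_mk, Prod.mk_sub_mk, Prod.smul_mk,
        smul_zero, add_zero, sub_zero, e1, e2] at k1 k2 ⊢
      simp only [neg_smul, ← sub_eq_add_neg] at k1 k2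
      linarith
    have h := lapH_sub_le_sum (hharm.1.contDiffAt ((isOpen_upBall 1).mem_nhds hmb))
      (hharm.1.contDiffAt ((isOpen_upBall 1).mem_nhds hma))
      (c := fun o => o.elim (2 * M - 4 * N) fun _ => 2 * M)
      (g := fun o t => (o.elim (2 * M - 4 * N) fun _ => 2 * M) * t ^ 2)
      (fun o => tendsto_mul_sq_div_sq _)
      (fun o => by
        cases o with
        | none => exact hvert
        | some i => exact htang i)
    rw [hharm.2 _ hmb, hharm.2 _ hma, Fintype.sum_option] at h
    simp only [Option.elim, Finset.sum_const, Finset.card_univ, Fintype.card_fin, nsmul_eq_mul] at h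
    rw [hN] at h
    linarith [mul_nonneg hM0.le (Nat.cast_nonneg (α := ℝ) d)]
  · subst h3'
    have hx : ‖x‖ < 1 := by nlinarith [norm_nonneg x]
    obtain ⟨l, hl, hlθ⟩ := hnd x hx
    have hl2 : K - 2 * N ≤ l := by
      refine ge_of_tendsto hl ?_
      filter_upwards [nhdsWithin_le_nhds (gt_mem_nhds h4'), self_mem_nhdsWithin] with t ht ht0
      have ht0' : (0 : ℝ) < t := ht0
      have k : v (x, b) - v (x, t) - B (x, t, b) ≤ v (x, b) - v (x, 0) - B (x, 0, b) :=
        hmax (show (x, t, b) ∈ Q from ⟨h1, h2, ht0'.le, le_of_lt ht⟩)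
      simp only [hB] at k
      rw [le_div_iff₀ ht0']
      nlinarith [mul_pos hN0 ht0', mul_pos (mul_pos hN0 ht0') ht0',
        mul_nonneg (mul_pos hN0 ht0').le (by linarith : 0 ≤ 1 - b)]
    linarith

end VerticalBound

section TangentialBound

variable {d : ℕ}

lemma hasDerivAt_exp_mul_parabola (l c M y₀ y : ℝ) :
    HasDerivAt (fun y => Real.exp (-l * y) * (c + M * (y - y₀) ^ 2))
      (Real.exp (-l * y) * (2 * M * (y - y₀) - l * (c + M * (y - y₀) ^ 2))) y := by
  have h1 : HasDerivAt (fun y : ℝ => Real.exp (-l * y)) (Real.exp (-l * y) * -l) y := by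
    simpa using ((hasDerivAt_id y).const_mul (-l)).exp
  have h2 : HasDerivAt (fun y : ℝ => c + M * (y - y₀) ^ 2) (M * (2 * (y - y₀))) y := by
    simpa using ((((hasDerivAt_id y).sub_const y₀).pow 2).const_mul M).const_add c
  exact (h1.mul h2).congr_deriv (by ring)

lemma secondDeriv_exp_mul_parabola (l c M y₀ y : ℝ) :
    secondDeriv (fun y => Real.exp (-l * y) * (c + M * (y - y₀) ^ 2)) (1 : ℝ) y =
      Real.exp (-l * y) * (l ^ 2 * (c + M * (y - y₀) ^ 2) - 4 * l * M * (y - y₀) + 2 * M) := by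
  unfold secondDeriv
  have h1 : ∀ t : ℝ, HasDerivAt (fun t : ℝ => Real.exp (-l * (y + t • (1 : ℝ))) *
      (c + M * (y + t • (1 : ℝ) - y₀) ^ 2)) (Real.exp (-l * (y + t)) *
      (2 * M * (y + t - y₀) - l * (c + M * (y + t - y₀) ^ 2))) t := by
    intro t
    simpa using (hasDerivAt_exp_mul_parabola l c M y₀ (y + t)).comp_const_add y t
  rw [show deriv (fun t : ℝ => Real.exp (-l * (y + t • (1 : ℝ))) *
      (c + M * (y + t • (1 : ℝ) - y₀) ^ 2)) = _ from funext fun t => (h1 t).deriv]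
  have h2 : HasDerivAt (fun t : ℝ => Real.exp (-l * (y + t))) (Real.exp (-l * y) * -l) 0 := by
    simpa using (((hasDerivAt_id (0 : ℝ)).const_add y).const_mul (-l)).exp
  have h3 : HasDerivAt (fun t : ℝ => y + t - y₀) 1 0 := by
    simpa using ((hasDerivAt_id (0 : ℝ)).const_add y).sub_const y₀
  have h4 := h2.mul ((h3.const_mul (2 * M)).sub ((((h3.pow 2).const_mul M).const_add c).const_mul l))
  refine (h4.deriv).trans ?_
  simp
  ring

set_option maxHeartbeats 2000000 in
/-- Doubling of variables in a tangential direction: symmetric tangential difference quotients of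
bounded solutions are bounded. -/
lemma tangential_diff_le {θ L P S l M N K : ℝ} (hS : 0 < S) (hl : l = 2 * |L| + 1)
    (hM : M = 200 * S * Real.exp l) (hN : N = M * (d + l ^ 2 + l + 1)) (hK : K = N + M + 2 * |P|)
    {f : ℝ → ℝ} {φ : Esp d → ℝ} {u : Esp d × ℝ → ℝ} (hf : GoodF θ L f)
    (hφ : ∀ x x', ‖x‖ < 1 → ‖x'‖ < 1 → |φ x - φ x'| ≤ |P| * ‖x - x'‖)
    (hu : TwoPhaseSolH d θ f φ u)
    (hb : ∀ p : Esp d × ℝ, ‖p.1‖ ^ 2 + p.2 ^ 2 < (3 / 4) ^ 2 → 0 ≤ p.2 → |u p| ≤ S) (i : Fin d)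
    {x₀ : Esp d} {y₀ s₀ : ℝ} (hp : (x₀, y₀) ∈ upBall d (1 / 2)) (hs₀ : 0 ≤ s₀)
    (hs₀' : s₀ ≤ 1 / 10) :
    u (x₀ + s₀ • EuclideanSpace.single i 1, y₀) - u (x₀ - s₀ • EuclideanSpace.single i 1, y₀) ≤
      K * s₀ := by
  by_contra! hlt
  obtain ⟨hcont, hharm, hnd⟩ := hu
  set e : Esp d := EuclideanSpace.single i 1 with he
  have hen : ‖e‖ = 1 := by simp [he]
  have hl0 : 0 < l := by rw [hl]; positivity
  have hM0 : 0 < M := by rw [hM]; positivity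
  have hN0 : 0 < N := by rw [hN]; positivity
  have hP0 := abs_nonneg P
  have hy₀ : y₀ < 1 / 2 := by
    have h1 := hp.1
    have h2 := hp.2
    simp only at h1 h2
    nlinarith [sq_nonneg ‖x₀‖]
  have hy₀0 : 0 < y₀ := hp.2
  set Q : Set (Esp d × ℝ × ℝ) := {z | ‖z.1 - x₀‖ ≤ 1 / 10 ∧ 0 ≤ z.2.1 ∧ z.2.1 ≤ 1 / 10 ∧
    |z.2.2 - y₀| ≤ 1 / 10 ∧ 0 ≤ z.2.2} with hQ
  have hb1 : ∀ z ∈ Q, z.2.2 ≤ 3 / 5 := fun z hz => by linarith [(abs_le.1 hz.2.2.2.1).2]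
  have hin₁ : ∀ z ∈ Q, ‖z.1 + z.2.1 • e‖ ^ 2 + z.2.2 ^ 2 < (3 / 4) ^ 2 := by
    rintro z ⟨h1, h2, h3, h4, h5⟩
    refine normSq_add_sq_lt_of_near hp ?_ h5 (by linarith [(abs_le.1 h4).2])
    rw [add_sub_right_comm]
    refine (norm_add_le _ _).trans ?_
    rw [norm_smul, hen, Real.norm_eq_abs, abs_of_nonneg h2]
    linarith
  have hin₂ : ∀ z ∈ Q, ‖z.1 - z.2.1 • e‖ ^ 2 + z.2.2 ^ 2 < (3 / 4) ^ 2 := by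
    rintro z ⟨h1, h2, h3, h4, h5⟩
    refine normSq_add_sq_lt_of_near hp ?_ h5 (by linarith [(abs_le.1 h4).2])
    rw [sub_right_comm]
    refine (norm_sub_le _ _).trans ?_
    rw [norm_smul, hen, Real.norm_eq_abs, abs_of_nonneg h2]
    linarith
  have hdom : ∀ x : Esp d, ∀ y, ‖x‖ ^ 2 + y ^ 2 < (3 / 4) ^ 2 → 0 ≤ y →
      (x, y) ∈ upBall d 1 ∪ flatBall d 1 := by
    intro x y h1 hy
    have h2 : ‖x‖ ^ 2 + y ^ 2 < 1 ^ 2 := by linarith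
    rcases hy.lt_or_eq with h | h
    · exact Or.inl ⟨h2, h⟩
    · exact Or.inr ⟨h2, h.symm⟩
  have hcomp : IsCompact Q := by
    refine IsCompact.of_isClosed_subset ((isCompact_closedBall x₀ 1).prod
      ((isCompact_Icc (a := (0 : ℝ)) (b := 1)).prod (isCompact_Icc (a := (0 : ℝ)) (b := 1)))) ?_ ?_
    · have h1 : Continuous fun z : Esp d × ℝ × ℝ => ‖z.1 - x₀‖ := by fun_prop
      have h2 : Continuous fun z : Esp d × ℝ × ℝ => |z.2.2 - y₀| := by fun_prop
      have h3 : Continuous fun z : Esp d × ℝ × ℝ => z.2.1 := by fun_prop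
      have h4 : Continuous fun z : Esp d × ℝ × ℝ => z.2.2 := by fun_prop
      exact (isClosed_le h1 continuous_const).inter ((isClosed_le continuous_const h3).inter
        ((isClosed_le h3 continuous_const).inter ((isClosed_le h2 continuous_const).inter
          (isClosed_le continuous_const h4))))
    · intro z hz
      have h1 := hb1 z hz
      obtain ⟨h2, h3, h4, h5, h6⟩ := hz
      refine ⟨?_, ⟨h3, by linarith⟩, h6, by linarith⟩
      rw [Metric.mem_closedBall, dist_eq_norm]
      linarith
  set B : Esp d × ℝ × ℝ → ℝ := fun z => M * (‖z.1 - x₀‖ ^ 2 + (z.2.2 - y₀) ^ 2) +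
    (K * z.2.1 - N * z.2.1 ^ 2) with hB
  set W : Esp d × ℝ × ℝ → ℝ := fun z =>
    u (z.1 + z.2.1 • e, z.2.2) - u (z.1 - z.2.1 • e, z.2.2) with hW
  have hBc : Continuous B := by fun_prop
  have hWc : ContinuousOn W Q := by
    refine ContinuousOn.sub ?_ ?_
    · exact hcont.comp (by fun_prop) fun z hz => hdom _ _ (hin₁ z hz) hz.2.2.2.2
    · exact hcont.comp (by fun_prop) fun z hz => hdom _ _ (hin₂ z hz) hz.2.2.2.2
  have hGc : ContinuousOn (fun z => Real.exp (l * z.2.2) * W z - B z) Q :=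
    (ContinuousOn.mul (Continuous.continuousOn (by fun_prop)) hWc).sub hBc.continuousOn
  have hz₀ : (x₀, s₀, y₀) ∈ Q := by
    refine ⟨?_, hs₀, hs₀', ?_, hp.2.le⟩ <;> norm_num
  obtain ⟨⟨x, s, y⟩, hz, hmax⟩ := hcomp.exists_isMaxOn ⟨_, hz₀⟩ hGc
  set m : ℝ := Real.exp (l * y) * W (x, s, y) - B (x, s, y) with hm
  have hmax' : ∀ z ∈ Q, W z ≤ Real.exp (-l * z.2.2) * (B z + m) := by
    intro z hz
    have h1 : Real.exp (l * z.2.2) * W z - B z ≤ m := hmax hz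
    rw [neg_mul, Real.exp_neg, ← div_eq_inv_mul, le_div_iff₀ (Real.exp_pos _)]
    linarith
  have hWq : W (x, s, y) = Real.exp (-l * y) * (B (x, s, y) + m) := by
    rw [hm, neg_mul, Real.exp_neg]
    field_simp
    ring
  have hpos : 0 < m := by
    have h1 : Real.exp (l * y₀) * W (x₀, s₀, y₀) - B (x₀, s₀, y₀) ≤ m := hmax hz₀
    have h2 : 1 ≤ Real.exp (l * y₀) := Real.one_le_exp (by positivity)
    have h3 : K * s₀ < W (x₀, s₀, y₀) := hlt
    have h4 : 0 ≤ K * s₀ := by rw [hK]; positivity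
    have h5 : B (x₀, s₀, y₀) = K * s₀ - N * s₀ ^ 2 := by simp [hB]
    nlinarith [mul_nonneg hN0.le (sq_nonneg s₀)]
  have hbz := hb1 _ hz
  have hz₁ := hin₁ _ hz
  have hz₂ := hin₂ _ hz
  obtain ⟨h1, h2, h3, h4, h5⟩ := id hz
  simp only at h1 h2 h3 h4 h5 hbz hz₁ hz₂
  have hv₁ := abs_le.1 (hb (x + s • e, y) hz₁ h5)
  have hv₂ := abs_le.1 (hb (x - s • e, y) hz₂ h5)
  have hBval : B (x, s, y) = M * (‖x - x₀‖ ^ 2 + (y - y₀) ^ 2) + (K * s - N * s ^ 2) := rfl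
  have hWval : W (x, s, y) = u (x + s • e, y) - u (x - s • e, y) := rfl
  have hWS : W (x, s, y) ≤ 2 * S := by linarith
  have hsum : M * (1 / 10) ^ 2 = 2 * S * Real.exp l := by rw [hM]; ring
  have hGle : Real.exp (l * y) * W (x, s, y) ≤ 2 * S * Real.exp l := by
    have k1 : Real.exp (l * y) ≤ Real.exp l := Real.exp_le_exp.2 (by nlinarith)
    have k2 := Real.exp_pos (l * y)
    nlinarith
  have hBm : B (x, s, y) < M * (1 / 10) ^ 2 := by linarith
  have hg : (M + 2 * |P|) * s ≤ K * s - N * s ^ 2 := by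
    rw [hK]
    nlinarith [mul_nonneg hN0.le h2, mul_nonneg (mul_nonneg hN0.le h2) (by linarith : 0 ≤ 1 - s)]
  have hMs : 0 ≤ (M + 2 * |P|) * s := by positivity
  have hMx := mul_nonneg hM0.le (sq_nonneg ‖x - x₀‖)
  have hMy := mul_nonneg hM0.le (sq_nonneg (y - y₀))
  have h1' : ‖x - x₀‖ < 1 / 10 := by
    refine lt_of_le_of_ne h1 fun h => ?_
    rw [hBval, h] at hBm
    linarith
  have h4' : |y - y₀| < 1 / 10 := by
    refine lt_of_le_of_ne h4 fun h => ?_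
    rw [hBval, ← sq_abs (y - y₀), h] at hBm
    linarith
  have h3' : s < 1 / 10 := by
    refine lt_of_le_of_ne h3 fun h => ?_
    rw [hBval] at hBm
    rw [h] at hg hBm
    nlinarith
  have hB0 : 0 ≤ B (x, s, y) := by rw [hBval]; linarith
  have hWpos : 0 < W (x, s, y) := by
    rw [hWq]
    have := Real.exp_pos (-l * y)
    positivity
  have h2' : 0 < s := by
    refine lt_of_le_of_ne h2 fun h => ?_
    rw [hWval, ← h] at hWpos
    simp at hWpos
  set c : ℝ := M * ‖x - x₀‖ ^ 2 + (K * s - N * s ^ 2) + m with hc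
  have hcB : ∀ y', B (x, s, y') + m = c + M * (y' - y₀) ^ 2 := fun y' => by
    simp only [hB, hc]; ring
  rcases h5.lt_or_eq with h5' | h5'
  · have hm₁ : (x + s • e, y) ∈ upBall d 1 := ⟨by simp only; linarith, h5'⟩
    have hm₂ : (x - s • e, y) ∈ upBall d 1 := ⟨by simp only; linarith, h5'⟩
    have hnhds : Q ∈ nhds (x, s, y) := by
      have c1 : Continuous fun z : Esp d × ℝ × ℝ => ‖z.1 - x₀‖ := by fun_prop
      have c2 : Continuous fun z : Esp d × ℝ × ℝ => |z.2.2 - y₀| := by fun_prop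
      have c3 : Continuous fun z : Esp d × ℝ × ℝ => z.2.1 := by fun_prop
      have c4 : Continuous fun z : Esp d × ℝ × ℝ => z.2.2 := by fun_prop
      filter_upwards [(isOpen_lt c1 continuous_const).mem_nhds h1',
        (isOpen_lt continuous_const c3).mem_nhds h2', (isOpen_lt c3 continuous_const).mem_nhds h3',
        (isOpen_lt c2 continuous_const).mem_nhds h4', (isOpen_lt continuous_const c4).mem_nhds h5']
        with z k1 k2 k3 k4 k5
      exact ⟨le_of_lt k1, le_of_lt k2, le_of_lt k3, le_of_lt k4, le_of_lt k5⟩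
    set β : ℝ := Real.exp (-l * y) with hβ
    have hβ0 : 0 < β := Real.exp_pos _
    have hWq' : u (x + s • e, y) - u (x - s • e, y) = β * (B (x, s, y) + m) := hWq
    have hvert : ∀ᶠ t in nhdsWithin (0 : ℝ) (Ioi 0),
        secDiff u (coordVec d none) (x + s • e, y) t -
          secDiff u (coordVec d none) (x - s • e, y) t ≤
        secDiff (fun y => Real.exp (-l * y) * (c + M * (y - y₀) ^ 2)) (1 : ℝ) y t := by
      filter_upwards [eventually_symm (eventually_line_mem hnhds ((0 : Esp d), (0 : ℝ), (1 : ℝ)))]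
        with t hk
      have k1 := hmax' _ hk.1
      have k2 := hmax' _ hk.2
      simp only [Prod.mk_add_mk, Prod.smul_mk, smul_zero, add_zero, smul_eq_mul, mul_one, mul_zero,
        ← sub_eq_add_neg, hcB, hW] at k1 k2
      rw [hcB] at hWq'
      simp only [secDiff, coordVec, Prod.mk_add_mk, Prod.mk_sub_mk, Prod.smul_mk,
        smul_zero, add_zero, sub_zero, smul_eq_mul, mul_one]
      linarith
    have htang : ∀ j, ∀ᶠ t in nhdsWithin (0 : ℝ) (Ioi 0),
        secDiff u (coordVec d (some j)) (x + s • e, y) t -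
          secDiff u (coordVec d (some j)) (x - s • e, y) t ≤ (2 * M * β) * t ^ 2 := by
      intro j
      filter_upwards [eventually_symm (eventually_line_mem hnhds
        (EuclideanSpace.single j (1 : ℝ), (0 : ℝ), (0 : ℝ)))] with t hk
      have k1 := hmax' _ hk.1
      have k2 := hmax' _ hk.2
      have e1 := norm_add_smul_single_sq (x - x₀) j t
      have e2 := norm_add_smul_single_sq (x - x₀) j (-t)
      rw [sub_add_eq_add_sub] at e1 e2
      simp only [hB, hW, Prod.mk_add_mk, Prod.smul_mk, smul_zero, add_zero, e1, e2, ← hβ]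
        at k1 k2 hWq'
      simp only [secDiff, coordVec, Prod.mk_add_mk, Prod.mk_sub_mk, Prod.smul_mk,
        smul_zero, add_zero, sub_zero]
      simp only [neg_smul, ← sub_eq_add_neg] at k1 k2
      rw [add_right_comm x (s • e), sub_add_eq_add_sub x (s • e), add_sub_right_comm x (s • e),
        sub_right_comm x (s • e)]
      linarith
    have hdir : ∀ᶠ t in nhdsWithin (0 : ℝ) (Ioi 0),
        secDiff u (coordVec d (some i)) (x + s • e, y) t -
          secDiff u (coordVec d (some i)) (x - s • e, y) t ≤ (-2 * N * β) * t ^ 2 := by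
      filter_upwards [eventually_symm (eventually_line_mem hnhds ((0 : Esp d), (1 : ℝ), (0 : ℝ)))]
        with t hk
      have k1 := hmax' _ hk.1
      have k2 := hmax' _ hk.2
      simp only [hB, hW, Prod.mk_add_mk, Prod.smul_mk, smul_zero, add_zero, smul_eq_mul, mul_one,
        mul_zero, ← sub_eq_add_neg, ← hβ, add_smul, sub_smul] at k1 k2 hWq'
      simp only [secDiff, coordVec, Prod.mk_add_mk, Prod.mk_sub_mk, Prod.smul_mk,
        smul_zero, add_zero, sub_zero, ← he]
      rw [add_assoc x, add_sub_assoc x, sub_add x, sub_sub x]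
      linarith
    have hvlim := tendsto_secDiff (u := fun y => Real.exp (-l * y) * (c + M * (y - y₀) ^ 2)) (p := y)
      (by fun_prop) 1
    rw [secondDeriv_exp_mul_parabola, ← hcB, ← hβ] at hvlim
    set q : ℝ := β * (l ^ 2 * (B (x, s, y) + m) - 4 * l * M * (y - y₀) + 2 * M) with hq
    have h := lapH_sub_le_sum (hharm.1.contDiffAt ((isOpen_upBall 1).mem_nhds hm₁))
      (hharm.1.contDiffAt ((isOpen_upBall 1).mem_nhds hm₂))
      (c := fun o => o.elim q fun j => 2 * M * β - if j = i then 2 * (N + M) * β else 0)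
      (g := fun o t => o.elim
        (secDiff (fun y => Real.exp (-l * y) * (c + M * (y - y₀) ^ 2)) (1 : ℝ) y t)
        fun j => (2 * M * β - if j = i then 2 * (N + M) * β else 0) * t ^ 2)
      (fun o => by
        cases o with
        | none => exact hvlim
        | some j => exact tendsto_mul_sq_div_sq _)
      (fun o => by
        cases o with
        | none => exact hvert
        | some j =>
          by_cases hj : j = i
          · subst hj
            simp only [Option.elim, if_true]
            rw [show 2 * M * β - 2 * (N + M) * β = -2 * N * β by ring]
            exact hdir
          · simp only [Option.elim, if_neg hj, sub_zero]
            exact htang j)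
    rw [hharm.2 _ hm₁, hharm.2 _ hm₂, Fintype.sum_option] at h
    simp only [Option.elim, Finset.sum_sub_distrib, Finset.sum_const, Finset.card_univ,
      Fintype.card_fin, nsmul_eq_mul, Finset.sum_ite_eq', Finset.mem_univ, if_true] at h
    have hSβ : 2 * S ≤ M * β := by
      have k1 : 1 ≤ Real.exp l * β := by
        rw [hβ, ← Real.exp_add]
        exact Real.one_le_exp (by nlinarith)
      rw [hM]
      nlinarith [mul_nonneg hS.le (by linarith : 0 ≤ Real.exp l * β - 1)]
    have hq2 : q ≤ M * β * (l ^ 2 + l + 2) := by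
      have k1 : β * (B (x, s, y) + m) ≤ M * β := by linarith
      have k2 := (abs_lt.1 h4').1
      have k3 : 0 ≤ β * M * l * ((y - y₀) + 1 / 10) := by
        have : 0 ≤ (y - y₀) + 1 / 10 := by linarith
        positivity
      have k4 := mul_le_mul_of_nonneg_left k1 (sq_nonneg l)
      have k5 : 0 < β * M * l := by positivity
      rw [hq]
      linarith
    rw [hN] at h
    have hMβ : 0 < M * β := by positivity
    have k6 : 0 < M * β * (l ^ 2 + l) := by positivity
    linarith
  · subst h5'
    have hx₁ : ‖x + s • e‖ < 1 := by nlinarith [norm_nonneg (x + s • e)]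
    have hx₂ : ‖x - s • e‖ < 1 := by nlinarith [norm_nonneg (x - s • e)]
    obtain ⟨l₁, hl₁, hlθ₁, hlf₁⟩ := hnd _ hx₁
    obtain ⟨l₂, hl₂, hlθ₂, hlf₂⟩ := hnd _ hx₂
    have hWq0 : W (x, s, 0) = B (x, s, 0) + m := by rw [hWq]; simp
    have hlim : l₁ - l₂ ≤ 2 * M * (0 - y₀) - l * (c + M * (0 - y₀) ^ 2) := by
      have hT := (hasDerivAt_exp_mul_parabola l c M y₀ 0).tendsto_slope_zero_right
      simp only [mul_zero, Real.exp_zero, one_mul] at hT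
      refine le_of_tendsto_of_tendsto (hl₁.sub hl₂) hT ?_
      have hev : ∀ᶠ t : ℝ in nhds 0, |t - y₀| < 1 / 10 := by
        have hc2 : Continuous fun t : ℝ => |t - y₀| := by fun_prop
        exact (isOpen_lt hc2 continuous_const).mem_nhds h4'
      filter_upwards [nhdsWithin_le_nhds hev, self_mem_nhdsWithin] with t ht ht0
      have ht0' : (0 : ℝ) < t := ht0
      have k := hmax' (x, s, t) ⟨h1, h2, h3, ht.le, ht0'.le⟩
      rw [hcB] at k hWq0
      simp only [hW] at k hWq0
      rw [← sub_div, smul_eq_mul, ← div_eq_inv_mul, zero_add]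
      refine div_le_div_of_nonneg_right ?_ ht0'.le
      linarith
    have hφ' := hφ _ _ hx₁ hx₂
    rw [show x + s • e - (x - s • e) = (2 * s) • e by module, norm_smul, hen,
      Real.norm_eq_abs, abs_of_pos (by positivity : 0 < 2 * s)] at hφ'
    have hφ'' := abs_le.1 hφ'
    have hWP : 2 * |P| * s < W (x, s, 0) := by
      rw [hWq0, hBval]
      have := mul_pos hM0 h2'
      linarith
    rw [hWval] at hWP
    have hjump := hf.neg_mul_sub_le (a := u (x + s • e, 0) - φ (x + s • e))
      (b := u (x - s • e, 0) - φ (x - s • e)) (by linarith) hlθ₁ hlθ₂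
      (fun h => hlf₁ (sub_ne_zero.1 h)) (fun h => hlf₂ (sub_ne_zero.1 h))
    rw [← hcB, ← hWq0, hWval] at hlim
    have hL2 := neg_abs_le L
    have hL3 := le_abs_self L
    have hL4 := abs_nonneg L
    rw [hWval] at hWpos
    set w := u (x + s • e, 0) - u (x - s • e, 0) with hw
    have hab : u (x + s • e, 0) - φ (x + s • e) - (u (x - s • e, 0) - φ (x - s • e)) ≤ 2 * w := by
      linarith
    have hab0 : 0 ≤ u (x + s • e, 0) - φ (x + s • e) - (u (x - s • e, 0) - φ (x - s • e)) := by
      linarith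
    have hLab : L * (u (x + s • e, 0) - φ (x + s • e) - (u (x - s • e, 0) - φ (x - s • e))) ≤
        |L| * (2 * w) := by
      exact (mul_le_mul_of_nonneg_right hL3 hab0).trans (mul_le_mul_of_nonneg_left hab hL4)
    have hMy0 := mul_pos hM0 hy₀0
    rw [hl] at hlim
    linarith

end TangentialBound

section GradientBound

variable {d : ℕ}

lemma le_of_backward_diff_le {h : ℝ → ℝ} {D K : ℝ} (hd : HasDerivAt h D 0)
    (hle : ∀ᶠ t in nhdsWithin (0 : ℝ) (Ioi 0), h 0 - h (-t) ≤ K * t) : D ≤ K := by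
  have hd' : HasDerivAt h D (-0) := by simpa using hd
  have h1 := (hd'.scomp (0 : ℝ) (hasDerivAt_neg (0 : ℝ))).neg.tendsto_slope_zero_right
  simp only [neg_smul, one_smul, neg_neg] at h1
  refine le_of_tendsto h1 ?_
  filter_upwards [hle, self_mem_nhdsWithin] with t ht ht0
  have ht0' : (0 : ℝ) < t := ht0
  simp only [Pi.neg_apply, Function.comp_apply, zero_add, neg_zero, smul_eq_mul]
  rw [← div_eq_inv_mul, div_le_iff₀ ht0']
  linarith

lemma le_of_symm_diff_le {h : ℝ → ℝ} {D K : ℝ} (hd : HasDerivAt h D 0)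
    (hle : ∀ᶠ t in nhdsWithin (0 : ℝ) (Ioi 0), h t - h (-t) ≤ K * t) : 2 * D ≤ K := by
  have hd' : HasDerivAt h D (-0) := by simpa using hd
  have h1 : HasDerivAt (fun t => h t - h (-t) + h 0) (2 * D) 0 :=
    ((hd.sub (hd'.scomp (0 : ℝ) (hasDerivAt_neg (0 : ℝ)))).add_const (h 0)).congr_deriv
      (by simp; ring)
  have h2 := h1.tendsto_slope_zero_right
  refine le_of_tendsto h2 ?_
  filter_upwards [hle, self_mem_nhdsWithin] with t ht ht0
  have ht0' : (0 : ℝ) < t := ht0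
  simp only [zero_add, neg_zero, smul_eq_mul]
  rw [← div_eq_inv_mul, div_le_iff₀ ht0']
  linarith

lemma hasDerivAt_tangential {u : Esp d × ℝ → ℝ} {p : Esp d × ℝ} (hu : ContDiffAt ℝ 2 u p)
    (i : Fin d) : HasDerivAt (fun t : ℝ => u (p.1 + t • EuclideanSpace.single i (1 : ℝ), p.2))
      (deriv (fun t : ℝ => u (p.1 + t • EuclideanSpace.single i (1 : ℝ), p.2)) 0) 0 := by
  have h := (eventually_hasDerivAt_line hu (coordVec d (some i))).self_of_nhds.differentiableAt
  refine DifferentiableAt.hasDerivAt (h.congr_of_eventuallyEq (.of_eq (funext fun t => ?_)))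
  congr 1
  ext1 <;> simp [coordVec]

lemma hasDerivAt_pdy {u : Esp d × ℝ → ℝ} {p : Esp d × ℝ} (hu : ContDiffAt ℝ 2 u p) :
    HasDerivAt (fun t : ℝ => u (p.1, p.2 + t)) (pdy d u p) 0 := by
  have h := (eventually_hasDerivAt_line hu (coordVec d none)).self_of_nhds.differentiableAt
  refine DifferentiableAt.hasDerivAt (h.congr_of_eventuallyEq (.of_eq (funext fun t => ?_)))
  congr 1
  ext1 <;> simp [coordVec]

/-- One-sided bounds for the partial derivatives of a bounded solution. -/
lemma partial_derivs_le {θ L P S l M N K K' : ℝ} (hθ : 0 < θ) (hS : 0 < S)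
    (hK' : K' = 400 * S * (d + 1) + θ + 1) (hl : l = 2 * |L| + 1)
    (hM : M = 200 * S * Real.exp l) (hN : N = M * (d + l ^ 2 + l + 1)) (hK : K = N + M + 2 * |P|)
    {f : ℝ → ℝ} {φ : Esp d → ℝ} {u : Esp d × ℝ → ℝ} (hf : GoodF θ L f)
    (hφ : ∀ x x', ‖x‖ < 1 → ‖x'‖ < 1 → |φ x - φ x'| ≤ |P| * ‖x - x'‖)
    (hu : TwoPhaseSolH d θ f φ u)
    (hb : ∀ p : Esp d × ℝ, ‖p.1‖ ^ 2 + p.2 ^ 2 < (3 / 4) ^ 2 → 0 ≤ p.2 → |u p| ≤ S)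
    {p : Esp d × ℝ} (hp : p ∈ upBall d (1 / 2)) :
    pdy d u p ≤ K' ∧ ∀ i : Fin d,
      2 * deriv (fun t : ℝ => u (p.1 + t • EuclideanSpace.single i (1 : ℝ), p.2)) 0 ≤ K := by
  have hmem : p ∈ upBall d 1 := ⟨by linarith [hp.1], hp.2⟩
  have hcd : ContDiffAt ℝ 2 u p := hu.2.1.1.contDiffAt ((isOpen_upBall 1).mem_nhds hmem)
  constructor
  · refine le_of_backward_diff_le (hasDerivAt_pdy hcd) ?_
    filter_upwards [nhdsWithin_le_nhds (gt_mem_nhds hp.2), self_mem_nhdsWithin] with t ht ht0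
    have ht0' : (0 : ℝ) < t := ht0
    have h := sub_le_of_normalDeriv_le hS hθ hK' hu.1 hu.2.1 (fun x hx => by
      obtain ⟨r, hr, hrθ, -⟩ := hu.2.2 x hx
      exact ⟨r, hr, (abs_le.1 hrθ).2⟩) hb (x₀ := p.1) (y₀ := p.2) (a₀ := p.2 + -t) hp
      (by linarith) (by linarith)
    rw [add_zero]
    linarith
  · intro i
    refine le_of_symm_diff_le (hasDerivAt_tangential hcd i) ?_
    filter_upwards [nhdsWithin_le_nhds (gt_mem_nhds (by norm_num : (0 : ℝ) < 1 / 10)),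
      self_mem_nhdsWithin] with t ht ht0
    have ht0' : (0 : ℝ) < t := ht0
    rw [neg_smul, ← sub_eq_add_neg]
    exact tangential_diff_le hS hl hM hN hK hf hφ hu hb i (x₀ := p.1) (y₀ := p.2) hp ht0'.le ht.le

end GradientBound

/-- **full Lipschitz bound.** There is `C > 0`, depending only on `d`, `θ`,
`‖u‖_{L²(B₁⁺)}`, the Lipschitz constant of `f`, and `‖φ‖_{C¹(B₁')}`, such that every
solution `u` of the two-phase thin obstacle problem with
`∫_{B₁⁺}(|u|² + |∇u|²) < ∞` and `C^{1,1}` obstacle `φ` satisfies `|∇u| ≤ C` in `B_{1/2}⁺`. -/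
theorem statement14
    (d : ℕ) (hd : 1 ≤ d) (θ A L P : ℝ) (hθ : 0 < θ) :
    ∃ C > 0, ∀ (f : ℝ → ℝ) (φ : Esp d → ℝ) (u : Esp d × ℝ → ℝ),
      GoodF θ L f →
      (∀ x : Esp d, ‖x‖ < 1 → DifferentiableAt ℝ φ x ∧ |φ x| ≤ P ∧ ‖fderiv ℝ φ x‖ ≤ P) →
      (∃ M : ℝ, ∀ x y : Esp d, ‖x‖ < 1 → ‖y‖ < 1 →
        ‖fderiv ℝ φ x - fderiv ℝ φ y‖ ≤ M * ‖x - y‖) →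
      TwoPhaseSolH d θ f φ u →
      IntegrableOn (fun p => (u p)^2 + gradSqH d u p) (upBall d 1) volume →
      (∫ p in upBall d 1, (u p)^2) ≤ A^2 →
      ∀ p ∈ upBall d (1/2), Real.sqrt (gradSqH d u p) ≤ C := by
  obtain ⟨S, hS, hsup⟩ := exists_sup_bound d A hθ
  set K' : ℝ := 400 * S * (d + 1) + θ + 1 with hK'
  set l : ℝ := 2 * |L| + 1 with hl
  set M : ℝ := 200 * S * Real.exp l with hM
  set N : ℝ := M * (d + l ^ 2 + l + 1) with hN
  set K : ℝ := N + M + 2 * |P| with hK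
  refine ⟨Real.sqrt (d * K ^ 2 + K' ^ 2), by positivity, ?_⟩
  intro f φ u hf hφ _ hu hi hA p hp
  have hb := hsup f φ u hu hi hA
  have hlip : ∀ x x' : Esp d, ‖x‖ < 1 → ‖x'‖ < 1 → |φ x - φ x'| ≤ |P| * ‖x - x'‖ := by
    intro x x' hx hx'
    have h := (convex_ball (0 : Esp d) 1).norm_image_sub_le_of_norm_fderiv_le (𝕜 := ℝ) (f := φ)
      (C := |P|) (fun z hz => (hφ z (mem_ball_zero_iff.1 hz)).1)
      (fun z hz => (hφ z (mem_ball_zero_iff.1 hz)).2.2.trans (le_abs_self P))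
      (mem_ball_zero_iff.2 hx') (mem_ball_zero_iff.2 hx)
    rwa [Real.norm_eq_abs] at h
  have hupper := partial_derivs_le hθ hS hK' hl hM hN hK hf hlip hu hb hp
  have hlower := partial_derivs_le (φ := fun x => -φ x) (u := fun q => -u q) hθ hS hK' hl hM hN hK
    hf (fun x x' hx hx' => by
      rw [show -φ x - -φ x' = -(φ x - φ x') by ring, abs_neg]
      exact hlip x x' hx hx') hu.neg
    (fun q hq hq0 => by rw [abs_neg]; exact hb q hq hq0) hp
  unfold pdy at hlower
  simp only [deriv.fun_neg] at hlower
  have hK0 : 0 ≤ K := by positivity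
  refine Real.sqrt_le_sqrt (add_le_add ?_ ?_)
  · unfold tangGradSq
    calc _ ≤ ∑ _i : Fin d, K ^ 2 := Finset.sum_le_sum fun i _ => by
          have h1 := hupper.2 i
          have h2 := hlower.2 i
          exact sq_le_sq' (by linarith) (by linarith)
      _ = d * K ^ 2 := by simp
  · exact sq_le_sq' (by unfold pdy; linarith [hlower.1]) hupper.1
end

section
/- Let d ≥ 1 be an integer and θ > 0. Let u : ℝ^d × [0,∞) → ℝ be Lipschitz, harmonic in the open half-space ℝ^d × (0,∞), and such that for every x ∈ ℝ^d the one-sided derivative ∂_y u(x,0) := lim_{t→0⁺}(u(x,t) − u(x,0))/t exists, |∂_y u(x,0)| ≤ θ, and ∂_y u(x,0) = θ·sign(u(x,0)) whenever u(x,0) ≠ 0. If u(0,0) = 0, then u(x,0) = 0 for every x ∈ ℝ^d. -/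
open MeasureTheory Set

open Filter Topology InnerProductSpace
open scoped Laplacian

section

variable {E : Type*} [NormedAddCommGroup E] [InnerProductSpace ℝ E]

lemma deriv_deriv_line_eq_iteratedFDeriv {f : E → ℝ} {X : E} (hf : ContDiffAt ℝ 2 f X) (w : E) :
    deriv (deriv (fun t : ℝ => f (X + t • w))) 0 = iteratedFDeriv ℝ 2 f X ![w, w] := by
  have hline : ∀ t : ℝ, HasDerivAt (fun t : ℝ => X + t • w) w t := fun t =>
    (((hasDerivAt_id' t).smul_const w).const_add X).congr_deriv (one_smul ℝ w)
  have hcont : Tendsto (fun t : ℝ => X + t • w) (𝓝 0) (𝓝 X) := by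
    have : ContinuousAt (fun t : ℝ => X + t • w) 0 := by fun_prop
    simpa [ContinuousAt] using this
  have hev : deriv (fun t : ℝ => f (X + t • w)) =ᶠ[𝓝 0]
      fun t : ℝ => fderiv ℝ f (X + t • w) w := by
    filter_upwards [hcont.eventually (hf.eventually (by simp))] with t ht
    have hd : HasFDerivAt f (fderiv ℝ f (X + t • w)) (X + t • w) :=
      (ht.differentiableAt two_ne_zero).hasFDerivAt
    exact (hd.comp_hasDerivAt t (hline t)).deriv
  rw [hev.deriv_eq, iteratedFDeriv_two_apply]
  have h2 : HasFDerivAt (fderiv ℝ f) (fderiv ℝ (fderiv ℝ f) X) (X + (0 : ℝ) • w) := by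
    rw [zero_smul, add_zero]
    exact ((hf.fderiv_right (m := 1) le_rfl).differentiableAt one_ne_zero).hasFDerivAt
  have h4 : HasDerivAt (fun t : ℝ => fderiv ℝ f (X + t • w)) (fderiv ℝ (fderiv ℝ f) X w) 0 :=
    h2.comp_hasDerivAt 0 (hline 0)
  have h3 := h4.clm_apply (hasDerivAt_const (0 : ℝ) w)
  refine h3.deriv.trans ?_
  simp

lemma deriv_deriv_nonpos_of_isLocalMax {g : ℝ → ℝ} {a : ℝ} (hc : ContinuousAt g a)
    (h : IsLocalMax g a) : deriv (deriv g) a ≤ 0 := by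
  by_contra! hpos
  have hmin := isLocalMin_of_deriv_deriv_pos hpos h.deriv_eq_zero hc
  have hconst : g =ᶠ[𝓝 a] fun _ => g a := by
    filter_upwards [h, hmin] with t h1 h2 using le_antisymm h1 h2
  have : deriv g =ᶠ[𝓝 a] fun _ => 0 := by
    filter_upwards [hconst.eventuallyEq_nhds] with t ht
    simp [ht.deriv_eq]
  simp [this.deriv_eq] at hpos

lemma deriv_deriv_quadratic_rpow {α β γ r : ℝ} (hα : 0 < α) :
    deriv (deriv (fun t : ℝ => (α + β * t + γ * t ^ 2) ^ r)) 0
      = r * (r - 1) * α ^ (r - 2) * β ^ 2 + r * α ^ (r - 1) * (2 * γ) := by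
  have hq : ∀ t : ℝ, HasDerivAt (fun t : ℝ => α + β * t + γ * t ^ 2) (β + 2 * γ * t) t := by
    intro t
    have := (((hasDerivAt_id' t).const_mul β).const_add α).add ((hasDerivAt_pow 2 t).const_mul γ)
    exact this.congr_deriv (by simp; ring)
  have hpos : ∀ᶠ t : ℝ in 𝓝 0, 0 < α + β * t + γ * t ^ 2 :=
    (hq 0).continuousAt.eventually_const_lt (by simpa using hα)
  have hev : deriv (fun t : ℝ => (α + β * t + γ * t ^ 2) ^ r) =ᶠ[𝓝 0]
      fun t : ℝ => (β + 2 * γ * t) * r * (α + β * t + γ * t ^ 2) ^ (r - 1) := by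
    filter_upwards [hpos] with t ht
    exact ((hq t).rpow_const (Or.inl ht.ne')).deriv
  rw [hev.deriv_eq]
  have h1 : HasDerivAt (fun t : ℝ => (β + 2 * γ * t) * r) (2 * γ * r) 0 := by
    simpa using (((hasDerivAt_id (0 : ℝ)).const_mul (2 * γ)).const_add β).mul_const r
  have h2 := h1.mul ((hq 0).rpow_const (p := r - 1) (Or.inl (by simpa using hα.ne')))
  rw [show r - 2 = r - 1 - 1 by ring]
  refine h2.deriv.trans ?_
  simp; ring

lemma norm_add_smul_sq (Y w : E) (t : ℝ) :
    ‖Y + t • w‖ ^ 2 = ‖Y‖ ^ 2 + 2 * ⟪Y, w⟫_ℝ * t + ‖w‖ ^ 2 * t ^ 2 := by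
  rw [norm_add_sq_real, inner_smul_right, norm_smul, mul_pow, Real.norm_eq_abs, sq_abs]; ring

lemma contDiffAt_radial_rpow {P X : E} (hX : X ≠ P) {ρ : ℝ} (hρ : 0 < ρ) (r : ℝ) :
    ContDiffAt ℝ 2 (fun Z => (‖Z - P‖ ^ 2 / ρ ^ 2) ^ r) X := by
  have hpos : 0 < ‖X - P‖ := norm_pos_iff.2 (sub_ne_zero.2 hX)
  refine ContDiffAt.rpow_const_of_ne ?_ (by positivity)
  exact (((contDiff_id.sub contDiff_const).norm_sq ℝ).div_const _).contDiffAt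

variable [FiniteDimensional ℝ E]

lemma laplacian_eq_sum_deriv_deriv_line {ι : Type*} [Fintype ι] (b : OrthonormalBasis ι ℝ E)
    {f : E → ℝ} {X : E} (hf : ContDiffAt ℝ 2 f X) :
    Δ f X = ∑ i, deriv (deriv (fun t : ℝ => f (X + t • b i))) 0 := by
  simp [laplacian_eq_iteratedFDeriv_orthonormalBasis f b, deriv_deriv_line_eq_iteratedFDeriv hf]

lemma laplacian_nonpos_of_isLocalMax {f : E → ℝ} {X : E} (hf : ContDiffAt ℝ 2 f X)
    (h : IsLocalMax f X) : Δ f X ≤ 0 := by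
  rw [laplacian_eq_sum_deriv_deriv_line (stdOrthonormalBasis ℝ E) hf]
  refine Finset.sum_nonpos fun i _ => ?_
  have hline : Continuous (fun t : ℝ => X + t • stdOrthonormalBasis ℝ E i) := by fun_prop
  have h0 : X + (0 : ℝ) • stdOrthonormalBasis ℝ E i = X := by simp
  refine deriv_deriv_nonpos_of_isLocalMax
    (ContinuousAt.comp (by simpa using hf.continuousAt) hline.continuousAt) ?_
  exact IsLocalMax.comp_continuous (g := fun t : ℝ => X + t • stdOrthonormalBasis ℝ E i)
    (by simpa using h) hline.continuousAt

lemma laplacian_radial_rpow {P X : E} (hX : X ≠ P) {ρ : ℝ} (hρ : 0 < ρ) (r : ℝ) :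
    Δ (fun Z => (‖Z - P‖ ^ 2 / ρ ^ 2) ^ r) X
      = r * (‖X - P‖ ^ 2 / ρ ^ 2) ^ (r - 1) / ρ ^ 2 *
        (4 * (r - 1) + 2 * Module.finrank ℝ E) := by
  have hpos : 0 < ‖X - P‖ := norm_pos_iff.2 (sub_ne_zero.2 hX)
  set b := stdOrthonormalBasis ℝ E
  rw [laplacian_eq_sum_deriv_deriv_line b (contDiffAt_radial_rpow hX hρ r)]
  set α := ‖X - P‖ ^ 2 / ρ ^ 2 with hα
  have hα0 : 0 < α := by positivity
  have key : ∀ i, deriv (deriv (fun t : ℝ => (‖X + t • b i - P‖ ^ 2 / ρ ^ 2) ^ r)) 0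
      = r * (r - 1) * α ^ (r - 2) * (4 / ρ ^ 4) * ⟪X - P, b i⟫_ℝ ^ 2
        + r * α ^ (r - 1) * (2 / ρ ^ 2) := by
    intro i
    have : (fun t : ℝ => (‖X + t • b i - P‖ ^ 2 / ρ ^ 2) ^ r) =
        fun t : ℝ => (α + (2 * ⟪X - P, b i⟫_ℝ / ρ ^ 2) * t + (1 / ρ ^ 2) * t ^ 2) ^ r := by
      ext t
      rw [add_sub_right_comm, norm_add_smul_sq, b.norm_eq_one, hα]
      congr 1; field_simp
    rw [this, deriv_deriv_quadratic_rpow hα0]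
    ring
  simp only [key]
  rw [Finset.sum_add_distrib, ← Finset.mul_sum, b.sum_sq_inner_left, Finset.sum_const,
    Finset.card_univ, Fintype.card_fin, nsmul_eq_mul]
  have h2 : α ^ (r - 1) = α ^ (r - 2) * α := by
    rw [← Real.rpow_add_one hα0.ne']; ring_nf
  rw [show ‖X - P‖ ^ 2 = α * ρ ^ 2 by rw [hα]; field_simp, h2]
  field_simp

end

section

variable {E : Type*} [NormedAddCommGroup E] [InnerProductSpace ℝ E]

lemma hasDerivAt_radial_rpow_line {P X : E} (hX : X ≠ P) {ρ : ℝ} (hρ : 0 < ρ) (r : ℝ) (w : E) :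
    HasDerivAt (fun t : ℝ => (‖X + t • w - P‖ ^ 2 / ρ ^ 2) ^ r)
      (2 * ⟪X - P, w⟫_ℝ / ρ ^ 2 * r * (‖X - P‖ ^ 2 / ρ ^ 2) ^ (r - 1)) 0 := by
  have hpos : 0 < ‖X - P‖ := norm_pos_iff.2 (sub_ne_zero.2 hX)
  have hfun : (fun t : ℝ => ‖X + t • w - P‖ ^ 2 / ρ ^ 2) =
      fun t : ℝ => (‖X - P‖ ^ 2 + 2 * ⟪X - P, w⟫_ℝ * t + ‖w‖ ^ 2 * t ^ 2) / ρ ^ 2 := by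
    ext t
    rw [add_sub_right_comm, norm_add_smul_sq]
  have hd : HasDerivAt (fun t : ℝ => ‖X + t • w - P‖ ^ 2 / ρ ^ 2)
      (2 * ⟪X - P, w⟫_ℝ / ρ ^ 2) 0 := by
    rw [hfun]
    have := ((((hasDerivAt_id' (0 : ℝ)).const_mul (2 * ⟪X - P, w⟫_ℝ)).const_add
      (‖X - P‖ ^ 2)).add ((hasDerivAt_pow 2 (0 : ℝ)).const_mul (‖w‖ ^ 2))).div_const (ρ ^ 2)
    exact this.congr_deriv (by simp)
  have hne : ‖X + (0 : ℝ) • w - P‖ ^ 2 / ρ ^ 2 ≠ 0 := by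
    rw [zero_smul, add_zero]; positivity
  simpa using hd.rpow_const (p := r) (Or.inl hne)

variable [FiniteDimensional ℝ E]

/-- `v` is harmonic in the half-space `{⟪e, X⟫ > 0}`, continuous up to the boundary, and its inward
normal derivative is nonnegative at the boundary points where `v` is positive. -/
structure HalfSpaceSubsolution (e : E) (v : E → ℝ) : Prop where
  continuousOn : ContinuousOn v {X | 0 ≤ ⟪e, X⟫_ℝ}
  harmonicOn : HarmonicOnNhd v {X | 0 < ⟪e, X⟫_ℝ}
  slope_nonneg : ∀ X, ⟪e, X⟫_ℝ = 0 → 0 < v X →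
    ∃ L, 0 ≤ L ∧ Tendsto (fun t : ℝ => (v (X + t • e) - v X) / t) (𝓝[>] 0) (𝓝 L)

lemma HalfSpaceSubsolution.le_sub_radial {e : E} (he : ‖e‖ = 1) {v : E → ℝ}
    (hv : HalfSpaceSubsolution e v) {S : ℝ} (hS : ∀ X, 0 ≤ ⟪e, X⟫_ℝ → v X ≤ S)
    {P : E} {ρ δ M p : ℝ} (hρ : 0 < ρ) (hP : 0 < ⟪e, P⟫_ℝ) (hδ : 0 < δ) (hδS : δ ≤ S)
    (hball : ∀ X, ‖X - P‖ ≤ ρ → v X ≤ S - δ) (hp : 0 < p)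
    (hn : Module.finrank ℝ E < 2 * (p + 1)) {X : E} (hX : 0 ≤ ⟪e, X⟫_ℝ)
    (hρX : ρ ≤ ‖X - P‖) (hXM : ‖X - P‖ ≤ M) :
    v X ≤ S - δ * ((‖X - P‖ ^ 2 / ρ ^ 2) ^ (-p) - (M ^ 2 / ρ ^ 2) ^ (-p)) := by
  by_contra! hcon
  set φ : E → ℝ := fun Z => (‖Z - P‖ ^ 2 / ρ ^ 2) ^ (-p) with hφ
  set K : Set E := {Z | 0 ≤ ⟪e, Z⟫_ℝ ∧ ρ ≤ ‖Z - P‖ ∧ ‖Z - P‖ ≤ M} with hK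
  have hne : ∀ {Z}, ρ ≤ ‖Z - P‖ → Z ≠ P := by
    rintro Z hZ rfl
    simp at hZ; linarith
  have hKc : IsCompact K := by
    refine (isCompact_closedBall P M).of_isClosed_subset ?_ ?_
    · have h1 : IsClosed {Z : E | 0 ≤ ⟪e, Z⟫_ℝ} := isClosed_le continuous_const (by fun_prop)
      have h2 : IsClosed {Z : E | ρ ≤ ‖Z - P‖} := isClosed_le continuous_const (by fun_prop)
      have h3 : IsClosed {Z : E | ‖Z - P‖ ≤ M} := isClosed_le (by fun_prop) continuous_const
      exact h1.inter (h2.inter h3)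
    · intro Z hZ
      simpa [dist_eq_norm] using hZ.2.2
  have hφc : ContinuousOn φ K := fun Z hZ =>
    (contDiffAt_radial_rpow (hne hZ.2.1) hρ (-p)).continuousAt.continuousWithinAt
  have hFc : ContinuousOn (fun Z => v Z + δ * φ Z) K :=
    (hv.continuousOn.mono fun Z hZ => hZ.1).add (continuousOn_const.mul hφc)
  obtain ⟨Z, hZK, hZmax⟩ := hKc.exists_isMaxOn ⟨X, hX, hρX, hXM⟩ hFc
  have hM : 0 < M := hρ.trans_le (hρX.trans hXM)
  have hM0 : 0 < (M ^ 2 / ρ ^ 2) ^ (-p) := Real.rpow_pos_of_pos (by positivity) _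
  have hZX : S + δ * (M ^ 2 / ρ ^ 2) ^ (-p) < v Z + δ * φ Z := by
    have : v X + δ * φ X ≤ v Z + δ * φ Z := hZmax ⟨hX, hρX, hXM⟩
    have h3 : φ X = (‖X - P‖ ^ 2 / ρ ^ 2) ^ (-p) := rfl
    rw [← h3] at hcon
    linarith
  obtain ⟨hZe, hZρ, hZM⟩ := hZK
  have hφ1 : φ Z ≤ 1 := by
    refine Real.rpow_le_one_of_one_le_of_nonpos ?_ (by linarith)
    rw [one_le_div (by positivity)]
    gcongr
  have hZM' : ‖Z - P‖ < M := by
    refine lt_of_le_of_ne hZM fun h => ?_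
    have : φ Z = (M ^ 2 / ρ ^ 2) ^ (-p) := by rw [hφ]; simp only [h]
    rw [this] at hZX
    linarith [hS Z hZe]
  have hδM : 0 < δ * (M ^ 2 / ρ ^ 2) ^ (-p) := by positivity
  have hZρ' : ρ < ‖Z - P‖ := by
    refine lt_of_le_of_ne hZρ fun h => ?_
    nlinarith [hball Z h.symm.le]
  have hnear : ∀ᶠ Y in 𝓝 Z, ρ ≤ ‖Y - P‖ ∧ ‖Y - P‖ ≤ M := by
    have hc : Continuous fun Y : E => ‖Y - P‖ := by fun_prop
    filter_upwards [hc.continuousAt.eventually_const_lt hZρ',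
      hc.continuousAt.eventually_lt_const hZM'] with Y h1 h2 using ⟨h1.le, h2.le⟩
  have hZP := hne hZρ
  have hα : 0 < ‖Z - P‖ ^ 2 / ρ ^ 2 := by
    have := hρ.trans hZρ'
    positivity
  rcases hZe.eq_or_lt with h0 | h0
  · have hvpos : 0 < v Z := by nlinarith
    obtain ⟨L, hL, hLt⟩ := hv.slope_nonneg Z h0.symm hvpos
    have hd := hasDerivAt_radial_rpow_line hZP hρ (-p) e
    rw [hasDerivAt_iff_tendsto_slope_zero] at hd
    have hd' := (hd.mono_left (nhdsGT_le_nhdsNE 0)).const_mul δ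
    have hlim := hLt.add hd'
    have hle := le_of_tendsto hlim (b := 0) ?_
    · have hin : ⟪Z - P, e⟫_ℝ < 0 := by
        rw [inner_sub_left, real_inner_comm e Z, real_inner_comm e P, ← h0]; linarith
      have : 0 < 2 * ⟪Z - P, e⟫_ℝ / ρ ^ 2 * (-p) * (‖Z - P‖ ^ 2 / ρ ^ 2) ^ (-p - 1) := by
        refine mul_pos ?_ (Real.rpow_pos_of_pos hα _)
        refine mul_pos_of_neg_of_neg (div_neg_of_neg_of_pos (by linarith) (by positivity))
          (by linarith)
      nlinarith
    · have hline : Tendsto (fun t : ℝ => Z + t • e) (𝓝[>] 0) (𝓝 Z) := by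
        have : ContinuousAt (fun t : ℝ => Z + t • e) 0 := by fun_prop
        have h2 : Tendsto (fun t : ℝ => Z + t • e) (𝓝 0) (𝓝 Z) := by
          simpa [ContinuousAt] using this
        exact h2.mono_left nhdsWithin_le_nhds
      filter_upwards [hline.eventually hnear, self_mem_nhdsWithin] with t ht (ht0 : 0 < t)
      have hmem : Z + t • e ∈ K := by
        refine ⟨?_, ht⟩
        rw [inner_add_right, inner_smul_right, real_inner_self_eq_norm_sq, he, ← h0]
        linarith
      have hle : v (Z + t • e) + δ * φ (Z + t • e) ≤ v Z + δ * φ Z := hZmax hmem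
      have : (v (Z + t • e) - v Z) / t + δ * (t⁻¹ * (φ (Z + t • e) - φ Z)) ≤ 0 := by
        rw [show (v (Z + t • e) - v Z) / t + δ * (t⁻¹ * (φ (Z + t • e) - φ Z)) =
          ((v (Z + t • e) + δ * φ (Z + t • e)) - (v Z + δ * φ Z)) / t by field_simp; ring]
        exact div_nonpos_of_nonpos_of_nonneg (by linarith) ht0.le
      simpa [hφ] using this
  · have hKn : K ∈ 𝓝 Z := by
      have hc : Continuous fun Y : E => ⟪e, Y⟫_ℝ := by fun_prop
      filter_upwards [hnear, hc.continuousAt.eventually_const_lt h0] with Y h1 h2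
      exact ⟨h2.le, h1⟩
    have hmax : IsLocalMax (v + δ • φ) Z := hZmax.isLocalMax hKn
    obtain ⟨hvC, hvΔ⟩ := hv.harmonicOn Z h0
    have hφC : ContDiffAt ℝ 2 φ Z := contDiffAt_radial_rpow hZP hρ (-p)
    have hδφC : ContDiffAt ℝ 2 (δ • φ) Z := hφC.const_smul δ
    have hsum : ContDiffAt ℝ 2 (v + δ • φ) Z := hvC.add hδφC
    have hle : Δ (v + δ • φ) Z ≤ 0 := laplacian_nonpos_of_isLocalMax hsum hmax
    rw [hvC.laplacian_add hδφC, hvΔ.self_of_nhds, laplacian_smul _ hφC, hφ,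
      laplacian_radial_rpow hZP hρ] at hle
    have h1 : 0 < (‖Z - P‖ ^ 2 / ρ ^ 2) ^ (-p - 1) := Real.rpow_pos_of_pos hα _
    have h2 : 0 < δ • (-p * (‖Z - P‖ ^ 2 / ρ ^ 2) ^ (-p - 1) / ρ ^ 2 *
        (4 * (-p - 1) + 2 * (Module.finrank ℝ E : ℝ))) := by
      rw [smul_eq_mul]
      refine mul_pos hδ (mul_pos_of_neg_of_neg ?_ (by linarith))
      refine div_neg_of_neg_of_pos (mul_neg_of_neg_of_pos (by linarith) h1) (by positivity)
    simp only [Pi.zero_apply, zero_add] at hle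
    linarith

end

section

variable {E : Type*} [NormedAddCommGroup E] [InnerProductSpace ℝ E] [FiniteDimensional ℝ E]

lemma laplacian_comp_add_linearIsometryEquiv {f : E → ℝ} (c : E) (R : E ≃ₗᵢ[ℝ] E) {X : E}
    (hf : ContDiffAt ℝ 2 f (c + R X)) :
    Δ (fun Z => f (c + R Z)) X = Δ f (c + R X) := by
  set b := stdOrthonormalBasis ℝ E
  have hc : ContDiffAt ℝ 2 (fun Z => f (c + R Z)) X :=
    ContDiffAt.comp X hf (contDiff_const.add R.contDiff).contDiffAt
  rw [laplacian_eq_sum_deriv_deriv_line b hc, laplacian_eq_sum_deriv_deriv_line (b.map R) hf]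
  simp [add_assoc]

lemma InnerProductSpace.HarmonicAt.comp_add_linearIsometryEquiv {f : E → ℝ} {c : E}
    {R : E ≃ₗᵢ[ℝ] E} {X : E} (hf : HarmonicAt f (c + R X)) :
    HarmonicAt (fun Z => f (c + R Z)) X := by
  have hc : ContDiff ℝ 2 (fun Z => c + R Z) := contDiff_const.add R.contDiff
  refine ⟨ContDiffAt.comp X hf.1 hc.contDiffAt, ?_⟩
  have ht : Tendsto (fun Z => c + R Z) (𝓝 X) (𝓝 (c + R X)) := hc.continuous.continuousAt
  filter_upwards [ht.eventually hf.eventually] with Z hZ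
  rw [laplacian_comp_add_linearIsometryEquiv c R hZ.1, hZ.2.self_of_nhds]
  rfl

lemma laplacian_quadratic_barrier (m k : E) (hk : ‖k‖ = 1) (a r l : ℝ) (Z : E) :
    ContDiffAt ℝ 2 (fun Z => a * (‖Z - m‖ ^ 2 + l * (r * ⟪k, Z - m⟫_ℝ - ⟪k, Z - m⟫_ℝ ^ 2))) Z ∧
    Δ (fun Z => a * (‖Z - m‖ ^ 2 + l * (r * ⟪k, Z - m⟫_ℝ - ⟪k, Z - m⟫_ℝ ^ 2))) Z
      = a * (2 * Module.finrank ℝ E - 2 * l) := by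
  have hC : ContDiffAt ℝ 2
      (fun Z => a * (‖Z - m‖ ^ 2 + l * (r * ⟪k, Z - m⟫_ℝ - ⟪k, Z - m⟫_ℝ ^ 2))) Z := by
    have h1 : ContDiff ℝ 2 (fun Z : E => ‖Z - m‖ ^ 2) :=
      (contDiff_id.sub contDiff_const).norm_sq ℝ
    have h2 : ContDiff ℝ 2 (fun Z : E => ⟪k, Z - m⟫_ℝ) :=
      contDiff_const.inner ℝ (contDiff_id.sub contDiff_const)
    exact (contDiff_const.mul (h1.add (contDiff_const.mul
      ((contDiff_const.mul h2).sub (h2.pow 2))))).contDiffAt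
  refine ⟨hC, ?_⟩
  set b := stdOrthonormalBasis ℝ E
  rw [laplacian_eq_sum_deriv_deriv_line b hC]
  have hquad : ∀ α β γ : ℝ, deriv (deriv (fun t : ℝ => α + β * t + γ * t ^ 2)) 0 = 2 * γ := by
    intro α β γ
    have h1 : deriv (fun t : ℝ => α + β * t + γ * t ^ 2) = fun t => β + 2 * γ * t := by
      ext t
      have := (((hasDerivAt_id' t).const_mul β).const_add α).add
        ((hasDerivAt_pow 2 t).const_mul γ)
      exact (this.congr_deriv (by simp; ring)).deriv
    rw [h1]
    simp
  have key : ∀ i, deriv (deriv (fun t : ℝ => a * (‖Z + t • b i - m‖ ^ 2 + l *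
      (r * ⟪k, Z + t • b i - m⟫_ℝ - ⟪k, Z + t • b i - m⟫_ℝ ^ 2)))) 0
      = 2 * a - 2 * a * l * ⟪k, b i⟫_ℝ ^ 2 := by
    intro i
    have : (fun t : ℝ => a * (‖Z + t • b i - m‖ ^ 2 + l *
      (r * ⟪k, Z + t • b i - m⟫_ℝ - ⟪k, Z + t • b i - m⟫_ℝ ^ 2))) = fun t : ℝ =>
        (a * (‖Z - m‖ ^ 2 + l * (r * ⟪k, Z - m⟫_ℝ - ⟪k, Z - m⟫_ℝ ^ 2))) +
        (a * (2 * ⟪Z - m, b i⟫_ℝ + l * (r * ⟪k, b i⟫_ℝ - 2 * ⟪k, Z - m⟫_ℝ * ⟪k, b i⟫_ℝ))) * t +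
        (a * (1 - l * ⟪k, b i⟫_ℝ ^ 2)) * t ^ 2 := by
      ext t
      rw [add_sub_right_comm, norm_add_smul_sq, b.norm_eq_one, inner_add_right, inner_smul_right]
      ring
    rw [this, hquad]
    ring
  simp only [key]
  rw [Finset.sum_sub_distrib, ← Finset.mul_sum _ _ (2 * a * l),
    b.sum_sq_inner_left, hk, Finset.sum_const,
    Finset.card_univ, Fintype.card_fin, nsmul_eq_mul]
  ring

lemma reflection_difference_le {v : E → ℝ} {m k : E} (hk : ‖k‖ = 1) {r C : ℝ} (hr : 0 < r)
    (hC : 0 < C) (hv : HarmonicOnNhd v (Metric.closedBall m r))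
    (hosc : ∀ X ∈ Metric.closedBall m r, ∀ Y ∈ Metric.closedBall m r, v X - v Y ≤ C)
    {ξ : ℝ} (h0 : 0 ≤ ξ) (hξ : ξ ≤ r) :
    v (m + ξ • k) - v (m - ξ • k) ≤ C * (Module.finrank ℝ E + 2) * ξ / r := by
  set n : ℝ := (Module.finrank ℝ E : ℝ) with hn
  set R : E ≃ₗᵢ[ℝ] E := (ℝ ∙ k)ᗮ.reflection with hR
  have hRk : R k = -k := Submodule.reflection_orthogonalComplement_singleton_eq_neg k
  have hRm : ∀ Z, (m - R m) + R Z = m + R (Z - m) := fun Z => by rw [map_sub]; abel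
  have hnorm : ∀ Z, ‖(m - R m) + R Z - m‖ = ‖Z - m‖ := fun Z => by
    rw [hRm, add_sub_cancel_left, R.norm_map]
  set B : E → ℝ := fun Z => C / r ^ 2 * (‖Z - m‖ ^ 2 +
    (n + 1) * (r * ⟪k, Z - m⟫_ℝ - ⟪k, Z - m⟫_ℝ ^ 2)) with hB
  set w : E → ℝ := fun Z => v ((m - R m) + R Z) with hw
  set K : Set E := Metric.closedBall m r ∩ {Z | 0 ≤ ⟪k, Z - m⟫_ℝ} with hK
  have hKc : IsCompact K := (isCompact_closedBall m r).inter_right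
    (isClosed_le continuous_const (by fun_prop))
  have hσ : ∀ Z ∈ Metric.closedBall m r, (m - R m) + R Z ∈ Metric.closedBall m r := by
    intro Z hZ
    rw [mem_closedBall_iff_norm] at hZ ⊢
    rwa [hnorm]
  have hwH : HarmonicOnNhd w (Metric.closedBall m r) := fun Z hZ =>
    (hv _ (hσ Z hZ)).comp_add_linearIsometryEquiv
  have hBC := fun Z => (laplacian_quadratic_barrier m k hk (C / r ^ 2) r (n + 1) Z).1
  have hs_le : ∀ Z ∈ Metric.closedBall m r, ⟪k, Z - m⟫_ℝ ≤ r := fun Z hZ => by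
    rw [mem_closedBall_iff_norm] at hZ
    calc ⟪k, Z - m⟫_ℝ ≤ ‖k‖ * ‖Z - m‖ := real_inner_le_norm _ _
      _ ≤ r := by rw [hk, one_mul]; exact hZ
  have hmain : ∀ Z ∈ K, v Z - w Z ≤ B Z := by
    by_contra! hcon
    obtain ⟨Y, hYK, hY⟩ := hcon
    have hFc : ContinuousOn (v - w - B) K := by
      refine ((hv.continuousOn.mono inter_subset_left).sub
        (hwH.continuousOn.mono inter_subset_left)).sub ?_
      exact fun Z _ => (hBC Z).continuousAt.continuousWithinAt
    obtain ⟨Z, ⟨hZb, hZk⟩, hZmax⟩ := hKc.exists_isMaxOn ⟨Y, hYK⟩ hFc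
    have hZpos : 0 < v Z - w Z - B Z := by
      have : v Y - w Y - B Y ≤ v Z - w Z - B Z := hZmax hYK
      linarith
    have hZs := hs_le Z hZb
    have hn0 : 0 ≤ n := by rw [hn]; positivity
    have hZk : 0 ≤ ⟪k, Z - m⟫_ℝ := hZk
    have hterm : 0 ≤ (n + 1) * (r * ⟪k, Z - m⟫_ℝ - ⟪k, Z - m⟫_ℝ ^ 2) :=
      mul_nonneg (by linarith) (by nlinarith)
    have hZr : ‖Z - m‖ < r := by
      refine lt_of_le_of_ne (mem_closedBall_iff_norm.1 hZb) fun h => ?_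
      have h1 : C ≤ B Z := by
        calc C = C / r ^ 2 * r ^ 2 := by field_simp
          _ ≤ B Z := by
            simp only [hB, h]
            gcongr
            linarith
      linarith [hosc Z hZb _ (hσ Z hZb)]
    have hZ0 : 0 < ⟪k, Z - m⟫_ℝ := by
      refine lt_of_le_of_ne hZk fun h => ?_
      have hfix : R (Z - m) = Z - m := by
        rw [hR, Submodule.reflection_eq_self_iff, Submodule.mem_orthogonal_singleton_iff_inner_right]
        exact h.symm
      have hwZ : w Z = v Z := by
        simp only [hw]
        rw [hRm, hfix, add_sub_cancel]
      have : 0 ≤ B Z := mul_nonneg (by positivity) (by positivity)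
      linarith
    have hKn : K ∈ 𝓝 Z := by
      have hc : Continuous fun Y : E => ⟪k, Y - m⟫_ℝ := by fun_prop
      filter_upwards [hc.continuousAt.eventually_const_lt hZ0,
        Metric.isOpen_ball.mem_nhds (mem_ball_iff_norm.2 hZr)] with Y h1 h2
      exact ⟨Metric.ball_subset_closedBall h2, h1.le⟩
    have hvw : ContDiffAt ℝ 2 (v - w) Z := (hv Z hZb).1.sub (hwH Z hZb).1
    have hvwB : ContDiffAt ℝ 2 (v - w - B) Z := hvw.sub (hBC Z)
    have hle : Δ (v - w - B) Z ≤ 0 :=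
      laplacian_nonpos_of_isLocalMax hvwB (hZmax.isLocalMax hKn)
    rw [hvw.laplacian_sub (hBC Z),
      (hv Z hZb).1.laplacian_sub (hwH Z hZb).1, (hv Z hZb).2.self_of_nhds,
      (hwH Z hZb).2.self_of_nhds, (laplacian_quadratic_barrier m k hk _ _ _ Z).2] at hle
    have : 0 < C / r ^ 2 := by positivity
    simp only [Pi.zero_apply] at hle
    nlinarith
  have hin : ⟪k, m + ξ • k - m⟫_ℝ = ξ := by
    rw [add_sub_cancel_left, inner_smul_right, real_inner_self_eq_norm_sq, hk]; ring
  have hno : ‖m + ξ • k - m‖ = ξ := by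
    rw [add_sub_cancel_left, norm_smul, hk, Real.norm_of_nonneg h0, mul_one]
  have hXK : m + ξ • k ∈ K := by
    refine ⟨mem_closedBall_iff_norm.2 (hno.trans_le hξ), ?_⟩
    change 0 ≤ ⟪k, m + ξ • k - m⟫_ℝ
    rwa [hin]
  have h1 := hmain _ hXK
  have hwX : w (m + ξ • k) = v (m - ξ • k) := by
    simp only [hw]
    rw [hRm, add_sub_cancel_left, map_smul, hRk, smul_neg, sub_eq_add_neg]
  rw [hwX] at h1
  refine h1.trans ?_
  simp only [hB]
  rw [hin, hno, div_mul_eq_mul_div, div_le_div_iff₀ (by positivity) hr]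
  have hn0 : 0 ≤ n := by rw [hn]; positivity
  have : ξ ^ 2 + (n + 1) * (r * ξ - ξ ^ 2) ≤ (n + 2) * (ξ * r) := by
    nlinarith [mul_nonneg hn0 (sq_nonneg ξ)]
  calc C * (ξ ^ 2 + (n + 1) * (r * ξ - ξ ^ 2)) * r ≤ C * ((n + 2) * (ξ * r)) * r := by gcongr
    _ = C * (n + 2) * ξ * r ^ 2 := by ring

lemma sub_le_of_harmonicOnNhd_closedBall {v : E → ℝ} {P : E} {R C : ℝ} (hR : 0 < R)
    (hC : 0 < C) (hv : HarmonicOnNhd v (Metric.closedBall P R))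
    (hosc : ∀ X ∈ Metric.closedBall P R, ∀ Y ∈ Metric.closedBall P R, v X - v Y ≤ C)
    {X : E} (hX : ‖X - P‖ ≤ R / 2) :
    v X - v P ≤ C * (Module.finrank ℝ E + 2) * ‖X - P‖ / R := by
  rcases eq_or_ne X P with rfl | hXP
  · simp
  have hpos : 0 < ‖X - P‖ := norm_pos_iff.2 (sub_ne_zero.2 hXP)
  set k : E := ‖X - P‖⁻¹ • (X - P) with hk
  set m : E := P + (‖X - P‖ / 2) • k with hm
  have hk1 : ‖k‖ = 1 := by
    rw [hk, norm_smul, norm_inv, norm_norm, inv_mul_cancel₀ hpos.ne']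
  have hmP : dist m P = ‖X - P‖ / 2 := by
    rw [hm, dist_eq_norm, add_sub_cancel_left, norm_smul, hk1, mul_one,
      Real.norm_of_nonneg (by positivity)]
  have hsub : Metric.closedBall m (R / 2) ⊆ Metric.closedBall P R :=
    Metric.closedBall_subset_closedBall' (by linarith)
  have h := reflection_difference_le hk1 (half_pos hR) hC (hv.mono hsub)
    (fun X hX Y hY => hosc X (hsub hX) Y (hsub hY)) (ξ := ‖X - P‖ / 2) (by positivity)
    (by linarith)
  have h1 : m + (‖X - P‖ / 2) • k = X := by
    rw [hm, add_assoc, ← add_smul, add_halves, hk, smul_smul, mul_inv_cancel₀ hpos.ne', one_smul,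
      add_sub_cancel]
  have h2 : m - (‖X - P‖ / 2) • k = P := by rw [hm, add_sub_cancel_right]
  rw [h1, h2] at h
  refine h.trans_eq ?_
  field_simp

end

section

variable {E : Type*} [NormedAddCommGroup E] [InnerProductSpace ℝ E]

lemma tendsto_nhdsWithin_add_smul {e : E} (he : ‖e‖ = 1) {X : E} (hX : 0 ≤ ⟪e, X⟫_ℝ) :
    Tendsto (fun t : ℝ => X + t • e) (𝓝[>] 0) (𝓝[{Z | 0 ≤ ⟪e, Z⟫_ℝ}] X) := by
  refine tendsto_nhdsWithin_iff.2 ⟨?_, ?_⟩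
  · have : Continuous (fun t : ℝ => X + t • e) := by fun_prop
    simpa using (this.tendsto 0).mono_left nhdsWithin_le_nhds
  · filter_upwards [self_mem_nhdsWithin] with t (ht : 0 < t)
    rw [inner_add_right, inner_smul_right, real_inner_self_eq_norm_sq, he]
    linarith

variable [FiniteDimensional ℝ E]

lemma HalfSpaceSubsolution.tendsto_atTop_normal {e : E} (he : ‖e‖ = 1) {v : E → ℝ}
    (hv : HalfSpaceSubsolution e v) {C S : ℝ} (hC : ∀ X, 0 ≤ ⟪e, X⟫_ℝ → |v X| ≤ C)
    (hS : IsLUB (v '' {X | 0 ≤ ⟪e, X⟫_ℝ}) S) (hS0 : 0 < S) {b : E} (hb : ⟪e, b⟫_ℝ = 0) :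
    Tendsto (fun R : ℝ => v (b + R • e)) atTop (𝓝 S) := by
  have hle : ∀ X, 0 ≤ ⟪e, X⟫_ℝ → v X ≤ S := fun X hX => hS.1 ⟨X, hX, rfl⟩
  have hin : ∀ R : ℝ, ⟪e, b + R • e⟫_ℝ = R := fun R => by
    rw [inner_add_right, inner_smul_right, real_inner_self_eq_norm_sq, he, hb]; ring
  refine tendsto_order.2 ⟨fun a ha => ?_, fun a ha => ?_⟩
  swap
  · filter_upwards [eventually_ge_atTop 0] with R hR
    exact (hle _ ((hin R).symm ▸ hR)).trans_lt ha
  obtain ⟨δ, hδ, hδS, hδa⟩ : ∃ δ, 0 < δ ∧ δ ≤ S ∧ a ≤ S - δ :=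
    ⟨min (S - a) S, lt_min (by linarith) hS0, min_le_right _ _,
      by linarith [min_le_left (S - a) S]⟩
  have hC0 : 0 < C := by
    obtain ⟨_, ⟨X, hX, rfl⟩, hX0, -⟩ := hS.exists_between hS0
    exact hX0.trans_le ((le_abs_self _).trans (hC X hX))
  set n : ℝ := (Module.finrank ℝ E : ℝ) with hn
  have hn0 : 0 ≤ n := by rw [hn]; positivity
  set κ : ℝ := min (1 / 4) (δ / (8 * C * (n + 2))) with hκ
  have hκ0 : 0 < κ := by rw [hκ]; positivity
  have hκ4 : κ ≤ 1 / 4 := min_le_left _ _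
  have hκδ : 4 * C * (n + 2) * κ ≤ δ / 2 := by
    have h : κ ≤ δ / (8 * C * (n + 2)) := min_le_right _ _
    rw [le_div_iff₀ (by positivity)] at h
    linarith
  set ε : ℝ := δ / 2 * ((4 / κ ^ 2) ^ (-(n + 1)) - (9 / κ ^ 2) ^ (-(n + 1))) with hε
  have hε0 : 0 < ε := by
    refine mul_pos (by linarith) (sub_pos.2 ?_)
    exact Real.rpow_lt_rpow_of_neg (by positivity) (by gcongr; norm_num) (by linarith)
  have hεδ : ε ≤ δ / 2 := by
    have h1 : (4 / κ ^ 2) ^ (-(n + 1)) ≤ 1 := by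
      refine Real.rpow_le_one_of_one_le_of_nonpos ?_ (by linarith)
      rw [one_le_div (by positivity)]
      nlinarith
    have h2 : 0 ≤ (9 / κ ^ 2) ^ (-(n + 1)) := by positivity
    nlinarith
  obtain ⟨_, ⟨X₁, hX₁, rfl⟩, hX₁S, -⟩ := hS.exists_between (sub_lt_self S hε0)
  filter_upwards [eventually_gt_atTop 0, eventually_ge_atTop ‖X₁ - b‖] with R hR hRX
  by_contra! hcon
  set P := b + R • e with hP
  have hPe : ⟪e, P⟫_ℝ = R := hin R
  have hballP : ∀ X ∈ Metric.closedBall P (R / 2), 0 < ⟪e, X⟫_ℝ := fun X hX => by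
    rw [mem_closedBall_iff_norm] at hX
    have h1 : ⟪e, P - X⟫_ℝ ≤ ‖P - X‖ := by
      simpa [he] using real_inner_le_norm e (P - X)
    rw [inner_sub_right, hPe, norm_sub_rev] at h1
    linarith
  have hball : ∀ X, ‖X - P‖ ≤ κ * R → v X ≤ S - δ / 2 := fun X hX => by
    have h := sub_le_of_harmonicOnNhd_closedBall (half_pos hR) (mul_pos two_pos hC0)
      (hv.harmonicOn.mono hballP) (fun X hX Y hY => by
        linarith [abs_le.1 (hC X (hballP X hX).le), abs_le.1 (hC Y (hballP Y hY).le)])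
      (X := X) (hX.trans (by nlinarith))
    have h2 : 2 * C * (n + 2) * ‖X - P‖ / (R / 2) ≤ 4 * C * (n + 2) * κ := by
      rw [div_le_iff₀ (by positivity)]
      calc 2 * C * (n + 2) * ‖X - P‖ ≤ 2 * C * (n + 2) * (κ * R) := by gcongr
        _ = 4 * C * (n + 2) * κ * (R / 2) := by ring
    rw [← hn] at h
    linarith
  have hX₁P : ‖X₁ - P‖ ≤ 2 * R := by
    calc ‖X₁ - P‖ = ‖(X₁ - b) - R • e‖ := by rw [hP, sub_sub]
      _ ≤ ‖X₁ - b‖ + ‖R • e‖ := norm_sub_le _ _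
      _ ≤ 2 * R := by rw [norm_smul, he, Real.norm_of_nonneg hR.le]; linarith
  rcases lt_or_ge ‖X₁ - P‖ (κ * R) with hlt | hge
  · linarith [hball X₁ hlt.le]
  have hκR : 0 < κ * R := by positivity
  have h := hv.le_sub_radial he hle hκR (hPe.symm ▸ hR) (half_pos hδ) (by linarith) hball
    (p := n + 1) (M := 3 * R) (by linarith) (by linarith) hX₁ hge (by linarith)
  have h9 : (3 * R) ^ 2 / (κ * R) ^ 2 = 9 / κ ^ 2 := by field_simp; norm_num
  have h4 : (4 / κ ^ 2) ^ (-(n + 1)) ≤ (‖X₁ - P‖ ^ 2 / (κ * R) ^ 2) ^ (-(n + 1)) := by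
    have hpos : 0 < ‖X₁ - P‖ := hκR.trans_le hge
    refine Real.rpow_le_rpow_of_nonpos (by positivity) ?_ (by linarith)
    calc ‖X₁ - P‖ ^ 2 / (κ * R) ^ 2 ≤ (2 * R) ^ 2 / (κ * R) ^ 2 := by gcongr
      _ = 4 / κ ^ 2 := by field_simp; norm_num
  rw [h9] at h
  nlinarith

lemma HalfSpaceSubsolution.eq_of_finrank_eq_two {e : E} (he : ‖e‖ = 1) {v : E → ℝ}
    (hv : HalfSpaceSubsolution e v) (hE : Module.finrank ℝ E = 2) {S : ℝ}
    (hS : IsLUB (v '' {X | 0 ≤ ⟪e, X⟫_ℝ}) S) (hS0 : 0 < S) {X : E} (hX : 0 ≤ ⟪e, X⟫_ℝ) :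
    v X = S := by
  have hle : ∀ X, 0 ≤ ⟪e, X⟫_ℝ → v X ≤ S := fun X hX => hS.1 ⟨X, hX, rfl⟩
  have hint : ∀ P, 0 < ⟪e, P⟫_ℝ → v P = S := by
    intro P hP
    refine (hle P hP.le).antisymm ?_
    by_contra! hlt
    obtain ⟨δ, hδ, hδS, hδv⟩ : ∃ δ, 0 < δ ∧ δ ≤ S ∧ v P < S - δ :=
      ⟨min ((S - v P) / 2) S, lt_min (by linarith) hS0, min_le_right _ _,
        by linarith [min_le_left ((S - v P) / 2) S]⟩
    obtain ⟨ρ, hρ, hball⟩ := Metric.nhds_basis_closedBall.eventually_iff.1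
      ((hv.harmonicOn P hP).1.continuousAt.eventually_lt_const hδv)
    have hball : ∀ X, ‖X - P‖ ≤ ρ → v X ≤ S - δ := fun X hX =>
      (hball (mem_closedBall_iff_norm.2 hX)).le
    have hbound : ∀ X, 0 ≤ ⟪e, X⟫_ℝ → v X ≤ S - δ := by
      intro X hX
      rcases lt_or_ge ‖X - P‖ ρ with hlt | hge
      · exact hball X hlt.le
      set q := ‖X - P‖ ^ 2 / ρ ^ 2 with hq
      have hq0 : 0 < q := by
        have := hρ.trans_le hge
        positivity
      have hpow : ∀ p : ℝ, 0 < p → v X ≤ S - δ * q ^ (-p) := by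
        intro p hp
        have hlim : Tendsto (fun M : ℝ => S - δ * (q ^ (-p) - (M ^ 2 / ρ ^ 2) ^ (-p))) atTop
            (𝓝 (S - δ * (q ^ (-p) - 0))) := by
          have h1 : Tendsto (fun M : ℝ => M ^ 2 / ρ ^ 2) atTop atTop :=
            (tendsto_pow_atTop two_ne_zero).atTop_div_const (by positivity)
          exact (((tendsto_rpow_neg_atTop hp).comp h1).const_sub _).const_mul δ |>.const_sub S
        rw [sub_zero] at hlim
        refine ge_of_tendsto hlim ?_
        filter_upwards [eventually_ge_atTop ‖X - P‖] with M hM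
        refine hv.le_sub_radial he hle hρ hP hδ hδS hball hp ?_ hX hge hM
        rw [hE]
        push_cast
        linarith
      have hlim : Tendsto (fun p : ℝ => S - δ * q ^ (-p)) (𝓝[>] 0) (𝓝 (S - δ * 1)) := by
        have hc : Continuous fun p : ℝ => S - δ * q ^ (-p) :=
          continuous_const.sub (continuous_const.mul
            ((Real.continuous_const_rpow hq0.ne').comp continuous_neg))
        simpa using (hc.tendsto 0).mono_left nhdsWithin_le_nhds
      rw [mul_one] at hlim
      refine ge_of_tendsto hlim ?_
      filter_upwards [self_mem_nhdsWithin] with p hp using hpow p hp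
    have : S ≤ S - δ := hS.2 (by rintro _ ⟨X, hX, rfl⟩; exact hbound X hX)
    linarith
  refine tendsto_nhds_unique
    ((hv.continuousOn X hX).tendsto.comp (tendsto_nhdsWithin_add_smul he hX)) ?_
  refine tendsto_const_nhds.congr' ?_
  filter_upwards [self_mem_nhdsWithin] with t (ht : 0 < t)
  refine (hint _ ?_).symm
  rw [inner_add_right, inner_smul_right, real_inner_self_eq_norm_sq, he]
  linarith

end

section

variable {E : Type*} [NormedAddCommGroup E] [InnerProductSpace ℝ E]

/-- The linear map of the Euclidean plane sending the standard basis to `a` and `e`. -/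
def planeMap (a e : E) : EuclideanSpace ℝ (Fin 2) →ₗ[ℝ] E where
  toFun z := z 0 • a + z 1 • e
  map_add' z w := by simp [add_smul]; abel
  map_smul' c z := by simp [mul_smul]

lemma inner_planeMap_right {a e : E} (he : ‖e‖ = 1) (hae : ⟪a, e⟫_ℝ = 0)
    (z : EuclideanSpace ℝ (Fin 2)) : ⟪e, planeMap a e z⟫_ℝ = z 1 := by
  simp [planeMap, inner_add_right, inner_smul_right, real_inner_comm a e, hae, he]

variable [FiniteDimensional ℝ E]

lemma harmonicAt_comp_planeMap {a e : E} (ha : ‖a‖ = 1) (he : ‖e‖ = 1) (hae : ⟪a, e⟫_ℝ = 0)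
    {v : E → ℝ} (hv : HarmonicOnNhd v {X | 0 < ⟪e, X⟫_ℝ})
    (hinv : ∀ X k, 0 < ⟪e, X⟫_ℝ → ⟪e, k⟫_ℝ = 0 → ⟪a, k⟫_ℝ = 0 → v (X + k) = v X)
    {z : EuclideanSpace ℝ (Fin 2)} (hz : 0 < z 1) :
    HarmonicAt (fun z => v (planeMap a e z)) z := by
  set f : EuclideanSpace ℝ (Fin 2) → ℝ := fun z => v (planeMap a e z) with hf
  have hcont : ∀ z : EuclideanSpace ℝ (Fin 2), 0 < z 1 → ContDiffAt ℝ 2 f z := fun z hz =>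
    ContDiffAt.comp z (hv _ (by simpa [inner_planeMap_right he hae] using hz)).1
      (planeMap a e).toContinuousLinearMap.contDiff.contDiffAt
  refine ⟨hcont z hz, ?_⟩
  have hopen : ∀ᶠ y : EuclideanSpace ℝ (Fin 2) in 𝓝 z, 0 < y 1 := by
    have : Continuous fun y : EuclideanSpace ℝ (Fin 2) => y 1 := by fun_prop
    exact this.continuousAt.eventually_const_lt hz
  filter_upwards [hopen] with y hy
  have hye : 0 < ⟪e, planeMap a e y⟫_ℝ := by rwa [inner_planeMap_right he hae]
  have hne : a ≠ e := by
    rintro rfl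
    simp [ha] at hae
  have hon : Orthonormal ℝ ((↑) : ({a, e} : Set E) → E) := by
    refine ⟨?_, ?_⟩
    · rintro ⟨x, rfl | rfl⟩ <;> assumption
    · rintro ⟨x, rfl | rfl⟩ ⟨y, rfl | rfl⟩ hxy
      · exact absurd rfl hxy
      · exact hae
      · rw [real_inner_comm]; exact hae
      · exact absurd rfl hxy
  obtain ⟨s, b, hs, hb⟩ := hon.exists_orthonormalBasis_extension
  set g : E → ℝ := fun w => deriv (deriv fun t : ℝ => v (planeMap a e y + t • w)) 0 with hg
  have hsum : ∑ i, g (b i) = g a + g e := by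
    classical
    rw [hb, Finset.sum_coe_sort s g, ← Finset.sum_pair hne]
    symm
    refine Finset.sum_subset (fun x hx => hs (by simpa using hx)) fun x hx hxn => ?_
    have horth : ∀ c ∈ s, x ≠ c → ⟪c, x⟫_ℝ = 0 := fun c hc hxc => by
      have := b.orthonormal.2 (i := ⟨c, hc⟩) (j := ⟨x, hx⟩) (by simpa using hxc.symm)
      simpa [hb] using this
    simp only [Finset.mem_insert, Finset.mem_singleton, not_or] at hxn
    have hconst : (fun t : ℝ => v (planeMap a e y + t • x)) = fun _ => v (planeMap a e y) := by
      ext t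
      refine hinv _ _ hye ?_ ?_
      · rw [inner_smul_right, horth e (hs (by simp)) hxn.2, mul_zero]
      · rw [inner_smul_right, horth a (hs (by simp)) hxn.1, mul_zero]
    simp [hg, hconst]
  rw [laplacian_eq_sum_deriv_deriv_line (EuclideanSpace.basisFun (Fin 2) ℝ) (hcont y hy)]
  have h0 := (hv _ hye).2.self_of_nhds
  rw [laplacian_eq_sum_deriv_deriv_line b (hv _ hye).1] at h0
  have h1 : g a + g e = 0 := hsum.symm.trans h0
  rw [Fin.sum_univ_two]
  simpa [hf, hg, planeMap, add_smul, add_assoc, add_comm, add_left_comm] using h1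

lemma HalfSpaceSubsolution.eq_of_invariant {a e : E} (ha : ‖a‖ = 1) (he : ‖e‖ = 1)
    (hae : ⟪a, e⟫_ℝ = 0) {v : E → ℝ} (hv : HalfSpaceSubsolution e v)
    (hinv : ∀ X k, 0 ≤ ⟪e, X⟫_ℝ → ⟪e, k⟫_ℝ = 0 → ⟪a, k⟫_ℝ = 0 → v (X + k) = v X) {S : ℝ}
    (hS : IsLUB (v '' {X | 0 ≤ ⟪e, X⟫_ℝ}) S) (hS0 : 0 < S) {X : E} (hX : 0 ≤ ⟪e, X⟫_ℝ) :
    v X = S := by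
  set f : EuclideanSpace ℝ (Fin 2) := EuclideanSpace.single 1 1 with hf
  have hfin : ∀ z : EuclideanSpace ℝ (Fin 2), ⟪f, z⟫_ℝ = z 1 := fun z => by
    simp [hf, EuclideanSpace.inner_single_left]
  have hf1 : ‖f‖ = 1 := by simp [hf]
  have hι := inner_planeMap_right he hae
  have hproj : ∀ X, 0 ≤ ⟪e, X⟫_ℝ → v (planeMap a e !₂[⟪a, X⟫_ℝ, ⟪e, X⟫_ℝ]) = v X := by
    intro X hX
    have hea : ⟪e, a⟫_ℝ = 0 := by rwa [real_inner_comm]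
    have h := hinv (planeMap a e !₂[⟪a, X⟫_ℝ, ⟪e, X⟫_ℝ])
      (X - planeMap a e !₂[⟪a, X⟫_ℝ, ⟪e, X⟫_ℝ]) (by rw [hι]; simpa using hX)
      (by rw [inner_sub_right, hι]; simp)
      (by simp [planeMap, inner_sub_right, inner_add_right, inner_smul_right, ha, hae])
    rw [← h, add_sub_cancel]
  have hw : HalfSpaceSubsolution f (fun z => v (planeMap a e z)) := by
    refine ⟨?_, ?_, ?_⟩
    · refine hv.continuousOn.comp (planeMap a e).toContinuousLinearMap.continuous.continuousOn ?_
      intro z hz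
      simpa [hfin, hι] using hz
    · intro z hz
      exact harmonicAt_comp_planeMap ha he hae hv.harmonicOn (fun X k hX => hinv X k hX.le)
        (by simpa [hfin] using hz)
    · intro z hz hvz
      obtain ⟨L, hL, hLt⟩ := hv.slope_nonneg _ (by rw [hι, ← hfin, hz]) hvz
      refine ⟨L, hL, ?_⟩
      have hfe : planeMap a e f = e := by simp [planeMap, hf]
      simpa [map_add, map_smul, hfe] using hLt
  have himg : (fun z => v (planeMap a e z)) '' {z | 0 ≤ ⟪f, z⟫_ℝ} = v '' {X | 0 ≤ ⟪e, X⟫_ℝ} := by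
    ext y
    constructor
    · rintro ⟨z, hz, rfl⟩
      exact ⟨planeMap a e z, by simpa [hfin, hι] using hz, rfl⟩
    · rintro ⟨X, hX, rfl⟩
      exact ⟨_, by simpa [hfin] using hX, hproj X hX⟩
  rw [← hproj X hX]
  exact hw.eq_of_finrank_eq_two hf1 (by simp) (himg ▸ hS) hS0 (by simpa [hfin] using hX)

end

section

variable {E : Type*} [NormedAddCommGroup E] [InnerProductSpace ℝ E]

lemma inner_add_of_inner_eq_zero {e h X : E} (hh : ⟪e, h⟫_ℝ = 0) : ⟪e, X + h⟫_ℝ = ⟪e, X⟫_ℝ := by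
  rw [inner_add_right, hh, add_zero]

variable [FiniteDimensional ℝ E]

/-- `u` is a Lipschitz solution of the two-phase thin obstacle problem, with constant nonlinearity
`θ` and zero obstacle, in the half-space `{⟪e, X⟫ ≥ 0}`. -/
structure TwoPhaseHalfSpaceSolution (e : E) (θ : ℝ) (K : NNReal) (u : E → ℝ) : Prop where
  lipschitzOn : LipschitzOnWith K u {X | 0 ≤ ⟪e, X⟫_ℝ}
  harmonicOn : HarmonicOnNhd u {X | 0 < ⟪e, X⟫_ℝ}
  slope : ∀ X, ⟪e, X⟫_ℝ = 0 → ∃ L,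
    Tendsto (fun t : ℝ => (u (X + t • e) - u X) / t) (𝓝[>] 0) (𝓝 L) ∧ |L| ≤ θ ∧
      (u X ≠ 0 → L = θ * Real.sign (u X))

namespace TwoPhaseHalfSpaceSolution

variable {e : E} {θ : ℝ} {K : NNReal} {u : E → ℝ}

lemma halfSpaceSubsolution_sub (hu : TwoPhaseHalfSpaceSolution e θ K u) {h : E}
    (hh : ⟪e, h⟫_ℝ = 0) : HalfSpaceSubsolution e (fun X => u (X + h) - u X) := by
  refine ⟨?_, ?_, ?_⟩
  · refine (hu.lipschitzOn.continuousOn.comp (by fun_prop) fun X hX => ?_).sub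
      hu.lipschitzOn.continuousOn
    change 0 ≤ ⟪e, X + h⟫_ℝ
    rwa [inner_add_of_inner_eq_zero hh]
  · intro X hX
    have h1 : HarmonicAt (fun Z => u (h + LinearIsometryEquiv.refl ℝ E Z)) X := by
      refine HarmonicAt.comp_add_linearIsometryEquiv (hu.harmonicOn _ ?_)
      change 0 < ⟪e, h + X⟫_ℝ
      rwa [add_comm, inner_add_of_inner_eq_zero hh]
    have h2 : HarmonicAt (fun Z => u (Z + h)) X := by simpa [add_comm] using h1
    exact h2.sub (hu.harmonicOn X hX)
  · intro X hX hpos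
    obtain ⟨L₁, hL₁, hθ₁, hs₁⟩ := hu.slope (X + h) (by rw [inner_add_of_inner_eq_zero hh, hX])
    obtain ⟨L₂, hL₂, hθ₂, hs₂⟩ := hu.slope X hX
    refine ⟨L₁ - L₂, ?_, ?_⟩
    · rw [abs_le] at hθ₁ hθ₂
      rcases lt_or_ge 0 (u (X + h)) with h1 | h1
      · rw [hs₁ h1.ne', Real.sign_of_pos h1]; linarith
      · have h2 : u X < 0 := by linarith
        rw [hs₂ h2.ne, Real.sign_of_neg h2]; linarith
    · refine (hL₁.sub hL₂).congr fun t => ?_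
      rw [add_right_comm X h]
      ring

lemma abs_sub_le (hu : TwoPhaseHalfSpaceSolution e θ K u) {h : E} (hh : ⟪e, h⟫_ℝ = 0) (X : E)
    (hX : 0 ≤ ⟪e, X⟫_ℝ) : |u (X + h) - u X| ≤ K * ‖h‖ := by
  have := hu.lipschitzOn.dist_le_mul (X + h) (by simpa [inner_add_of_inner_eq_zero hh] using hX) X hX
  simpa [Real.dist_eq, dist_eq_norm] using this

lemma tendsto_sub_of_pos (hu : TwoPhaseHalfSpaceSolution e θ K u) (he : ‖e‖ = 1) {h : E}
    (hh : ⟪e, h⟫_ℝ = 0) {Y : E} (hY : 0 ≤ ⟪e, Y⟫_ℝ) (hpos : 0 < u (Y + h) - u Y) :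
    ∃ S, 0 < S ∧ IsLUB ((fun X => u (X + h) - u X) '' {X | 0 ≤ ⟪e, X⟫_ℝ}) S ∧
      ∀ b, ⟪e, b⟫_ℝ = 0 →
        Tendsto (fun R : ℝ => u (b + R • e + h) - u (b + R • e)) atTop (𝓝 S) := by
  have hlub := isLUB_csSup (s := (fun X => u (X + h) - u X) '' {X | 0 ≤ ⟪e, X⟫_ℝ}) ⟨_, Y, hY, rfl⟩
    ⟨K * ‖h‖, by rintro _ ⟨X, hX, rfl⟩; exact (le_abs_self _).trans (hu.abs_sub_le hh X hX)⟩
  have hS0 := hpos.trans_le (hlub.1 ⟨Y, hY, rfl⟩)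
  exact ⟨_, hS0, hlub, fun b hb => (hu.halfSpaceSubsolution_sub hh).tendsto_atTop_normal he
    (hu.abs_sub_le hh) hlub hS0 hb⟩

lemma exists_tendsto_sub (hu : TwoPhaseHalfSpaceSolution e θ K u) (he : ‖e‖ = 1) {h : E}
    (hh : ⟪e, h⟫_ℝ = 0) :
    ∃ A, (∀ b, ⟪e, b⟫_ℝ = 0 →
        Tendsto (fun R : ℝ => u (b + R • e + h) - u (b + R • e)) atTop (𝓝 A)) ∧
      (0 < A → IsLUB ((fun X => u (X + h) - u X) '' {X | 0 ≤ ⟪e, X⟫_ℝ}) A) ∧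
      (A = 0 → ∀ X, 0 ≤ ⟪e, X⟫_ℝ → u (X + h) = u X) := by
  by_cases h1 : ∃ Y, 0 ≤ ⟪e, Y⟫_ℝ ∧ 0 < u (Y + h) - u Y
  · obtain ⟨Y, hY, hpos⟩ := h1
    obtain ⟨S, hS0, hlub, hS⟩ := hu.tendsto_sub_of_pos he hh hY hpos
    exact ⟨S, hS, fun _ => hlub, fun h => absurd h hS0.ne'⟩
  have hh' : ⟪e, -h⟫_ℝ = 0 := by rw [inner_neg_right, hh, neg_zero]
  by_cases h2 : ∃ Y, 0 ≤ ⟪e, Y⟫_ℝ ∧ 0 < u (Y + -h) - u Y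
  · obtain ⟨Y, hY, hpos⟩ := h2
    obtain ⟨S, hS0, -, hS⟩ := hu.tendsto_sub_of_pos he hh' hY hpos
    refine ⟨-S, fun b hb => ?_, fun h => by linarith, fun h => by linarith⟩
    refine (hS (b + h) (by rw [inner_add_of_inner_eq_zero hh, hb])).neg.congr fun R => ?_
    rw [add_right_comm b h, add_neg_cancel_right]
    ring
  push Not at h1 h2
  have heq : ∀ X, 0 ≤ ⟪e, X⟫_ℝ → u (X + h) = u X := fun X hX => by
    have := h2 (X + h) (by rwa [inner_add_of_inner_eq_zero hh])
    rw [add_neg_cancel_right] at this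
    linarith [h1 X hX]
  refine ⟨0, fun b hb => ?_, fun h => absurd h (lt_irrefl _), fun _ => heq⟩
  refine tendsto_const_nhds.congr' ?_
  filter_upwards [eventually_ge_atTop 0] with R hR
  rw [heq, sub_self]
  rw [inner_add_right, hb, inner_smul_right, real_inner_self_eq_norm_sq, he]
  linarith

/-- A solution cannot increase by a positive constant under a tangential translation. -/
lemma false_of_translation (hu : TwoPhaseHalfSpaceSolution e θ K u) (hθ : 0 < θ) (he : ‖e‖ = 1)
    (h0 : u 0 = 0) {a : E} (ha : ⟪e, a⟫_ℝ = 0) {S : ℝ} (hS : 0 < S)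
    (htr : ∀ X, 0 ≤ ⟪e, X⟫_ℝ → u (X + a) - u X = S) : False := by
  have ha' : ⟪e, -a⟫_ℝ = 0 := by rw [inner_neg_right, ha, neg_zero]
  obtain ⟨L₁, hL₁, -, hs₁⟩ := hu.slope a ha
  obtain ⟨L₂, hL₂, -, hs₂⟩ := hu.slope (-a) ha'
  have hu1 : u a = S := by
    have := htr 0 (by simp)
    rw [zero_add, h0] at this
    linarith
  have hu2 : u (-a) = -S := by
    have := htr (-a) ha'.ge
    rw [neg_add_cancel, h0] at this
    linarith
  have hL : L₁ = L₂ := by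
    refine tendsto_nhds_unique hL₁ (hL₂.congr' ?_)
    filter_upwards [self_mem_nhdsWithin] with t (ht : 0 < t)
    have hte : 0 ≤ ⟪e, t • e⟫_ℝ := by
      rw [inner_smul_right, real_inner_self_eq_norm_sq, he]
      linarith
    have h1 := htr (t • e) hte
    have h2 := htr (-a + t • e) (by rwa [inner_add_right, ha', zero_add])
    rw [neg_add_cancel_comm] at h2
    rw [hu1, hu2, add_comm a]
    congr 1
    linarith
  rw [hs₁ (by rw [hu1]; exact hS.ne'), hs₂ (by rw [hu2]; linarith), hu1, hu2,
    Real.sign_of_pos hS, Real.sign_of_neg (neg_lt_zero.2 hS)] at hL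
  linarith

theorem eq_zero (hu : TwoPhaseHalfSpaceSolution e θ K u) (hθ : 0 < θ) (he : ‖e‖ = 1)
    (h0 : u 0 = 0) {X : E} (hX : ⟪e, X⟫_ℝ = 0) : u X = 0 := by
  have hW : ∀ h : (ℝ ∙ e)ᗮ, ⟪e, (h : E)⟫_ℝ = 0 := fun h =>
    Submodule.mem_orthogonal_singleton_iff_inner_right.1 h.2
  choose A hA hAlub hA0 using fun h : (ℝ ∙ e)ᗮ => hu.exists_tendsto_sub he (hW h)
  have he0 : ⟪e, (0 : E)⟫_ℝ = 0 := inner_zero_right e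
  have hadd : ∀ h k, A (h + k) = A h + A k := fun h k => by
    refine tendsto_nhds_unique (hA (h + k) 0 he0) (((hA h k (hW k)).add (hA k 0 he0)).congr ?_)
    intro R
    rw [Submodule.coe_add, zero_add, add_comm (k : E), add_assoc, add_comm (k : E) h]
    ring
  have hbound : ∀ h, ‖A h‖ ≤ K * ‖h‖ := fun h => by
    refine le_of_tendsto (hA h 0 he0).norm ?_
    filter_upwards [eventually_ge_atTop 0] with R hR
    refine hu.abs_sub_le (hW h) _ ?_
    rw [zero_add, inner_smul_right, real_inner_self_eq_norm_sq, he]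
    linarith
  set φ : (ℝ ∙ e)ᗮ →L[ℝ] ℝ := (AddMonoidHom.mk' A hadd).toRealLinearMap
    (AddMonoidHomClass.continuous_of_bound (AddMonoidHom.mk' A hadd) K hbound) with hφ
  set c := (toDual ℝ (ℝ ∙ e)ᗮ).symm φ with hc
  have hcA : ∀ h, A h = ⟪c, h⟫_ℝ := fun h => by
    rw [hc, toDual_symm_apply]
    rfl
  rcases eq_or_ne c 0 with hc0 | hc0
  · have hX' : X ∈ (ℝ ∙ e)ᗮ := Submodule.mem_orthogonal_singleton_iff_inner_right.2 hX
    have := hA0 ⟨X, hX'⟩ (by rw [hcA, hc0, inner_zero_left]) 0 (by simp)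
    rwa [zero_add, h0] at this
  exfalso
  have hcn : 0 < ‖c‖ := norm_pos_iff.2 hc0
  set a : (ℝ ∙ e)ᗮ := ‖c‖⁻¹ • c with ha
  have ha1 : ‖(a : E)‖ = 1 := by
    rw [← Submodule.coe_norm, ha, norm_smul, norm_inv, norm_norm, inv_mul_cancel₀ hcn.ne']
  have hAa : A a = ‖c‖ := by
    rw [hcA, ha, inner_smul_right, real_inner_self_eq_norm_sq]
    field_simp
  have hAa0 : 0 < A a := hAa ▸ hcn
  have hinv : ∀ X k, 0 ≤ ⟪e, X⟫_ℝ → ⟪e, k⟫_ℝ = 0 → ⟪(a : E), k⟫_ℝ = 0 → u (X + k) = u X := by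
    intro X k hX hk hak
    refine hA0 ⟨k, Submodule.mem_orthogonal_singleton_iff_inner_right.2 hk⟩ ?_ X hX
    rw [hcA]
    have : ‖c‖⁻¹ * ⟪(c : E), k⟫_ℝ = 0 := by
      simpa [ha, inner_smul_left] using hak
    simpa [hc0] using this
  refine hu.false_of_translation hθ he h0 (hW a) hAa0 fun X hX => ?_
  refine (hu.halfSpaceSubsolution_sub (hW a)).eq_of_invariant ha1 he
    (by rw [real_inner_comm]; exact hW a) ?_ (hAlub a hAa0) hAa0 hX
  intro X k hX hk hak
  rw [add_right_comm, hinv (X + a) k (by rwa [inner_add_of_inner_eq_zero (hW a)]) hk hak,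
    hinv X k hX hk hak]

end TwoPhaseHalfSpaceSolution

end

/-- The inward unit normal of the half-space `{y > 0}`. -/
def verticalUnit (d : ℕ) : WithLp 2 (Esp d × ℝ) := WithLp.toLp 2 (0, 1)

lemma inner_verticalUnit (d : ℕ) (X : WithLp 2 (Esp d × ℝ)) : ⟪verticalUnit d, X⟫_ℝ = X.snd := by
  simp [verticalUnit, WithLp.prod_inner_apply]

lemma norm_verticalUnit (d : ℕ) : ‖verticalUnit d‖ = 1 := by
  simp [verticalUnit]

lemma laplacian_comp_ofLp_eq_lapH {d : ℕ} {u : Esp d × ℝ → ℝ} {X : WithLp 2 (Esp d × ℝ)}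
    (hu : ContDiffAt ℝ 2 (fun X : WithLp 2 (Esp d × ℝ) => u X.ofLp) X) :
    Δ (fun X : WithLp 2 (Esp d × ℝ) => u X.ofLp) X = lapH d u X.ofLp := by
  rw [laplacian_eq_sum_deriv_deriv_line
    ((EuclideanSpace.basisFun (Fin d) ℝ).prod (OrthonormalBasis.singleton Unit ℝ)) hu]
  rw [Fintype.sum_sum_type, lapH]
  congr 1
  · refine Finset.sum_congr rfl fun i _ => ?_
    congr 2
    ext t
    congr 1
    ext <;> simp
  · rw [Fintype.sum_unique]
    congr 2
    ext t
    congr 1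
    ext <;> simp

lemma harmonicOnNhd_comp_ofLp {d : ℕ} {u : Esp d × ℝ → ℝ}
    (hu : HarmonicOnH d u {p : Esp d × ℝ | 0 < p.2}) :
    HarmonicOnNhd (fun X : WithLp 2 (Esp d × ℝ) => u X.ofLp) {X | 0 < ⟪verticalUnit d, X⟫_ℝ} := by
  have hopen : IsOpen {p : Esp d × ℝ | 0 < p.2} := isOpen_lt continuous_const continuous_snd
  have hcont : ∀ X : WithLp 2 (Esp d × ℝ), 0 < X.snd →
      ContDiffAt ℝ 2 (fun X : WithLp 2 (Esp d × ℝ) => u X.ofLp) X := fun X hX =>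
    ContDiffAt.comp X (hu.1.contDiffAt (hopen.mem_nhds hX))
      (WithLp.prodContinuousLinearEquiv 2 ℝ (Esp d) ℝ).contDiff.contDiffAt
  intro X hX
  have hX : 0 < X.snd := by rwa [mem_ofPred_eq, inner_verticalUnit] at hX
  refine ⟨hcont X hX, ?_⟩
  have hc : Continuous fun Y : WithLp 2 (Esp d × ℝ) => Y.snd := by fun_prop
  filter_upwards [hc.continuousAt.eventually_const_lt hX] with Y hY
  rw [laplacian_comp_ofLp_eq_lapH (hcont Y hY)]
  exact hu.2 _ hY

/-- **classification of Lipschitz global solutions.** If `u` is Lipschitz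
on the closed half-space `{y ≥ 0}` of `ℝ^d × ℝ`, harmonic in the open half-space, its
one-sided vertical derivative on `{y = 0}` exists, is bounded by `θ` in absolute value,
and equals `θ·sign(u)` off `{u(·,0) = 0}`, and `u(0,0) = 0`, then `u(·,0) ≡ 0`. -/
theorem statement15
    (d : ℕ) (hd : 1 ≤ d) (θ : ℝ) (hθ : 0 < θ)
    (u : Esp d × ℝ → ℝ) (Lc : NNReal)
    (hLip : LipschitzOnWith Lc u {p : Esp d × ℝ | 0 ≤ p.2})
    (hharm : HarmonicOnH d u {p : Esp d × ℝ | 0 < p.2})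
    (hbdry : ∀ x : Esp d, ∃ L : ℝ, NormalDeriv d u x L ∧ |L| ≤ θ ∧
      (u (x, 0) ≠ 0 → L = θ * Real.sign (u (x, 0))))
    (h0 : u (0, 0) = 0) :
    ∀ x : Esp d, u (x, 0) = 0 := by
  intro x
  have hsol : TwoPhaseHalfSpaceSolution (verticalUnit d) θ Lc
      (fun X : WithLp 2 (Esp d × ℝ) => u X.ofLp) := by
    refine ⟨?_, harmonicOnNhd_comp_ofLp hharm, ?_⟩
    · have h := hLip.comp ((WithLp.prod_lipschitzWith_ofLp 2 (Esp d) ℝ).lipschitzOnWith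
        (s := {X | 0 ≤ ⟪verticalUnit d, X⟫_ℝ})) fun X hX => by
          rwa [mem_ofPred_eq, inner_verticalUnit] at hX
      simpa [Function.comp_def] using h
    · intro X hX
      rw [inner_verticalUnit] at hX
      obtain ⟨L, hL, hθL, hs⟩ := hbdry X.fst
      have hX' : (X.fst, (0 : ℝ)) = X.ofLp := Prod.ext rfl hX.symm
      refine ⟨L, hL.congr fun t => ?_, hθL, by rwa [hX'] at hs⟩
      have : (X.fst, t) = (X + t • verticalUnit d).ofLp := by
        ext <;> simp [verticalUnit, hX]
      rw [this, hX']
  exact hsol.eq_zero hθ (norm_verticalUnit d) h0 (X := WithLp.toLp 2 (x, 0))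
    (inner_verticalUnit d _)
end
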